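/- The group K_{n,k,l} admits a finite, ascending, injective L-presentation: there exist a finite set S, a finite subset R of the free group F(S), and a finite set Φ of injective endomorphisms of F(S), such that K_{n,k,l} is isomorphic to the quotient of F(S) by the normal closure of ⋃_{φ ∈ Φ*} φ(R), where Φ* is the closure of Φ ∪ {id} under composition (the submonoid of End(F(S)) generated by Φ). -/

import Mathlib

namespace Birman

/-- The generating set of the free group `F_{n,k,l}`: `X ∪ Y ∪ Z`. -/
abbrev Gen (n k l : ℕ) := Fin n ⊕ (Fin k ⊕ Fin l)

/-- The free group `F_{n,k,l}` on `X ∪ Y ∪ Z`. -/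
abbrev FG (n k l : ℕ) := FreeGroup (Gen n k l)

variable {n k l : ℕ}

/-- The generator `x_i`. -/
def xg (n k l : ℕ) (i : Fin n) : Gen n k l := Sum.inl i
/-- The generator `y_j`. -/
def yg (n k l : ℕ) (j : Fin k) : Gen n k l := Sum.inr (Sum.inl j)
/-- The generator `z_m`. -/
def zg (n k l : ℕ) (m : Fin l) : Gen n k l := Sum.inr (Sum.inr m)

/-- `A_{n,k,l}`: automorphisms sending each generator in `Y ∪ Z` to a conjugate of itself. -/
def A (n k l : ℕ) : Subgroup (MulAut (FG n k l)) where
  carrier := {f | ∀ s : Fin k ⊕ Fin l,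
    IsConj (FreeGroup.of (Sum.inr s : Gen n k l)) (f (FreeGroup.of (Sum.inr s)))}
  one_mem' := by
    intro s
    rw [MulAut.one_apply]
  mul_mem' := by
    intro f g hf hg s
    rw [MulAut.mul_apply]
    exact (hf s).trans (f.toMonoidHom.map_isConj (hg s))
  inv_mem' := by
    intro f hf s
    have h := (f⁻¹ : MulAut (FG n k l)).toMonoidHom.map_isConj (hf s)
    simp only [MulEquiv.toMonoidHom_eq_coe, MonoidHom.coe_coe] at h
    have h2 : (f⁻¹ : MulAut (FG n k l)) (f (FreeGroup.of (Sum.inr s))) = FreeGroup.of (Sum.inr s) :=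
      MulAut.inv_apply_self _ f _
    rw [h2] at h
    exact h.symm

/-- The projection `F_{n,k,l} → F_{n,0,l}` killing the generators in `Y`. -/
def proj (n k l : ℕ) : FG n k l →* FG n 0 l :=
  FreeGroup.lift fun g => match g with
    | Sum.inl i => FreeGroup.of (Sum.inl i)
    | Sum.inr (Sum.inl _) => 1
    | Sum.inr (Sum.inr m) => FreeGroup.of (Sum.inr (Sum.inr m))

/-- Automorphisms commuting with the projection to `F_{n,0,l}`, i.e. inducing the identity
on `F_{n,k,l}/N ≅ F_{n,0,l}`. -/
def fixProj (n k l : ℕ) : Subgroup (MulAut (FG n k l)) where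
  carrier := {f | ∀ w : FG n k l, proj n k l (f w) = proj n k l w}
  one_mem' := by intro w; simp
  mul_mem' := by
    intro f g hf hg w
    rw [MulAut.mul_apply]
    exact (hf (g w)).trans (hg w)
  inv_mem' := by
    intro f hf w
    have h := hf ((f⁻¹ : MulAut (FG n k l)) w)
    rw [MulAut.apply_inv_self] at h
    exact h.symm

/-- `K_{n,k,l}`, the kernel of `ρ : A_{n,k,l} → A_{n,0,l}`: those elements of `A_{n,k,l}`
that induce the identity automorphism of `F_{n,k,l}/N ≅ F_{n,0,l}`. -/
def K (n k l : ℕ) : Subgroup (MulAut (FG n k l)) := A n k l ⊓ fixProj n k l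

/-- `f` is the automorphism `M_{v,w}` : `v ↦ w v`, fixing all other generators. -/
def IsMul (f : MulAut (FG n k l)) (v w : Gen n k l) : Prop :=
  f (FreeGroup.of v) = FreeGroup.of w * FreeGroup.of v ∧
    ∀ u : Gen n k l, u ≠ v → f (FreeGroup.of u) = FreeGroup.of u

/-- `f` is the automorphism `M_{v⁻¹,w}` : `v ↦ v w⁻¹`, fixing all other generators. -/
def IsMulInv (f : MulAut (FG n k l)) (v w : Gen n k l) : Prop :=
  f (FreeGroup.of v) = FreeGroup.of v * (FreeGroup.of w)⁻¹ ∧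
    ∀ u : Gen n k l, u ≠ v → f (FreeGroup.of u) = FreeGroup.of u

/-- `f` is the automorphism `C_{v,w}` : `v ↦ w v w⁻¹`, fixing all other generators. -/
def IsConjGen (f : MulAut (FG n k l)) (v w : Gen n k l) : Prop :=
  f (FreeGroup.of v) = FreeGroup.of w * FreeGroup.of v * (FreeGroup.of w)⁻¹ ∧
    ∀ u : Gen n k l, u ≠ v → f (FreeGroup.of u) = FreeGroup.of u

end Birman

namespace BirmanAux

open FreeGroup (of reduce toWord_mul reduce_toWord toWord_mk mk_toWord isReduced_toWord isReduced_cons_cons)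

/-- letters -/
abbrev Lt (V : Type) := V × Bool

section letters
variable {V : Type}

def linv (x : Lt V) : Lt V := (x.1, !x.2)
@[simp] lemma linv_linv (x : Lt V) : linv (linv x) = x := by simp [linv]
@[simp] lemma linv_fst (x : Lt V) : (linv x).1 = x.1 := rfl
lemma linv_ne (x : Lt V) : linv x ≠ x := by
  intro h; have := congrArg Prod.snd h; simp [linv] at this
lemma ne_linv (x : Lt V) : x ≠ linv x := fun h => linv_ne x h.symm
lemma linv_inj {x y : Lt V} : linv x = linv y ↔ x = y :=
  ⟨fun h => by rw [← linv_linv x, h, linv_linv], fun h => by rw [h]⟩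
lemma linv_eq_comm {x y : Lt V} : linv x = y ↔ x = linv y := by
  constructor
  · rintro rfl; simp
  · rintro rfl; simp
lemma fst_eq_iff {x y : Lt V} : x.1 = y.1 ↔ x = y ∨ x = linv y := by
  obtain ⟨v, b⟩ := x; obtain ⟨w, c⟩ := y
  cases b <;> cases c <;> simp [linv]

def elt (x : Lt V) : FreeGroup V := FreeGroup.mk [x]
lemma elt_true (v : V) : elt (v, true) = of v := rfl
lemma elt_false (v : V) : elt (v, false) = (of v)⁻¹ := rfl
@[simp] lemma elt_linv (x : Lt V) : elt (linv x) = (elt x)⁻¹ := by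
  obtain ⟨v, b⟩ := x; cases b <;> simp [elt, linv, FreeGroup.inv_mk, FreeGroup.invRev]
lemma hom_ext_elt {G : Type*} [Group G] {f g : FreeGroup V →* G}
    (h : ∀ v, ∃ b, f (elt (v, b)) = g (elt (v, b))) : f = g := by
  ext v
  obtain ⟨b, hb⟩ := h v
  cases b
  · rw [elt_false, _root_.map_inv, _root_.map_inv, inv_inj] at hb; exact hb
  · exact hb
lemma elt_cons (x : Lt V) (L : List (Lt V)) : FreeGroup.mk (x :: L) = elt x * FreeGroup.mk L := by
  simp [elt, FreeGroup.mul_mk]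

lemma elt_induction {C : FreeGroup V → Prop} (h1 : C 1) (hm : ∀ x g, C g → C (elt x * g)) (g) :
    C g := by
  obtain ⟨L, rfl⟩ : ∃ L, FreeGroup.mk L = g := Quot.exists_rep g
  induction L with
  | nil => exact h1
  | cons x L ih => rw [elt_cons]; exact hm _ _ ih

variable [DecidableEq V]

def head (g : FreeGroup V) : Option (Lt V) := g.toWord.head?

@[simp] lemma head_one : head (1 : FreeGroup V) = none := by simp [head]
lemma head_eq_none {g : FreeGroup V} : head g = none ↔ g = 1 := by
  simp [head, List.head?_eq_none_iff]

@[simp] lemma toWord_elt (x : Lt V) : (elt x).toWord = [x] := by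
  simp [elt]
@[simp] lemma head_elt (x : Lt V) : head (elt x) = some x := by
  simp [head]

lemma toWord_elt_mul (x : Lt V) {g : FreeGroup V} (h : head g ≠ some (linv x)) :
    (elt x * g).toWord = x :: g.toWord := by
  rw [toWord_mul, toWord_elt, List.singleton_append, FreeGroup.reduce.cons, reduce_toWord]
  unfold head at h
  rcases hg : g.toWord with _ | ⟨y, L⟩
  · simp
  · rw [hg] at h
    simp only [List.head?_cons, ne_eq, Option.some.injEq] at h
    simp only
    rw [if_neg]
    rintro ⟨h1, h2⟩
    apply h
    ext
    · exact h1.symm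
    · simp [linv, h2]

lemma head_elt_mul (x : Lt V) {g : FreeGroup V} (h : head g ≠ some (linv x)) :
    head (elt x * g) = some x := by
  rw [head, toWord_elt_mul x h]; rfl
lemma norm_elt_mul (x : Lt V) {g : FreeGroup V} (h : head g ≠ some (linv x)) :
    FreeGroup.norm (elt x * g) = FreeGroup.norm g + 1 := by
  rw [FreeGroup.norm, toWord_elt_mul x h]; rfl

lemma exists_of_head {x : Lt V} {g : FreeGroup V} (h : head g = some x) :
    ∃ g', g = elt x * g' ∧ head g' ≠ some (linv x) := by
  refine ⟨(elt x)⁻¹ * g, by group, ?_⟩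
  intro h'
  have hr : FreeGroup.IsReduced g.toWord := isReduced_toWord
  unfold head at h h'
  rcases hw : g.toWord with _ | ⟨y, L⟩
  · simp [hw] at h
  · rw [hw] at h
    simp only [List.head?_cons, Option.some.injEq] at h
    subst h
    have : (elt y)⁻¹ * g = FreeGroup.mk L := by
      rw [inv_mul_eq_iff_eq_mul, ← elt_cons, ← hw, mk_toWord]
    rw [this, toWord_mk] at h'
    have hL : FreeGroup.IsReduced L := by
      rw [hw] at hr
      rw [FreeGroup.IsReduced] at hr ⊢
      exact hr.of_cons
    rw [hL.reduce_eq] at h'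
    rcases L with _ | ⟨z, L⟩
    · simp at h'
    · simp only [List.head?_cons, Option.some.injEq] at h'
      subst h'
      rw [hw, isReduced_cons_cons] at hr
      have := hr.1
      simp [linv] at this

lemma red_induction {C : FreeGroup V → Prop} (h1 : C 1)
    (hm : ∀ x g, head g ≠ some (linv x) → C g → C (elt x * g)) (g) : C g := by
  induction hn : FreeGroup.norm g generalizing g with
  | zero => rw [FreeGroup.norm_eq_zero] at hn; rw [hn]; exact h1
  | succ n ih =>
    rcases hh : head g with _ | x
    · rw [head_eq_none] at hh; rw [hh]; exact h1
    · obtain ⟨g', rfl, h'⟩ := exists_of_head hh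
      rw [norm_elt_mul x h'] at hn
      exact hm x g' h' (ih g' (by omega))

lemma head_elt_mul_iff (x : Lt V) (g : FreeGroup V) :
    head (elt x * g) = some x ↔ head g ≠ some (linv x) := by
  refine ⟨fun h h' => ?_, head_elt_mul x⟩
  obtain ⟨g', rfl, h2⟩ := exists_of_head h'
  rw [elt_linv, mul_inv_cancel_left] at h
  simp [h] at h2

lemma head_inv_elt_mul (x : Lt V) {g : FreeGroup V} (h : head g ≠ some x) :
    head ((elt x)⁻¹ * g) = some (linv x) := by
  rw [← elt_linv]; exact head_elt_mul _ (by simpa using h)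

lemma head_mul_elt {g : FreeGroup V} (s : Lt V) (h : head (g * elt s) ≠ head g) :
    g = 1 ∨ g = (elt s)⁻¹ := by
  induction g using red_induction with
  | h1 => left; rfl
  | hm x g' hx ih =>
    right
    rw [head_elt_mul x hx, mul_assoc] at h
    have h1 : head (g' * elt s) = some (linv x) := by
      by_contra h2; exact h (head_elt_mul x h2)
    rcases ih (by rw [h1]; exact hx.symm) with rfl | rfl
    · simp only [one_mul, head_elt, Option.some.injEq] at h1
      subst h1; simp
    · simp at h1

end letters

section cuts
variable {V : Type}

/-- boundary edges labelled r of a set -/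
def bd (r : FreeGroup V) (E : Set (FreeGroup V)) : Set (FreeGroup V) :=
  {g | ¬ (g ∈ E ↔ g * r ∈ E)}

/-- almost invariant sets -/
def AI (E : Set (FreeGroup V)) : Prop := ∀ r, (bd r E).Finite

noncomputable def N (r : FreeGroup V) (E : Set (FreeGroup V)) : ℕ := (bd r E).ncard

def tr (w : FreeGroup V) (E : Set (FreeGroup V)) : Set (FreeGroup V) := {g | w⁻¹ * g ∈ E}

@[simp] lemma mem_tr {w g : FreeGroup V} {E : Set (FreeGroup V)} : g ∈ tr w E ↔ w⁻¹ * g ∈ E := Iff.rfl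

def im (f : MulAut (FreeGroup V)) (E : Set (FreeGroup V)) : Set (FreeGroup V) := {g | f⁻¹ g ∈ E}
@[simp] lemma mem_im {f : MulAut (FreeGroup V)} {g : FreeGroup V} {E : Set (FreeGroup V)} :
  g ∈ im f E ↔ f⁻¹ g ∈ E := Iff.rfl

lemma bd_compl (r : FreeGroup V) (E : Set (FreeGroup V)) : bd r Eᶜ = bd r E := by
  ext g; simp only [bd, Set.mem_ofPred_eq, Set.mem_compl_iff]; tauto

lemma AI.compl {E : Set (FreeGroup V)} (h : AI E) : AI Eᶜ := fun r => by rw [bd_compl]; exact h r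

lemma AI_of_compl {E : Set (FreeGroup V)} (h : AI Eᶜ) : AI E := by
  simpa using h.compl

lemma AI.inter {E E' : Set (FreeGroup V)} (h : AI E) (h' : AI E') : AI (E ∩ E') := fun r => by
  refine ((h r).union (h' r)).subset ?_
  intro g; simp only [bd, Set.mem_ofPred_eq, Set.mem_inter_iff, Set.mem_union]; tauto

lemma AI.union {E E' : Set (FreeGroup V)} (h : AI E) (h' : AI E') : AI (E ∪ E') := fun r => by
  refine ((h r).union (h' r)).subset ?_
  intro g; simp only [bd, Set.mem_ofPred_eq, Set.mem_union]; tauto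

lemma bd_tr (w r : FreeGroup V) (E : Set (FreeGroup V)) :
    bd r (tr w E) = (fun g => w * g) '' bd r E := by
  ext g
  simp only [bd, Set.mem_ofPred_eq, mem_tr, Set.mem_image]
  constructor
  · intro h; exact ⟨w⁻¹ * g, by simpa [mul_assoc] using h, by group⟩
  · rintro ⟨x, hx, rfl⟩; simpa [mul_assoc] using hx

lemma AI.tr {E : Set (FreeGroup V)} (h : AI E) (w : FreeGroup V) : AI (tr w E) := fun r => by
  rw [bd_tr]; exact (h r).image _

lemma bd_im (f : MulAut (FreeGroup V)) (r : FreeGroup V) (E : Set (FreeGroup V)) :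
    bd (f r) (im f E) = f '' bd r E := by
  ext g
  simp only [bd, Set.mem_ofPred_eq, mem_im, Set.mem_image, map_mul, MulAut.inv_apply_self]
  constructor
  · intro h; exact ⟨f⁻¹ g, h, by simp⟩
  · rintro ⟨x, hx, rfl⟩; simpa using hx

lemma AI.im {E : Set (FreeGroup V)} (h : AI E) (f : MulAut (FreeGroup V)) : AI (im f E) := fun r => by
  have := bd_im f (f⁻¹ r) E
  rw [MulAut.apply_inv_self] at this
  rw [this]; exact (h _).image _

lemma N_compl (r : FreeGroup V) (E : Set (FreeGroup V)) : N r Eᶜ = N r E := by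
  rw [N, N, bd_compl]
lemma N_tr (w r : FreeGroup V) (E : Set (FreeGroup V)) : N r (tr w E) = N r E := by
  rw [N, N, bd_tr]; exact Set.ncard_image_of_injective _ (mul_right_injective w)
lemma N_im (f : MulAut (FreeGroup V)) (r : FreeGroup V) (E : Set (FreeGroup V)) :
    N (f r) (im f E) = N r E := by
  rw [N, N, bd_im]; exact Set.ncard_image_of_injective _ f.injective

lemma ncard_submod {α : Type*} {s t u v : Set α} (hu : u.Finite) (hv : v.Finite)
    (h1 : s ∪ t ⊆ u ∪ v) (h2 : s ∩ t ⊆ u ∩ v) : s.ncard + t.ncard ≤ u.ncard + v.ncard := by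
  have huv := hu.union hv
  have hs : s.Finite := huv.subset (Set.subset_union_left.trans h1)
  have ht : t.Finite := huv.subset (Set.subset_union_right.trans h1)
  rw [← Set.ncard_union_add_ncard_inter s t hs ht, ← Set.ncard_union_add_ncard_inter u v hu hv]
  exact add_le_add (Set.ncard_le_ncard h1 huv) (Set.ncard_le_ncard h2 (hu.inter_of_left v))

lemma N_submod {E E' : Set (FreeGroup V)} (h : AI E) (h' : AI E') (r : FreeGroup V) :
    N r (E ∩ E') + N r (E ∪ E') ≤ N r E + N r E' := by
  apply ncard_submod (h r) (h' r)
  · intro g; simp only [bd, Set.mem_ofPred_eq, Set.mem_union, Set.mem_inter_iff]; tauto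
  · intro g; simp only [bd, Set.mem_ofPred_eq, Set.mem_union, Set.mem_inter_iff]; tauto

variable [DecidableEq V]
def C (B : Set (Lt V)) : Set (FreeGroup V) := {g | ∃ x ∈ B, head g = some x}

lemma mem_C_of_head {B : Set (Lt V)} {g : FreeGroup V} {x} (h : head g = some x) :
    g ∈ C B ↔ x ∈ B := by
  simp [C, h, -Prod.exists, -Prod.forall]
@[simp] lemma one_notMem_C (B : Set (Lt V)) : 1 ∉ C B := by simp [C]
lemma C_inter (A B : Set (Lt V)) : C (A ∩ B) = C A ∩ C B := by
  ext g; rcases h : head g with _ | x <;> simp [C, h, -Prod.exists, -Prod.forall]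
lemma C_union (A B : Set (Lt V)) : C (A ∪ B) = C A ∪ C B := by
  ext g; rcases h : head g with _ | x <;> simp [C, h, -Prod.exists, -Prod.forall]
lemma C_diff (A B : Set (Lt V)) : C (A \ B) = C A \ C B := by
  ext g; rcases h : head g with _ | x <;> simp [C, h, -Prod.exists, -Prod.forall]

lemma C_singleton_linv (a : Lt V) : C {linv a} = tr (elt a)⁻¹ (C {a})ᶜ := by
  ext g
  simp only [C, Set.mem_singleton_iff, exists_eq_left, Set.mem_ofPred_eq, mem_tr, inv_inv,
    Set.mem_compl_iff, head_elt_mul_iff, not_not, ne_eq]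

lemma AI_C (B : Set (Lt V)) : AI (C B) := by
  intro r
  induction r using elt_induction with
  | h1 => convert Set.finite_empty; ext g; simp [bd]
  | hm x r ih =>
    have h1 : (bd (elt x) (C B)).Finite := by
      refine (Set.toFinite {1, (elt x)⁻¹}).subset ?_
      intro g hg
      apply head_mul_elt
      intro h
      simp [bd, C, h] at hg
    refine (h1.union (ih.image (fun g => g * (elt x)⁻¹))).subset ?_
    intro g hg
    by_cases hx : g ∈ bd (elt x) (C B)
    · left; exact hx
    · right
      refine ⟨g * elt x, ?_, by simp⟩
      simp only [bd, Set.mem_ofPred_eq, not_not, mul_assoc] at hg hx ⊢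
      tauto

end cuts
section cuts2
variable {V : Type} [Fintype V]
/-- capacity -/
noncomputable def cp (f : MulAut (FreeGroup V)) (E : Set (FreeGroup V)) : ℕ := ∑ v, N (f (of v)) E

lemma cp_compl (f : MulAut (FreeGroup V)) (E : Set (FreeGroup V)) : cp f Eᶜ = cp f E := by
  simp [cp, N_compl]
lemma cp_tr (f : MulAut (FreeGroup V)) (w) (E : Set (FreeGroup V)) : cp f (tr w E) = cp f E := by
  simp [cp, N_tr]
lemma cp_im (w f : MulAut (FreeGroup V)) (E : Set (FreeGroup V)) :
    cp (w * f) (im w E) = cp f E := by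
  simp [cp, N_im, MulAut.mul_apply]
lemma cp_submod (f : MulAut (FreeGroup V)) {E E' : Set (FreeGroup V)} (h : AI E) (h' : AI E') :
    cp f (E ∩ E') + cp f (E ∪ E') ≤ cp f E + cp f E' := by
  simp only [cp, ← Finset.sum_add_distrib]
  exact Finset.sum_le_sum fun v _ => N_submod h h' _

lemma bd_empty_of_cp_zero {f : MulAut (FreeGroup V)} {E : Set (FreeGroup V)} (h : AI E)
    (h0 : cp f E = 0) (g r : FreeGroup V) : g ∈ E ↔ g * r ∈ E := by
  have h1 : ∀ v g, g ∈ E ↔ g * f (of v) ∈ E := by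
    intro v g
    have := (Finset.sum_eq_zero_iff.1 h0) v (Finset.mem_univ v)
    rw [N, Set.ncard_eq_zero (h _)] at this
    by_contra hc
    have : g ∈ (∅ : Set _) := this ▸ hc
    exact this
  have h2 : ∀ r g, g ∈ E ↔ g * f r ∈ E := by
    intro r
    induction r with
    | C1 => simp
    | of v => exact h1 v
    | inv_of v _ => intro g; rw [h1 v (g * f (of v)⁻¹)]; simp
    | mul x y hx hy => intro g; rw [hx, hy, map_mul, mul_assoc]
  simpa using h2 (f⁻¹ r) g

lemma cp_pos {f : MulAut (FreeGroup V)} {E : Set (FreeGroup V)} (h : AI E)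
    {x y : FreeGroup V} (hx : x ∈ E) (hy : y ∉ E) : 1 ≤ cp f E := by
  by_contra h0
  apply hy
  have := (bd_empty_of_cp_zero h (f := f) (by omega) x (x⁻¹ * y)).1 hx
  simpa using this

variable [DecidableEq V]
lemma cp_linv (f : MulAut (FreeGroup V)) (a : Lt V) : cp f (C {linv a}) = cp f (C {a}) := by
  rw [C_singleton_linv, cp_tr, cp_compl]

noncomputable def nu (f : MulAut (FreeGroup V)) : ℕ := ∑ v, cp f (C {(v, true)})

lemma cp_letter (f : MulAut (FreeGroup V)) (a : Lt V) : cp f (C {a}) = cp f (C {(a.1, true)}) := by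
  obtain ⟨v, b⟩ := a
  cases b
  · exact cp_linv f (v, true)
  · rfl

end cuts2
end BirmanAux

namespace BirmanAux
open FreeGroup (of)

section wh
variable {V : Type}

open Classical in
noncomputable def pre (A : Set (Lt V)) (a x : Lt V) : FreeGroup V :=
  if x ∈ A ∧ x.1 ≠ a.1 then elt a else 1

lemma pre_in {A : Set (Lt V)} {a x : Lt V} (h : x ∈ A) (h' : x.1 ≠ a.1) : pre A a x = elt a :=
  if_pos ⟨h, h'⟩
lemma pre_out {A : Set (Lt V)} {a x : Lt V} (h : x ∉ A) : pre A a x = 1 :=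
  if_neg (fun h' => h h'.1)
lemma pre_own {A : Set (Lt V)} {a x : Lt V} (h : x.1 = a.1) : pre A a x = 1 :=
  if_neg (fun h' => h'.2 h)

noncomputable def whHom (A : Set (Lt V)) (a : Lt V) : FreeGroup V →* FreeGroup V :=
  FreeGroup.lift fun v => pre A a (v, true) * of v * (pre A a (v, false))⁻¹

lemma whHom_elt (A : Set (Lt V)) (a x : Lt V) :
    whHom A a (elt x) = pre A a x * elt x * (pre A a (linv x))⁻¹ := by
  obtain ⟨v, b⟩ := x
  cases b
  · rw [elt_false, map_inv, whHom, FreeGroup.lift_apply_of]; simp [linv, mul_assoc]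
  · rw [elt_true, whHom, FreeGroup.lift_apply_of]; simp [linv]

lemma whHom_own (A : Set (Lt V)) (a x : Lt V) (h : x.1 = a.1) : whHom A a (elt x) = elt x := by
  rw [whHom_elt, pre_own h, pre_own (by simpa using h)]; simp

lemma whHom_comp (A : Set (Lt V)) (a : Lt V) :
    (whHom A (linv a)).comp (whHom A a) = MonoidHom.id _ := by
  apply hom_ext_elt
  intro v
  refine ⟨true, ?_⟩
  have key : ∀ x, whHom A (linv a) (pre A a x) * pre A (linv a) x = 1 := by
    intro x
    by_cases h : x ∈ A ∧ x.1 ≠ a.1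
    · rw [pre_in h.1 h.2, pre_in h.1 (by simpa using h.2), whHom_own _ _ _ (by simp)]; simp
    · rw [pre, if_neg h, pre, if_neg (by simpa using h)]; simp
  have k2 : ∀ x, whHom A (linv a) (pre A a x) = (pre A (linv a) x)⁻¹ :=
    fun x => eq_inv_of_mul_eq_one_left (key x)
  simp only [MonoidHom.comp_apply, MonoidHom.id_apply]
  rw [whHom_elt, map_mul, map_mul, map_inv, k2, k2, whHom_elt]
  group

noncomputable def Wh (A : Set (Lt V)) (a : Lt V) : MulAut (FreeGroup V) :=
  MonoidHom.toMulEquiv (whHom A a) (whHom A (linv a)) (whHom_comp A a)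
    (by have := whHom_comp A (linv a); simpa using this)

lemma Wh_elt (A : Set (Lt V)) (a x : Lt V) :
    Wh A a (elt x) = pre A a x * elt x * (pre A a (linv x))⁻¹ := whHom_elt A a x

lemma Wh_own (A : Set (Lt V)) (a x : Lt V) (h : x.1 = a.1) : Wh A a (elt x) = elt x :=
  whHom_own A a x h

lemma Wh_inv (A : Set (Lt V)) (a : Lt V) : (Wh A a)⁻¹ = Wh A (linv a) := by
  ext x
  rfl

lemma aut_ext_elt {f g : MulAut (FreeGroup V)}
    (h : ∀ v, ∃ b, f (elt (v, b)) = g (elt (v, b))) : f = g := by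
  have := hom_ext_elt (f := f.toMonoidHom) (g := g.toMonoidHom) h
  ext x
  exact congrArg (fun f => f x) this

lemma Wh_congr {A A' : Set (Lt V)} {a : Lt V} (h : ∀ x : Lt V, x.1 ≠ a.1 → (x ∈ A ↔ x ∈ A')) :
    Wh A a = Wh A' a := by
  have : ∀ x, pre A a x = pre A' a x := by
    intro x
    unfold pre
    by_cases hx : x.1 = a.1
    · simp [hx]
    · by_cases h1 : x ∈ A
      · rw [if_pos ⟨h1, hx⟩, if_pos ⟨(h x hx).1 h1, hx⟩]
      · rw [if_neg (fun h2 => h1 h2.1), if_neg (fun h2 => h1 ((h x hx).2 h2.1))]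
  apply aut_ext_elt
  intro v
  refine ⟨true, ?_⟩
  rw [Wh_elt, Wh_elt, this, this]

variable [DecidableEq V]

/-- The action of a Whitehead automorphism on first letters. -/
lemma Wh_head (A : Set (Lt V)) (a : Lt V) (ha : a ∈ A) (ha' : linv a ∉ A) (g : FreeGroup V) :
    (∀ v, head g = some v → v.1 ≠ a.1 → head ((pre A a v)⁻¹ * Wh A a g) = some v) ∧
    (head g = some a → head (Wh A a g) = some a ∧
      ∀ x ∈ A, x ≠ a → head ((elt a)⁻¹ * Wh A a g) ≠ some x) ∧
    (head g = some (linv a) → head (Wh A a g) = some (linv a) ∨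
      ∃ x ∈ A, x ≠ a ∧ head (Wh A a g) = some x) := by
  have fne : ∀ {x : Lt V}, x ∈ A → x ≠ a → x.1 ≠ a.1 := by
    intro x hx hxa h
    rcases fst_eq_iff.1 h with h | h
    · exact hxa h
    · exact ha' (h ▸ hx)
  induction g using red_induction with
  | h1 => simp
  | hm u g hu ih =>
    obtain ⟨ih1, ih2, ih3⟩ := ih
    rw [head_elt_mul u hu]
    simp only [Option.some.injEq]
    -- case analysis on the head of g
    have hcase : g = 1 ∨ (∃ v, head g = some v ∧ v.1 ≠ a.1) ∨ head g = some a ∨ head g = some (linv a) := by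
      rcases h : head g with _ | v
      · left; exact head_eq_none.1 h
      · right
        by_cases hv : v.1 = a.1
        · right; rcases fst_eq_iff.1 hv with h | h
          · left; rw [h]
          · right; rw [h]
        · left; exact ⟨v, rfl, hv⟩
    refine ⟨?_, ?_, ?_⟩
    · rintro v rfl hva
      rw [map_mul, Wh_elt]
      have : (pre A a u)⁻¹ * (pre A a u * elt u * (pre A a (linv u))⁻¹ * Wh A a g)
        = elt u * ((pre A a (linv u))⁻¹ * Wh A a g) := by group
      rw [this]
      apply head_elt_mul
      have hva' : (linv u).1 ≠ a.1 := hva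
      have hla : linv u ≠ linv a := fun h => hva (by rw [linv_inj.1 h])
      have hla' : linv u ≠ a := fun h => hva' (by rw [h])
      by_cases hin : linv u ∈ A
      · rw [pre_in hin hva']
        rcases hcase with rfl | ⟨v, hv, hv1⟩ | hg | hg
        · rw [map_one, mul_one, ← elt_linv, head_elt]; simpa using hla.symm
        · have := ih1 v hv hv1
          by_cases hvA : v ∈ A
          · rw [pre_in hvA hv1] at this; rw [this]; rw [hv] at hu; exact hu
          · rw [pre_out hvA] at this; simp only [inv_one, one_mul] at this
            rw [head_inv_elt_mul]
            · simpa using hla.symm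
            · rw [this]; simp; rintro rfl; exact hv1 rfl
        · exact (ih2 hg).2 _ hin hla'
        · rw [head_inv_elt_mul]
          · simpa using hla.symm
          · rcases ih3 hg with h | ⟨x, hx, hxa, h⟩
            · rw [h]; simpa using linv_ne a
            · rw [h]; simpa using hxa
      · rw [pre_out hin]; simp only [inv_one, one_mul]
        rcases hcase with rfl | ⟨v, hv, hv1⟩ | hg | hg
        · simp
        · have := ih1 v hv hv1
          by_cases hvA : v ∈ A
          · rw [pre_in hvA hv1] at this
            have h2 : Wh A a g = elt a * ((elt a)⁻¹ * Wh A a g) := by group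
            rw [h2, head_elt_mul]
            · simpa using hla'.symm
            · rw [this]; simp; rintro rfl; exact hv1 rfl
          · rw [pre_out hvA] at this; simp only [inv_one, one_mul] at this
            rw [this]; rw [hv] at hu; exact hu
        · rw [(ih2 hg).1]; simpa using hla'.symm
        · rcases ih3 hg with h | ⟨x, hx, hxa, h⟩
          · rw [h]; simpa using hla.symm
          · rw [h]; simp; rintro rfl; exact hin hx
    · rintro rfl
      rw [map_mul, Wh_own _ _ _ rfl, inv_mul_cancel_left]
      have key : ∀ x, (x ∈ A ∧ x ≠ u ∨ x = linv u) → head (Wh A u g) ≠ some x := by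
        rcases hcase with rfl | ⟨v, hv, hv1⟩ | hg | hg
        · simp
        · have := ih1 v hv hv1
          by_cases hvA : v ∈ A
          · rw [pre_in hvA hv1] at this
            have h2 : Wh A u g = elt u * ((elt u)⁻¹ * Wh A u g) := by group
            rw [h2, head_elt_mul]
            · rintro x (⟨h, h'⟩ | h')
              · simpa using h'.symm
              · rw [h']; simpa using ne_linv u
            · rw [this]; simp; rintro rfl; exact hv1 rfl
          · rw [pre_out hvA] at this; simp only [inv_one, one_mul] at this
            rw [this]
            rintro x (⟨h, h'⟩ | h')
            · simp; rintro rfl; exact hvA h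
            · simp; rintro rfl; exact hv1 (by rw [h']; rfl)
        · rw [(ih2 hg).1]; rintro x (⟨h, h'⟩ | h')
          · simpa using h'.symm
          · rw [h']; simpa using ne_linv u
        · exact absurd hg hu
      exact ⟨head_elt_mul _ (key _ (Or.inr rfl)), fun x hx hxu => key x (Or.inl ⟨hx, hxu⟩)⟩
    · rintro rfl
      rw [map_mul, Wh_own _ _ _ (by rfl), elt_linv]
      rcases hcase with rfl | ⟨v, hv, hv1⟩ | hg | hg
      · left; simp [← elt_linv]
      · have := ih1 v hv hv1
        by_cases hvA : v ∈ A
        · rw [pre_in hvA hv1] at this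
          right; exact ⟨v, hvA, fun h => hv1 (by rw [h]), this⟩
        · rw [pre_out hvA] at this; simp only [inv_one, one_mul] at this
          left; apply head_inv_elt_mul; rw [this]; simp; rintro rfl; exact hv1 rfl
      · simp [hg] at hu
      · left; apply head_inv_elt_mul
        rcases ih3 hg with h | ⟨x, hx, hxa, h⟩
        · rw [h]; simpa using linv_ne a
        · rw [h]; simpa using hxa

lemma im_eq_of {f : MulAut (FreeGroup V)} {E E' : Set (FreeGroup V)}
    (h : ∀ g, f g ∈ E' ↔ g ∈ E) : im f E = E' := by
  ext g
  rw [mem_im, ← h, MulAut.apply_inv_self]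

lemma head_cases (a : Lt V) (g : FreeGroup V) :
    g = 1 ∨ (∃ v, head g = some v ∧ v.1 ≠ a.1) ∨ head g = some a ∨ head g = some (linv a) := by
  rcases h : head g with _ | v
  · left; exact head_eq_none.1 h
  · right
    by_cases hv : v.1 = a.1
    · right; rcases fst_eq_iff.1 hv with h | h
      · left; rw [h]
      · right; rw [h]
    · left; exact ⟨v, rfl, hv⟩

lemma Wh_im_C (A : Set (Lt V)) (a : Lt V) (ha : a ∈ A) (ha' : linv a ∉ A) :
    im (Wh A a) (C A) = C {a} := by
  apply im_eq_of
  intro g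
  obtain ⟨h1, h2, h3⟩ := Wh_head A a ha ha' g
  rcases head_cases a g with rfl | ⟨v, hv, hv1⟩ | hg | hg
  · simp
  · rw [mem_C_of_head hv]
    have := h1 v hv hv1
    by_cases hvA : v ∈ A
    · rw [pre_in hvA hv1] at this
      have h2 : Wh A a g = elt a * ((elt a)⁻¹ * Wh A a g) := by group
      have h3 : head (Wh A a g) = some a := by
        rw [h2]
        apply head_elt_mul
        rw [this]; simp; rintro rfl; exact hv1 rfl
      rw [mem_C_of_head h3]; simpa using hvA
    · rw [pre_out hvA] at this; simp only [inv_one, one_mul] at this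
      rw [mem_C_of_head this]
      simp only [Set.mem_singleton_iff, hvA, iff_false]
      rintro rfl; exact hv1 rfl
  · rw [mem_C_of_head hg, mem_C_of_head (h2 hg).1]; simpa using ha
  · rw [mem_C_of_head hg]
    simp only [ha', iff_false]
    rcases h3 hg with h | ⟨x, hx, hxa, h⟩
    · rw [mem_C_of_head h]; exact linv_ne a
    · rw [mem_C_of_head h]; exact hxa

lemma Wh_im_single (A : Set (Lt V)) (a : Lt V) (ha : a ∈ A) (ha' : linv a ∉ A) (b : Lt V)
    (hb : b.1 ≠ a.1) : im (Wh A a) (C {b}) = tr (pre A a b) (C {b}) := by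
  apply im_eq_of
  intro g
  rw [mem_tr]
  obtain ⟨h1, h2, h3⟩ := Wh_head A a ha ha' g
  have hba : b ≠ a := fun h => hb (by rw [h])
  have hba' : b ≠ linv a := fun h => hb (by rw [h]; rfl)
  by_cases hbA : b ∈ A
  · rw [pre_in hbA hb]
    rcases head_cases a g with rfl | ⟨v, hv, hv1⟩ | hg | hg
    · rw [map_one, mul_one, ← elt_linv, mem_C_of_head (head_elt _)]; simpa using hba'.symm
    · have := h1 v hv hv1
      rw [mem_C_of_head hv]
      by_cases hvA : v ∈ A
      · rw [pre_in hvA hv1] at this; rw [mem_C_of_head this]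
      · rw [pre_out hvA] at this; simp only [inv_one, one_mul] at this
        have h4 : head ((elt a)⁻¹ * Wh A a g) = some (linv a) := by
          apply head_inv_elt_mul; rw [this]; simp; rintro rfl; exact hv1 rfl
        rw [mem_C_of_head h4]
        simp only [Set.mem_singleton_iff, hba'.symm, false_iff]; rintro rfl; exact hvA hbA
    · rw [mem_C_of_head hg]
      have := (h2 hg).2 b hbA hba
      simp only [Set.mem_singleton_iff, hba.symm, iff_false, C, exists_eq_left]
      exact this
    · rw [mem_C_of_head hg]
      have h4 : head ((elt a)⁻¹ * Wh A a g) = some (linv a) := by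
        apply head_inv_elt_mul
        rcases h3 hg with h | ⟨x, hx, hxa, h⟩
        · rw [h]; simpa using linv_ne a
        · rw [h]; simpa using hxa
      rw [mem_C_of_head h4]
  · rw [pre_out hbA]
    simp only [inv_one, one_mul]
    rcases head_cases a g with rfl | ⟨v, hv, hv1⟩ | hg | hg
    · simp
    · have := h1 v hv hv1
      rw [mem_C_of_head hv]
      by_cases hvA : v ∈ A
      · rw [pre_in hvA hv1] at this
        have h2 : Wh A a g = elt a * ((elt a)⁻¹ * Wh A a g) := by group
        have h3 : head (Wh A a g) = some a := by
          rw [h2]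
          apply head_elt_mul
          rw [this]; simp; rintro rfl; exact hv1 rfl
        rw [mem_C_of_head h3]
        simp only [Set.mem_singleton_iff, hba.symm, false_iff]; rintro rfl; exact hbA hvA
      · rw [pre_out hvA] at this; simp only [inv_one, one_mul] at this
        rw [mem_C_of_head this]
    · rw [mem_C_of_head hg, mem_C_of_head (h2 hg).1]
    · rw [mem_C_of_head hg]
      rcases h3 hg with h | ⟨x, hx, hxa, h⟩
      · rw [mem_C_of_head h]
      · rw [mem_C_of_head h]
        simp only [Set.mem_singleton_iff, hba'.symm, iff_false]; rintro rfl; exact hbA hx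

variable [Fintype V]

lemma nu_Wh (f : MulAut (FreeGroup V)) (A : Set (Lt V)) (a : Lt V) (ha : a ∈ A) (ha' : linv a ∉ A) :
    nu (Wh A a * f) + cp f (C {a}) = nu f + cp f (C A) := by
  have h1 : cp (Wh A a * f) (C {a}) = cp f (C A) := by
    rw [← Wh_im_C A a ha ha', cp_im]
  have h2 : ∀ v, v ≠ a.1 → cp (Wh A a * f) (C {(v, true)}) = cp f (C {(v, true)}) := by
    intro v hv
    have := cp_im (Wh A a) f (C {(v, true)})
    rw [Wh_im_single A a ha ha' _ hv, cp_tr] at this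
    exact this
  unfold nu
  rw [← Finset.add_sum_erase _ _ (Finset.mem_univ a.1), ← Finset.add_sum_erase _ (fun v => cp f _) (Finset.mem_univ a.1)]
  rw [Finset.sum_congr rfl (fun v hv => h2 v (Finset.ne_of_mem_erase hv))]
  rw [← cp_letter, ← cp_letter, h1]
  omega

end wh
end BirmanAux

namespace BirmanAux
open FreeGroup (of)

section rels
variable {V : Type}

open Classical in
lemma pre_def (A : Set (Lt V)) (a x : Lt V) : pre A a x = if x ∈ A ∧ x.1 ≠ a.1 then elt a else 1 := rfl

lemma Wh_mul_elt (A B : Set (Lt V)) (a b x : Lt V) : (Wh B b * Wh A a) (elt x) =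
    (Wh B b (pre A a x) * pre B b x) * elt x *
      (Wh B b (pre A a (linv x)) * pre B b (linv x))⁻¹ := by
  rw [MulAut.mul_apply, Wh_elt, map_mul, map_mul, map_inv, Wh_elt]
  group

/-- equality of products of two Whitehead automorphisms -/
lemma Wh_rel {A B A' B' : Set (Lt V)} {a b a' b' : Lt V} (p q : Lt V)
    (hp : (Wh B b * Wh A a) (elt p) = (Wh B' b' * Wh A' a') (elt p))
    (hq : (Wh B b * Wh A a) (elt q) = (Wh B' b' * Wh A' a') (elt q))
    (h : ∀ x : Lt V, x.1 ≠ p.1 → x.1 ≠ q.1 → x ≠ p → x ≠ q → x ≠ linv p → x ≠ linv q →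
      Wh B b (pre A a x) * pre B b x = Wh B' b' (pre A' a' x) * pre B' b' x) :
    Wh B b * Wh A a = Wh B' b' * Wh A' a' := by
  apply aut_ext_elt
  intro v
  by_cases hvp : v = p.1
  · exact ⟨p.2, by subst hvp; exact hp⟩
  by_cases hvq : v = q.1
  · exact ⟨q.2, by subst hvq; exact hq⟩
  refine ⟨true, ?_⟩
  have H : ∀ x : Lt V, x.1 ≠ p.1 → x.1 ≠ q.1 → 
      Wh B b (pre A a x) * pre B b x = Wh B' b' (pre A' a' x) * pre B' b' x := by
    intro x h1 h2
    refine h x h1 h2 ?_ ?_ ?_ ?_ <;> rintro rfl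
    exacts [h1 rfl, h2 rfl, h1 rfl, h2 rfl]
  rw [Wh_mul_elt, Wh_mul_elt, H, H] <;> simpa [linv]

lemma Wh_D1 {A B : Set (Lt V)} {a b : Lt V} (hab : a.1 ≠ b.1) (ha : a ∈ A) (hb : b ∈ B)
    (hd : ∀ x ∈ A, x ∉ B) (h1 : linv a ∉ B) (h2 : linv b ∉ A) :
    Wh B b * Wh A a = Wh A a * Wh B b := by
  have hba := hab.symm
  have ha2 := hd a ha
  have hb2 : b ∉ A := fun h => hd b h hb
  apply Wh_rel a b
  · simp [pre_def, Wh_elt, *]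
  · simp [pre_def, Wh_elt, *]
  · intro x hxa hxb x1 x2 x3 x4
    have := hd x
    by_cases xA : x ∈ A <;> by_cases xB : x ∈ B <;> simp_all [pre_def, Wh_elt]

lemma Wh_D2 {A B : Set (Lt V)} {a b : Lt V} (hab : a.1 ≠ b.1) (ha : a ∈ A) (hb : b ∈ B)
    (hd : ∀ x ∈ A, x ∉ B) (h1 : linv a ∈ B) (h2 : linv b ∉ A) :
    Wh ((B ∪ A) \ {a}) b * Wh A a = Wh A a * Wh B b := by
  have hba := hab.symm
  have ha2 := hd a ha
  have hb2 : b ∉ A := fun h => hd b h hb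
  have e1 : linv a ≠ a := linv_ne a
  have e2 : b ≠ a := fun h => hba (by rw [h])
  have e3 : linv b ≠ a := fun h => hba (by rw [← h]; rfl)
  apply Wh_rel a b
  · simp [pre_def, Wh_elt, *]
  · simp [pre_def, Wh_elt, *]
  · intro x hxa hxb x1 x2 x3 x4
    have := hd x
    by_cases xA : x ∈ A <;> by_cases xB : x ∈ B <;> simp_all [pre_def, Wh_elt]

lemma Wh_N1 {A B : Set (Lt V)} {a b : Lt V} (hab : a.1 ≠ b.1) (ha : a ∈ A) 
    (hd : ∀ x ∈ A, x ∈ B) (h1 : linv a ∈ B) (h2 : b ∉ A) (h3 : linv b ∉ A) :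
    Wh B b * Wh A a = Wh A a * Wh B b := by
  have hba := hab.symm
  have ha2 := hd a ha
  apply Wh_rel a b
  · simp [pre_def, Wh_elt, *]
  · simp [pre_def, Wh_elt, *]
  · intro x hxa hxb x1 x2 x3 x4
    have := hd x
    by_cases xA : x ∈ A <;> by_cases xB : x ∈ B <;> simp_all [pre_def, Wh_elt]

lemma Wh_N2 {A B : Set (Lt V)} {a b : Lt V} (hab : a.1 ≠ b.1) (ha : a ∈ A) (ha' : linv a ∉ A)
    (hd : ∀ x ∈ A, x ∈ B) (h1 : linv a ∈ B) (h2 : b ∈ A) (h3 : linv b ∉ B) :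
    Wh B b * Wh A a = Wh (insert (linv b) (B \ A)) (linv a) * Wh B b := by
  have hba := hab.symm
  have ha2 := hd a ha
  have h4 : linv b ∉ A := fun h => h3 (hd _ h)
  have e1 : linv a ≠ a := linv_ne a
  have e2 : b ≠ a := fun h => hba (by rw [h])
  have e3 : linv b ≠ a := fun h => hba (by rw [← h]; rfl)
  have e4 : b ≠ linv b := ne_linv b
  apply Wh_rel a b
  · simp [pre_def, Wh_elt, *]
  · simp [pre_def, Wh_elt, *]
  · intro x hxa hxb x1 x2 x3 x4
    have := hd x
    by_cases xA : x ∈ A <;> by_cases xB : x ∈ B <;> simp_all [pre_def, Wh_elt]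

lemma Wh_N3 {A B : Set (Lt V)} {a b : Lt V} (hab : a.1 ≠ b.1) (ha : a ∈ A) 
    (hd : ∀ x ∈ A, x ∈ B) (h1 : linv a ∉ B) (h2 : b ∉ A) (h3 : linv b ∉ A) :
    Wh (insert a (B \ A)) b * Wh A a = Wh A a * Wh B b := by
  have hba := hab.symm
  have ha2 := hd a ha
  have e1 : linv a ≠ a := linv_ne a
  apply Wh_rel a b
  · simp [pre_def, Wh_elt, *]
  · simp [pre_def, Wh_elt, *]
  · intro x hxa hxb x1 x2 x3 x4
    have := hd x
    by_cases xA : x ∈ A <;> by_cases xB : x ∈ B <;> simp_all [pre_def, Wh_elt]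

lemma Wh_union {A B : Set (Lt V)} {b : Lt V} (h : ∀ x ∈ A, x ∈ B → x.1 = b.1) :
    Wh A b * Wh B b = Wh (A ∪ B) b := by
  have key : ∀ x, Wh A b (pre B b x) * pre A b x = pre (A ∪ B) b x := by
    intro x
    have := h x
    by_cases xb : x.1 = b.1
    · simp [pre_def, xb]
    by_cases xA : x ∈ A <;> by_cases xB : x ∈ B <;> simp_all [pre_def, Wh_elt]
  apply aut_ext_elt
  intro v
  refine ⟨true, ?_⟩
  rw [Wh_mul_elt, key, key, Wh_elt]

lemma Wh_E1_nested {A B : Set (Lt V)} {b : Lt V} (h : ∀ x ∈ A, x ∈ B) :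
    Wh (insert b (B \ A)) b * Wh A b = Wh B b := by
  rw [Wh_union]
  · apply Wh_congr
    intro x hx
    have := h x
    have : x ≠ b := fun h => hx (by rw [h])
    simp only [Set.mem_union, Set.mem_insert_iff, Set.mem_sdiff]; tauto
  · rintro x (rfl | ⟨h1, h2⟩) h3
    · rfl
    · exact absurd h3 h2

lemma Wh_E1_disj {A B : Set (Lt V)} {b : Lt V} (h : ∀ x ∈ A, x ∉ B) :
    Wh ((A ∪ B) \ {linv b}) b * Wh A (linv b) = Wh B b := by
  rw [← Wh_inv, mul_inv_eq_iff_eq_mul, Wh_union]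
  · apply Wh_congr
    intro x hx
    have : x ≠ linv b := fun h => hx (by rw [h]; rfl)
    simp only [Set.mem_union, Set.mem_sdiff, Set.mem_singleton_iff]; tauto
  · intro x h1 h2; exact absurd h1 (h x h2)

/-! permutations -/

def permHom (π : Equiv.Perm (Lt V)) : FreeGroup V →* FreeGroup V :=
  FreeGroup.lift fun v => elt (π (v, true))

lemma permHom_elt (π : Equiv.Perm (Lt V)) (h : ∀ x, π (linv x) = linv (π x)) (x : Lt V) :
    permHom π (elt x) = elt (π x) := by
  obtain ⟨v, b⟩ := x
  cases b
  · rw [elt_false, map_inv, permHom, FreeGroup.lift_apply_of, ← elt_linv, ← h]; rfl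
  · rw [elt_true, permHom, FreeGroup.lift_apply_of]

lemma symm_linv (π : Equiv.Perm (Lt V)) (h : ∀ x, π (linv x) = linv (π x)) (x : Lt V) :
    π.symm (linv x) = linv (π.symm x) := by
  rw [Equiv.symm_apply_eq, h, Equiv.apply_symm_apply]

def permAut (π : Equiv.Perm (Lt V)) (h : ∀ x, π (linv x) = linv (π x)) : MulAut (FreeGroup V) :=
  MonoidHom.toMulEquiv (permHom π) (permHom π.symm)
    (hom_ext_elt fun v => ⟨true, by
      rw [MonoidHom.comp_apply, permHom_elt π h, permHom_elt _ (symm_linv π h)]; simp⟩)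
    (hom_ext_elt fun v => ⟨true, by
      rw [MonoidHom.comp_apply, permHom_elt _ (symm_linv π h), permHom_elt π h]; simp⟩)

lemma permAut_elt (π : Equiv.Perm (Lt V)) (h : ∀ x, π (linv x) = linv (π x)) (x : Lt V) :
    permAut π h (elt x) = elt (π x) := permHom_elt π h x

def IsPerm (p : MulAut (FreeGroup V)) : Prop :=
  ∃ π : Equiv.Perm (Lt V), (∀ x, π (linv x) = linv (π x)) ∧ ∀ x, p (elt x) = elt (π x)

lemma IsPerm.one : IsPerm (1 : MulAut (FreeGroup V)) := ⟨1, by simp, by simp⟩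
lemma IsPerm.mul {p q : MulAut (FreeGroup V)} (hp : IsPerm p) (hq : IsPerm q) : IsPerm (p * q) := by
  obtain ⟨π, h1, h2⟩ := hp
  obtain ⟨ρ, h3, h4⟩ := hq
  exact ⟨π * ρ, by simp [h1, h3], by simp [h2, h4]⟩
lemma IsPerm.inv {p : MulAut (FreeGroup V)} (hp : IsPerm p) : IsPerm p⁻¹ := by
  obtain ⟨π, h1, h2⟩ := hp
  refine ⟨π.symm, symm_linv π h1, fun x => ?_⟩
  have : p (elt (π.symm x)) = elt x := by rw [h2]; simp
  rw [← this, MulAut.inv_apply_self]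

lemma perm_conj {p : MulAut (FreeGroup V)} {π : Equiv.Perm (Lt V)} (h1 : ∀ x, π (linv x) = linv (π x))
    (h2 : ∀ x, p (elt x) = elt (π x)) (A : Set (Lt V)) (a : Lt V) :
    p * Wh A a = Wh (π '' A) (π a) * p := by
  have hf : ∀ x y : Lt V, (π x).1 = (π y).1 ↔ x.1 = y.1 := by
    intro x y
    rw [fst_eq_iff, fst_eq_iff, ← h1]
    simp
  have key : ∀ x, p (pre A a x) = pre (π '' A) (π a) (π x) := by
    intro x
    by_cases hx : x ∈ A ∧ x.1 ≠ a.1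
    · rw [pre_in hx.1 hx.2, pre_in (Set.mem_image_of_mem _ hx.1) (by rw [Ne, hf]; exact hx.2), h2]
    · rw [pre, if_neg hx, pre, if_neg (by rw [Ne, hf, Function.Injective.mem_set_image π.injective]; exact hx)]
      simp
  apply aut_ext_elt
  intro v
  refine ⟨true, ?_⟩
  rw [MulAut.mul_apply, MulAut.mul_apply, Wh_elt, map_mul, map_mul, map_inv, key, key, h2, Wh_elt, h1]

section
variable [DecidableEq V]

lemma perm_head {p : MulAut (FreeGroup V)} {π : Equiv.Perm (Lt V)} (h1 : ∀ x, π (linv x) = linv (π x))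
    (h2 : ∀ x, p (elt x) = elt (π x)) (g : FreeGroup V) : head (p g) = (head g).map π := by
  induction g using red_induction with
  | h1 => simp
  | hm x g hx ih =>
    rw [map_mul, h2, head_elt_mul x hx, head_elt_mul]
    · rfl
    · rw [ih, ← h1]
      rcases hg : head g with _ | y
      · simp
      · rw [hg] at hx
        simp only [Option.map_some, ne_eq, Option.some.injEq, EmbeddingLike.apply_eq_iff_eq] at hx ⊢
        exact hx

lemma perm_im {p : MulAut (FreeGroup V)} {π : Equiv.Perm (Lt V)} (h1 : ∀ x, π (linv x) = linv (π x))
    (h2 : ∀ x, p (elt x) = elt (π x)) (x : Lt V) : im p (C {x}) = C {π x} := by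
  apply im_eq_of
  intro g
  rcases hg : head g with _ | y
  · rw [head_eq_none] at hg; subst hg; simp
  · have := perm_head h1 h2 g
    rw [hg] at this
    rw [mem_C_of_head hg, mem_C_of_head this]; simp

lemma nu_perm [Fintype V] {p : MulAut (FreeGroup V)} (hp : IsPerm p) (f : MulAut (FreeGroup V)) :
    nu (p * f) = nu f := by
  obtain ⟨π, h1, h2⟩ := hp
  have h : ∀ v, cp (p * f) (C {((π (v, true)).1, true)}) = cp f (C {(v, true)}) := by
    intro v
    rw [← cp_letter, ← perm_im h1 h2, cp_im]
  unfold nu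
  rw [← Finset.sum_congr rfl (fun v _ => h v)]
  have inj : Function.Injective (fun v => (π (v, true)).1) := by
    intro v w hvw
    rw [fst_eq_iff, ← h1] at hvw
    rcases hvw with h | h
    · simpa using h
    · simpa [linv] using h
  exact ((Finite.injective_iff_bijective.1 inj).sum_comp (fun w => cp (p * f) (C {(w, true)}))).symm

def qcyc (a b : Lt V) : Equiv.Perm (Lt V) :=
  Equiv.swap a (linv a) * (Equiv.swap a b * Equiv.swap (linv a) (linv b))

lemma qcyc_a {a b : Lt V} (h : a.1 ≠ b.1) : qcyc a b a = b := by
  have e1 := ne_linv a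
  have e2 : a ≠ linv b := fun h' => h (by rw [h']; rfl)
  have e3 : b ≠ a := fun h' => h (by rw [h'])
  have e4 : b ≠ linv a := fun h' => h (by rw [h']; rfl)
  simp [qcyc, Equiv.swap_apply_of_ne_of_ne, *]
lemma qcyc_b {a b : Lt V} (h : a.1 ≠ b.1) : qcyc a b b = linv a := by
  have e1 := ne_linv b
  have e4 : b ≠ linv a := fun h' => h (by rw [h']; rfl)
  simp [qcyc, Equiv.swap_apply_of_ne_of_ne, *]
lemma qcyc_linva {a b : Lt V} (h : a.1 ≠ b.1) : qcyc a b (linv a) = linv b := by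
  have e1 := ne_linv b
  have e2 : linv b ≠ a := fun h' => h (by rw [← h']; rfl)
  have e3 : linv b ≠ linv a := fun h' => h (by rw [linv_inj.1 h'])
  have e4 : linv b ≠ b := linv_ne b
  simp [qcyc, Equiv.swap_apply_of_ne_of_ne, *]
lemma qcyc_linvb {a b : Lt V} (h : a.1 ≠ b.1) : qcyc a b (linv b) = a := by
  have e2 : b ≠ linv a := fun h' => h (by rw [h']; rfl)
  have e3 : linv a ≠ a := linv_ne a
  simp [qcyc, Equiv.swap_apply_of_ne_of_ne, *, e2.symm]
lemma qcyc_other {a b x : Lt V} (h1 : x.1 ≠ a.1) (h2 : x.1 ≠ b.1) : qcyc a b x = x := by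
  have e1 : x ≠ a := fun h' => h1 (by rw [h'])
  have e2 : x ≠ b := fun h' => h2 (by rw [h'])
  have e3 : x ≠ linv a := fun h' => h1 (by rw [h']; rfl)
  have e4 : x ≠ linv b := fun h' => h2 (by rw [h']; rfl)
  simp [qcyc, Equiv.swap_apply_of_ne_of_ne, *]
lemma qcyc_linv {a b : Lt V} (h : a.1 ≠ b.1) (x : Lt V) : qcyc a b (linv x) = linv (qcyc a b x) := by
  by_cases h1 : x.1 = a.1
  · rcases fst_eq_iff.1 h1 with rfl | rfl
    · rw [qcyc_linva h, qcyc_a h]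
    · rw [linv_linv, qcyc_linva h, qcyc_a h, linv_linv]
  by_cases h2 : x.1 = b.1
  · rcases fst_eq_iff.1 h2 with rfl | rfl
    · rw [qcyc_linvb h, qcyc_b h, linv_linv]
    · rw [linv_linv, qcyc_linvb h, qcyc_b h]
  rw [qcyc_other h1 h2, qcyc_other (by simpa using h1) (by simpa using h2)]

def qperm (a b : Lt V) (h : a.1 ≠ b.1) : MulAut (FreeGroup V) := permAut (qcyc a b) (qcyc_linv h)
lemma qperm_elt (a b : Lt V) (h : a.1 ≠ b.1) (x) : qperm a b h (elt x) = elt (qcyc a b x) :=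
  permAut_elt _ _ x
lemma qperm_isPerm (a b : Lt V) (h : a.1 ≠ b.1) : IsPerm (qperm a b h) :=
  ⟨_, qcyc_linv h, qperm_elt a b h⟩

lemma Wh_E2 {A : Set (Lt V)} {a b : Lt V} (hab : a.1 ≠ b.1) (ha : a ∈ A) (hb : b ∈ A)
    (ha' : linv a ∉ A) (hb' : linv b ∉ A) :
    qperm a b hab * (Wh (insert (linv a) (A \ {a})) b * Wh A a) = Wh A b := by
  have hba := hab.symm
  have e1 : linv a ≠ a := linv_ne a
  have e1' : a ≠ linv a := ne_linv a
  have e2 : b ≠ a := fun h => hba (by rw [h])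
  have e3 : b ≠ linv a := fun h => hba (by rw [h]; rfl)
  have e4 : linv b ≠ linv a := fun h => hba (by rw [linv_inj.1 h])
  have e5 := qcyc_a hab
  have e6 := qcyc_b hab
  apply aut_ext_elt
  intro v
  by_cases hva : v = a.1
  · refine ⟨a.2, ?_⟩
    subst hva
    simp [pre_def, Wh_elt, qperm_elt, *]
  by_cases hvb : v = b.1
  · refine ⟨b.2, ?_⟩
    subst hvb
    simp [pre_def, Wh_elt, qperm_elt, *]
  refine ⟨true, ?_⟩
  have key : ∀ x : Lt V, x.1 ≠ a.1 → x.1 ≠ b.1 → 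
    qperm a b hab (Wh (insert (linv a) (A \ {a})) b (pre A a x) * pre (insert (linv a) (A \ {a})) b x)
      = pre A b x := by
    intro x hxa hxb
    have x1 : x ≠ a := fun h => hxa (by rw [h])
    have x2 : x ≠ linv a := fun h => hxa (by rw [h]; rfl)
    by_cases xA : x ∈ A
    · simp [pre_def, Wh_elt, qperm_elt, *]
    · simp [pre_def, Wh_elt, qperm_elt, *]
  rw [MulAut.mul_apply, Wh_mul_elt, map_mul, map_mul, map_inv, key _ hva hvb, key _ hva hvb, Wh_elt,
    qperm_elt, qcyc_other hva hvb]

end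

end rels
end BirmanAux

namespace BirmanAux
open FreeGroup (of)

section omega
variable {V : Type} 

def Gam (D : Set V) : Subgroup (MulAut (FreeGroup V)) where
  carrier := {f | ∀ v ∈ D, IsConj (of v) (f (of v))}
  one_mem' := by
    intro v _
    rw [MulAut.one_apply]
  mul_mem' := by
    intro f g hf hg s hs
    rw [MulAut.mul_apply]
    exact (hf s hs).trans (f.toMonoidHom.map_isConj (hg s hs))
  inv_mem' := by
    intro f hf s hs
    have h := (f⁻¹ : MulAut (FreeGroup V)).toMonoidHom.map_isConj (hf s hs)
    simp only [MulEquiv.toMonoidHom_eq_coe, MonoidHom.coe_coe] at h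
    rw [MulAut.inv_apply_self] at h
    exact h.symm

lemma mem_Gam {D : Set V} {f : MulAut (FreeGroup V)} :
    f ∈ Gam D ↔ ∀ v ∈ D, IsConj (of v) (f (of v)) := Iff.rfl

structure Adm (D : Set V) (A : Set (Lt V)) (a : Lt V) : Prop where
  mem : a ∈ A
  nmem : linv a ∉ A
  bal : ∀ x : Lt V, x.1 ∈ D → x.1 ≠ a.1 → (x ∈ A ↔ linv x ∈ A)

lemma Adm.mem_Gam {D : Set V} {A : Set (Lt V)} {a : Lt V} (h : Adm D A a) : Wh A a ∈ Gam D := by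
  intro v hv
  rw [← elt_true, Wh_elt]
  by_cases hva : v = a.1
  · rw [pre_own hva, pre_own (by simpa using hva), one_mul, inv_one, mul_one]
  · have := h.bal (v, true) hv hva
    have e : pre A a (linv (v, true)) = pre A a (v, true) := by
      by_cases h1 : (v, true) ∈ A
      · rw [pre_in h1 hva, pre_in (this.1 h1) hva]
      · rw [pre_out h1, pre_out (fun h => h1 (this.2 h))]
    rw [e]
    exact isConj_iff.2 ⟨_, rfl⟩

lemma Adm.flip {D : Set V} {A : Set (Lt V)} {a : Lt V} (h : Adm D A a) :
    Adm D (insert (linv a) (A \ {a})) (linv a) := by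
  refine ⟨by simp, ?_, ?_⟩
  · simp [ne_linv a]
  · intro x hx hxa
    have h1 := h.bal x hx hxa
    have x1 : x ≠ a := fun h => hxa (by rw [h]; rfl)
    have x2 : x ≠ linv a := fun h => hxa (by rw [h])
    have x3 : linv x ≠ a := fun h => hxa (by rw [← h]; rfl)
    simp [x1, x2, x3, h1, linv_inj]

lemma Wh_inv' (A : Set (Lt V)) (a : Lt V) : (Wh A a)⁻¹ = Wh (insert (linv a) (A \ {a})) (linv a) := by
  rw [Wh_inv]
  apply Wh_congr
  intro x hxa
  have x1 : x ≠ a := fun h => hxa (by rw [h]; rfl)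
  have x2 : x ≠ linv a := fun h => hxa (by rw [h])
  simp [x1, x2]

def Om (D : Set V) : Set (MulAut (FreeGroup V)) :=
  {w | (∃ A a, Adm D A a ∧ w = Wh A a) ∨ (IsPerm w ∧ w ∈ Gam D)}

lemma Om_Wh {D : Set V} {A : Set (Lt V)} {a : Lt V} (h : Adm D A a) : Wh A a ∈ Om D :=
  Or.inl ⟨A, a, h, rfl⟩

lemma Om_sub {D : Set V} {w : MulAut (FreeGroup V)} (h : w ∈ Om D) : w ∈ Gam D := by
  rcases h with ⟨A, a, h, rfl⟩ | h
  · exact h.mem_Gam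
  · exact h.2

lemma Om_inv {D : Set V} {w : MulAut (FreeGroup V)} (h : w ∈ Om D) : w⁻¹ ∈ Om D := by
  rcases h with ⟨A, a, h, rfl⟩ | h
  · rw [Wh_inv']; exact Om_Wh h.flip
  · exact Or.inr ⟨h.1.inv, inv_mem h.2⟩

lemma Om_finite [Finite V] (D : Set V) : (Om D).Finite := by
  apply Set.Finite.union
  · refine (Set.finite_range (fun p : Set (Lt V) × Lt V => Wh p.1 p.2)).subset ?_
    rintro w ⟨A, a, _, rfl⟩
    exact ⟨(A, a), rfl⟩
  · refine Set.Finite.subset (s := {w | IsPerm w}) ?_ (fun w hw => hw.1)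
    classical
    refine Set.Finite.of_injOn (t := Set.univ) (f := fun w => fun x => (w : MulAut (FreeGroup V)) (elt x) |>.toWord.head?)
      (fun _ _ => Set.mem_univ _) ?_ (s := {w | IsPerm w}) ?_ 
    · intro w hw w' hw' h
      obtain ⟨π, h1, h2⟩ := hw
      obtain ⟨π', h1', h2'⟩ := hw'
      apply aut_ext_elt
      intro v
      refine ⟨true, ?_⟩
      have := congrFun h (v, true)
      simp only [h2, h2', toWord_elt, List.head?_cons, Option.some.injEq] at this
      rw [h2, h2', this]
    · exact Set.finite_univ

open Classical in
lemma elt_conj {x y : Lt V} (h : IsConj (elt x) (elt y)) : x = y := by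
  have h1 := (FreeGroup.lift (fun v : V => if v = x.1 then Multiplicative.ofAdd (1:ℤ) else 1)).map_isConj h
  rw [isConj_iff_eq] at h1
  obtain ⟨v, b⟩ := x
  obtain ⟨w, c⟩ := y
  by_cases hvw : w = v
  · subst hvw
    cases b <;> cases c <;> simp [elt_true, elt_false, ← ofAdd_neg] at h1 ⊢
    all_goals exact absurd h1 (by decide)
  · exfalso
    cases b <;> cases c <;> simp [elt_true, elt_false, hvw, ← ofAdd_neg] at h1 

lemma perm_fix {D : Set V} {p : MulAut (FreeGroup V)} (hp : p ∈ Gam D) {π : Equiv.Perm (Lt V)}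
    (h1 : ∀ x, π (linv x) = linv (π x)) (h2 : ∀ x, p (elt x) = elt (π x)) {x : Lt V} (hx : x.1 ∈ D) :
    π x = x := by
  have h3 : π (x.1, true) = (x.1, true) := by
    have := hp x.1 hx
    rw [← elt_true, h2] at this
    exact (elt_conj this).symm
  obtain ⟨v, b⟩ := x
  cases b
  · have := h1 (v, true)
    rw [h3] at this
    exact this
  · exact h3

lemma Adm.perm {D : Set V} {p : MulAut (FreeGroup V)} (hp : p ∈ Gam D) {π : Equiv.Perm (Lt V)}
    (h1 : ∀ x, π (linv x) = linv (π x)) (h2 : ∀ x, p (elt x) = elt (π x)) {A : Set (Lt V)} {a : Lt V}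
    (h : Adm D A a) : Adm D (π '' A) (π a) := by
  refine ⟨Set.mem_image_of_mem _ h.mem, ?_, ?_⟩
  · rw [← h1, π.injective.mem_set_image]; exact h.nmem
  · intro y hy hya
    have e := perm_fix hp h1 h2 hy
    have hya' : y.1 ≠ a.1 := by
      intro h'
      have := perm_fix hp h1 h2 (x := a) (by rw [← h']; exact hy)
      exact hya (by rw [this, h'])
    have e2 : π (linv y) = linv y := by rw [h1, e]
    rw [← e2]
    nth_rw 1 [← e]
    rw [π.injective.mem_set_image, π.injective.mem_set_image]
    exact h.bal y hy hya'

end omega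

section paths
variable {V : Type} [Fintype V] [DecidableEq V]

def Edge (D : Set V) (h : ℕ) (x y : MulAut (FreeGroup V)) : Prop :=
  (∃ w ∈ Om D, y = w * x) ∧ nu x ≤ h ∧ nu y ≤ h ∧ (nu x < h ∨ nu y < h)

lemma Edge.symm {D : Set V} {h : ℕ} {x y : MulAut (FreeGroup V)} (e : Edge D h x y) : Edge D h y x := by
  obtain ⟨⟨w, hw, rfl⟩, h1, h2, h3⟩ := e
  exact ⟨⟨w⁻¹, Om_inv hw, by simp⟩, h2, h1, h3.symm⟩

def Path (D : Set V) (h : ℕ) : ℕ → MulAut (FreeGroup V) → MulAut (FreeGroup V) → Prop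
  | 0, x, y => x = y
  | n + 1, x, y => ∃ z, Path D h n x z ∧ (z = y ∨ (Edge D h z y ∧ (z = x ∨ nu z < h)))

lemma Path.refl (D : Set V) (h n : ℕ) (x : MulAut (FreeGroup V)) : Path D h n x x := by
  induction n with
  | zero => rfl
  | succ n ih => exact ⟨x, ih, Or.inl rfl⟩

lemma Path.trans {D : Set V} {h m n : ℕ} {x y z : MulAut (FreeGroup V)} (h1 : Path D h m x y)
    (h2 : Path D h n y z) (hy : nu y < h) : Path D h (m + n) x z := by
  induction n generalizing z with
  | zero => cases h2; exact h1
  | succ n ih =>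
    obtain ⟨w, hw, h3⟩ := h2
    refine ⟨w, ih hw, ?_⟩
    rcases h3 with h3 | ⟨h3, h4⟩
    · exact Or.inl h3
    · refine Or.inr ⟨h3, Or.inr ?_⟩
      rcases h4 with rfl | h4
      · exact hy
      · exact h4

lemma Path.mono {D : Set V} {h n m : ℕ} {x y : MulAut (FreeGroup V)} (p : Path D h n x y) (hm : n ≤ m) :
    Path D h m x y := by
  induction m, hm using Nat.le_induction with
  | base => exact p
  | succ m _ ih => exact ⟨y, ih, Or.inl rfl⟩

lemma Edge.path {D : Set V} {h n : ℕ} {x y : MulAut (FreeGroup V)} (e : Edge D h x y) :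
    Path D h (n + 1) x y := ⟨x, Path.refl _ _ _ _, Or.inr ⟨e, Or.inl rfl⟩⟩

lemma Path.symm {D : Set V} {h n : ℕ} {x y : MulAut (FreeGroup V)} (p : Path D h n x y) :
    Path D h n y x := by
  induction n generalizing y with
  | zero => exact Eq.symm p
  | succ n ih =>
    obtain ⟨z, hz, hy⟩ := p
    rcases hy with rfl | ⟨hy, rfl | h4⟩
    · exact (ih hz).mono (by omega)
    · exact hy.symm.path
    · have := (hy.symm.path (n := 0)).trans (ih hz) h4
      rw [Nat.add_comm] at this
      exact this

end paths
end BirmanAux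

namespace BirmanAux
open FreeGroup (of)

section compat
variable {V : Type} [Fintype V] [DecidableEq V]

lemma im_C_of {w : MulAut (FreeGroup V)} {u : FreeGroup V} {A : Set (Lt V)}
    (h : ∀ x ∈ A, im w (C {x}) = tr u (C {x})) : im w (C A) = tr u (C A) := by
  have hA : ∀ g, g ∈ C A ↔ ∃ x ∈ A, g ∈ C {x} := by
    intro g; simp [C, -Prod.exists]
  ext g
  rw [mem_im, mem_tr, hA, hA]
  refine exists_congr fun x => and_congr_right fun hx => ?_
  have := Set.ext_iff.1 (h x hx) g
  exact this

lemma cp_C_disj (f : MulAut (FreeGroup V)) {A B : Set (Lt V)} {b : Lt V} (hb : b ∈ B) (hb' : linv b ∉ B)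
    (hd : ∀ x ∈ A, x ∉ B) (h' : linv b ∉ A) : cp (Wh B b * f) (C A) = cp f (C A) := by
  have : im (Wh B b) (C A) = tr 1 (C A) := by
    apply im_C_of
    intro x hx
    rw [Wh_im_single B b hb hb', pre_out (hd x hx)]
    intro h
    rcases fst_eq_iff.1 h with rfl | rfl
    · exact hd _ hx hb
    · exact h' hx
  rw [← cp_im (Wh B b) f (C A), this, cp_tr]

lemma cp_C_sub (f : MulAut (FreeGroup V)) {A B : Set (Lt V)} {b : Lt V} (hb : b ∈ B) (hb' : linv b ∉ B)
    (hd : ∀ x ∈ A, x ∈ B) (h' : b ∉ A) : cp (Wh B b * f) (C A) = cp f (C A) := by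
  have : im (Wh B b) (C A) = tr (elt b) (C A) := by
    apply im_C_of
    intro x hx
    have hx1 : x.1 ≠ b.1 := by
      intro h
      rcases fst_eq_iff.1 h with rfl | rfl
      · exact h' hx
      · exact hb' (hd _ hx)
    rw [Wh_im_single B b hb hb' _ hx1, pre_in (hd x hx) hx1]
  rw [← cp_im (Wh B b) f (C A), this, cp_tr]

lemma cp_C_sup (f : MulAut (FreeGroup V)) {A B : Set (Lt V)} {a : Lt V} (ha : a ∈ A) (ha' : linv a ∉ A)
    (hd : ∀ x ∈ A, x ∈ B) (h' : linv a ∈ B) : cp (Wh A a * f) (C B) = cp f (C B) := by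
  have h1 : im (Wh A a) (C Bᶜ) = tr 1 (C Bᶜ) := by
    apply im_C_of
    intro x hx
    rw [Wh_im_single A a ha ha', pre_out (fun h => hx (hd x h))]
    intro h
    rcases fst_eq_iff.1 h with rfl | rfl
    · exact hx (hd _ ha)
    · exact hx h'
  have h2 : im (Wh A a) (C B) = C B := by
    ext g
    have := Set.ext_iff.1 h1 g
    simp only [mem_im, mem_tr, inv_one, one_mul] at this ⊢
    have e : ∀ g, g ∈ C B ↔ g ≠ 1 ∧ ¬ g ∈ C Bᶜ := by
      intro g
      rcases hg : head g with _ | x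
      · rw [head_eq_none] at hg; subst hg; simp
      · rw [mem_C_of_head hg, mem_C_of_head hg]
        simp only [Set.mem_compl_iff, not_not]
        constructor
        · intro h; refine ⟨?_, h⟩; rintro rfl; simp at hg
        · exact fun h => h.2
    rw [e, e, this, Ne, Ne, EmbeddingLike.map_eq_one_iff]
  rw [← cp_im (Wh A a) f (C B), h2]

lemma cp_letter_Wh (f : MulAut (FreeGroup V)) {A : Set (Lt V)} {a b : Lt V} (ha : a ∈ A) (ha' : linv a ∉ A)
    (hab : b.1 ≠ a.1) : cp (Wh A a * f) (C {b}) = cp f (C {b}) := by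
  rw [← cp_im (Wh A a) f (C {b}), Wh_im_single A a ha ha' b hab, cp_tr]

lemma path_mid {D : Set V} {f x y w1 w2 : MulAut (FreeGroup V)} {h : ℕ} (h1 : w1 ∈ Om D) (h2 : w2 ∈ Om D)
    (e : w1 * x = w2 * y) (hx : nu (x * f) ≤ h) (hy : nu (y * f) ≤ h) (hm : nu (w1 * x * f) < h) :
    Path D h 3 (x * f) (y * f) := by
  have e1 : Edge D h (x * f) (w1 * x * f) := ⟨⟨w1, h1, by rw [mul_assoc]⟩, hx, hm.le, Or.inr hm⟩
  have e2 : Edge D h (y * f) (w1 * x * f) := ⟨⟨w2, h2, by rw [e, mul_assoc]⟩, hy, hm.le, Or.inr hm⟩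
  exact (e1.path (n := 0)).trans (e2.symm.path (n := 1)) hm

lemma nu_mid (f : MulAut (FreeGroup V)) {A B : Set (Lt V)} {a b : Lt V} (ha : a ∈ A) (ha' : linv a ∉ A)
    (hb : b ∈ B) (hb' : linv b ∉ B) (hab : a.1 ≠ b.1)
    (hA : cp (Wh B b * f) (C A) = cp f (C A)) :
    nu (Wh A a * Wh B b * f) + cp f (C {a}) + cp f (C {b}) = nu f + cp f (C A) + cp f (C B) := by
  have h1 := nu_Wh f B b hb hb'
  have h2 := nu_Wh (Wh B b * f) A a ha ha'
  rw [hA, cp_letter_Wh f hb hb' hab] at h2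
  rw [mul_assoc]; omega

lemma gam_qperm {D : Set V} {a b : Lt V} (hab : a.1 ≠ b.1) (ha : a.1 ∉ D) (hb : b.1 ∉ D) :
    qperm a b hab ∈ Om D := by
  refine Or.inr ⟨qperm_isPerm a b hab, ?_⟩
  intro v hv
  rw [← elt_true, qperm_elt, qcyc_other]
  · rintro rfl; exact ha hv
  · rintro rfl; exact hb hv

/-- changing the multiplier -/
lemma path_E2 {D : Set V} {f : MulAut (FreeGroup V)} {A : Set (Lt V)} {a b : Lt V} (hab : a.1 ≠ b.1)
    (hA : Adm D A a) (hb : b ∈ A) (hb' : linv b ∉ A) (haD : a.1 ∉ D) (hbD : b.1 ∉ D)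
    (h1 : cp f (C A) ≤ cp f (C {a})) (h2 : cp f (C A) < cp f (C {b})) :
    Path D (nu f) 2 (Wh A a * f) (Wh A b * f) ∧ nu (Wh A b * f) < nu f ∧ Adm D A b := by
  have e := Wh_E2 hab hA.mem hb hA.nmem hb'
  have n1 := nu_Wh f A a hA.mem hA.nmem
  have n2 := nu_Wh f A b hb hb'
  have hA2 : Adm D A b := by
    refine ⟨hb, hb', fun x hx hxb => hA.bal x hx ?_⟩
    intro h; rw [h] at hx; exact haD hx
  have e2 : b ≠ a := fun h => hab (by rw [h])
  have e3 : linv b ≠ linv a := fun h => hab (by rw [linv_inj.1 h])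
  have hA' : Adm D (insert (linv a) (A \ {a})) b := by
    refine ⟨by simp [hb, e2], by simp [e3, hb'], fun x hx hxb => ?_⟩
    have x0 : x.1 ≠ a.1 := fun h => haD (h ▸ hx)
    have x1 : x ≠ a := fun h => x0 (by rw [h])
    have x2 : x ≠ linv a := fun h => x0 (by rw [h]; rfl)
    have x3 : linv x ≠ a := fun h => x0 (by rw [← h]; rfl)
    have := hA.bal x hx x0
    simp [x1, x2, x3, linv_inj, this]
  have e4 : Wh A b * f = qperm a b hab * (Wh (insert (linv a) (A \ {a})) b * (Wh A a * f)) := by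
    rw [← e]; simp only [mul_assoc]
  have n3 : nu (Wh (insert (linv a) (A \ {a})) b * (Wh A a * f)) = nu (Wh A b * f) := by
    rw [e4, nu_perm (qperm_isPerm a b hab)]
  have E1 : Edge D (nu f) (Wh A a * f) (Wh (insert (linv a) (A \ {a})) b * (Wh A a * f)) :=
    ⟨⟨_, Om_Wh hA', rfl⟩, by omega, by omega, by omega⟩
  have E2 : Edge D (nu f) (Wh (insert (linv a) (A \ {a})) b * (Wh A a * f)) (Wh A b * f) :=
    ⟨⟨_, gam_qperm hab haD hbD, e4⟩, by omega, by omega, by omega⟩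
  exact ⟨(E1.path (n := 0)).trans (E2.path (n := 0)) (by omega), by omega, hA2⟩

lemma path_E1_nested {D : Set V} {f : MulAut (FreeGroup V)} {A B : Set (Lt V)} {b : Lt V}
    (hA : Adm D A b) (hB : Adm D B b) (hd : ∀ x ∈ A, x ∈ B) 
    (h1 : nu (Wh A b * f) ≤ nu f) (h2 : nu (Wh B b * f) ≤ nu f)
    (h3 : nu (Wh A b * f) < nu f ∨ nu (Wh B b * f) < nu f) :
    Path D (nu f) 1 (Wh A b * f) (Wh B b * f) := by
  have : Adm D (insert b (B \ A)) b := by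
    refine ⟨by simp, by simp [linv_ne, hB.nmem], fun x hx hxb => ?_⟩
    have x1 : x ≠ b := fun h => hxb (by rw [h])
    have x3 : linv x ≠ b := fun h => hxb (by rw [← h]; rfl)
    simp [x1, x3, hA.bal x hx hxb, hB.bal x hx hxb]
  exact Edge.path (n := 0) ⟨⟨_, Om_Wh this, by rw [← mul_assoc, Wh_E1_nested hd]⟩, h1, h2, h3⟩

lemma path_E1_disj {D : Set V} {f : MulAut (FreeGroup V)} {A B : Set (Lt V)} {b : Lt V}
    (hA : Adm D A (linv b)) (hB : Adm D B b) (hd : ∀ x ∈ A, x ∉ B) 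
    (h1 : nu (Wh A (linv b) * f) ≤ nu f) (h2 : nu (Wh B b * f) ≤ nu f)
    (h3 : nu (Wh A (linv b) * f) < nu f ∨ nu (Wh B b * f) < nu f) :
    Path D (nu f) 1 (Wh A (linv b) * f) (Wh B b * f) := by
  have : Adm D ((A ∪ B) \ {linv b}) b := by
    refine ⟨by simp [hB.mem, ne_linv], by simp, fun x hx hxb => ?_⟩
    have x1 : x ≠ linv b := fun h => hxb (by rw [h]; rfl)
    have x3 : x ≠ b := fun h => hxb (by rw [h])
    simp [x1, x3, linv_inj, hA.bal x hx hxb, hB.bal x hx hxb]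
  exact Edge.path (n := 0) ⟨⟨_, Om_Wh this, by rw [← mul_assoc, Wh_E1_disj hd]⟩, h1, h2, h3⟩

lemma compat_disj {D : Set V} {f : MulAut (FreeGroup V)} {A B : Set (Lt V)} {a b : Lt V}
    (hA : Adm D A a) (hB : Adm D B b) (hd : ∀ x ∈ A, x ∉ B)
    (h1 : cp f (C A) ≤ cp f (C {a})) (h2 : cp f (C B) ≤ cp f (C {b}))
    (h3 : cp f (C A) < cp f (C {a}) ∨ cp f (C B) < cp f (C {b})) :
    Path D (nu f) 3 (Wh A a * f) (Wh B b * f) := by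
  have n1 := nu_Wh f A a hA.mem hA.nmem
  have n2 := nu_Wh f B b hB.mem hB.nmem
  by_cases hab : a.1 = b.1
  · rcases fst_eq_iff.1 hab with rfl | rfl
    · exact absurd hB.mem (hd _ hA.mem)
    · exact (path_E1_disj hA hB hd (by omega) (by omega) (by omega)).mono (by omega)
  have hba : b.1 ≠ a.1 := fun h => hab h.symm
  have hd' : ∀ x ∈ B, x ∉ A := fun x h h' => hd x h' h
  by_cases c1 : linv a ∈ B <;> by_cases c2 : linv b ∈ A
  · -- D4
    have haD : a.1 ∉ D := fun h => hd a hA.mem ((hB.bal a h hab).2 c1)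
    have hbD : b.1 ∉ D := fun h => hd b ((hA.bal b h hba).2 c2) hB.mem
    by_cases hc : cp f (C A) < cp f (C {b})
    · obtain ⟨p1, p2, p3⟩ := path_E2 (b := linv b) (f := f) hab hA c2 (by simpa using hd' _ hB.mem) haD hbD h1 
        (by rw [cp_linv]; exact hc)
      exact p1.trans (path_E1_disj p3 hB hd (by omega) (by omega) (by omega)) (by omega)
    · obtain ⟨p1, p2, p3⟩ := path_E2 (b := linv a) (f := f) hba hB c1 (by simpa using hd _ hA.mem) hbD haD h2
        (by rw [cp_linv]; omega)
      exact (p1.trans (path_E1_disj p3 hA hd' (by omega) (by omega) (by omega)) (by omega)).symm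
  · -- D2
    have haD : a.1 ∉ D := fun h => hd a hA.mem ((hB.bal a h hab).2 c1)
    have e2 : b ≠ a := fun h => hab (by rw [h])
    have hB' : Adm D ((B ∪ A) \ {a}) b := by
      refine ⟨by simp [hB.mem, e2], by simp [hB.nmem, c2], fun x hx hxb => ?_⟩
      have x0 : x.1 ≠ a.1 := fun h => haD (h ▸ hx)
      have x1 : x ≠ a := fun h => x0 (by rw [h])
      have x3 : linv x ≠ a := fun h => x0 (by rw [← h]; rfl)
      simp [x1, x3, hA.bal x hx x0, hB.bal x hx hxb]
    have e := Wh_D2 hab hA.mem hB.mem hd c1 c2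
    have n3 := nu_mid f hA.mem hA.nmem hB.mem hB.nmem hab (cp_C_disj f hB.mem hB.nmem hd c2)
    exact path_mid (Om_Wh hB') (Om_Wh hA) e (by omega) (by omega) (by rw [e]; omega)
  · -- D3
    have hbD : b.1 ∉ D := fun h => hd b ((hA.bal b h hba).2 c2) hB.mem
    have e2 : a ≠ b := fun h => hab (by rw [h])
    have hB' : Adm D ((A ∪ B) \ {b}) a := by
      refine ⟨by simp [hA.mem, e2], by simp [hA.nmem, c1], fun x hx hxb => ?_⟩
      have x0 : x.1 ≠ b.1 := fun h => hbD (h ▸ hx)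
      have x1 : x ≠ b := fun h => x0 (by rw [h])
      have x3 : linv x ≠ b := fun h => x0 (by rw [← h]; rfl)
      simp [x1, x3, hA.bal x hx hxb, hB.bal x hx x0]
    have e := Wh_D2 hba hB.mem hA.mem hd' c2 c1
    have n3 := nu_mid f hB.mem hB.nmem hA.mem hA.nmem hba (cp_C_disj f hA.mem hA.nmem hd' c1)
    exact (path_mid (Om_Wh hB') (Om_Wh hB) e (by omega) (by omega) (by rw [e]; omega)).symm
  · -- D1
    have e := Wh_D1 hab hA.mem hB.mem hd c1 c2
    have n3 := nu_mid f hA.mem hA.nmem hB.mem hB.nmem hab (cp_C_disj f hB.mem hB.nmem hd c2)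
    exact path_mid (Om_Wh hB) (Om_Wh hA) e (by omega) (by omega) (by rw [e]; omega)

lemma compat_nested {D : Set V} {f : MulAut (FreeGroup V)} {A B : Set (Lt V)} {a b : Lt V}
    (hA : Adm D A a) (hB : Adm D B b) (hd : ∀ x ∈ A, x ∈ B)
    (h1 : cp f (C A) ≤ cp f (C {a})) (h2 : cp f (C B) ≤ cp f (C {b}))
    (h3 : cp f (C A) < cp f (C {a}) ∨ cp f (C B) < cp f (C {b})) :
    Path D (nu f) 3 (Wh A a * f) (Wh B b * f) := by
  have n1 := nu_Wh f A a hA.mem hA.nmem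
  have n2 := nu_Wh f B b hB.mem hB.nmem
  by_cases hab : a.1 = b.1
  · rcases fst_eq_iff.1 hab with rfl | rfl
    · exact (path_E1_nested hA hB hd (by omega) (by omega) (by omega)).mono (by omega)
    · exact absurd (hd _ hA.mem) hB.nmem
  have hba : b.1 ≠ a.1 := fun h => hab h.symm
  have hb2 : linv b ∉ A := fun h => hB.nmem (hd _ h)
  by_cases c1 : linv a ∈ B <;> by_cases c2 : b ∈ A
  · -- N2
    have hbD : b.1 ∉ D := fun h => hb2 ((hA.bal b h hba).1 c2)
    have e2 : a ≠ linv b := fun h => hab (by rw [h]; rfl)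
    have hB' : Adm D (insert (linv b) (B \ A)) (linv a) := by
      refine ⟨by simp [hA.nmem, c1], by simp [hA.mem, e2], fun x hx hxa => ?_⟩
      have x0 : x.1 ≠ b.1 := fun h => hbD (h ▸ hx)
      have x1 : x ≠ b := fun h => x0 (by rw [h])
      have x3 : x ≠ linv b := fun h => x0 (by rw [h]; rfl)
      simp [x1, x3, linv_inj, hA.bal x hx hxa, hB.bal x hx x0]
    have e := Wh_N2 hab hA.mem hA.nmem hd c1 c2 hB.nmem
    have n3 := nu_mid f hB.mem hB.nmem hA.mem hA.nmem hba (cp_C_sup f hA.mem hA.nmem hd c1)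
    exact path_mid (Om_Wh hB) (Om_Wh hB') e (by omega) (by omega) (by omega)
  · -- N1
    have e := Wh_N1 hab hA.mem hd c1 c2 hb2
    have n3 := nu_mid f hA.mem hA.nmem hB.mem hB.nmem hab (cp_C_sub f hB.mem hB.nmem hd c2)
    exact path_mid (Om_Wh hB) (Om_Wh hA) e (by omega) (by omega) (by rw [e]; omega)
  · -- N4
    have haD : a.1 ∉ D := fun h => c1 ((hB.bal a h hab).1 (hd _ hA.mem))
    have hbD : b.1 ∉ D := fun h => hb2 ((hA.bal b h hba).1 c2)
    by_cases hc : cp f (C A) < cp f (C {b})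
    · obtain ⟨p1, p2, p3⟩ := path_E2 (b := b) (f := f) hab hA c2 hb2 haD hbD h1 hc
      exact p1.trans (path_E1_nested p3 hB hd (by omega) (by omega) (by omega)) (by omega)
    · obtain ⟨p1, p2, p3⟩ := path_E2 (b := a) (f := f) hba hB (hd _ hA.mem) c1 hbD haD h2 (by omega)
      exact (p1.trans (path_E1_nested hA p3 hd (by omega) (by omega) (by omega)).symm (by omega)).symm
  · -- N3
    have haD : a.1 ∉ D := fun h => c1 ((hB.bal a h hab).1 (hd _ hA.mem))
    have e2 : linv b ≠ a := fun h => hab (by rw [← h]; rfl)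
    have hB' : Adm D (insert a (B \ A)) b := by
      refine ⟨by simp [hB.mem, c2], by simp [hB.nmem, e2], fun x hx hxb => ?_⟩
      have x0 : x.1 ≠ a.1 := fun h => haD (h ▸ hx)
      have x1 : x ≠ a := fun h => x0 (by rw [h])
      have x3 : linv x ≠ a := fun h => x0 (by rw [← h]; rfl)
      simp [x1, x3, hA.bal x hx x0, hB.bal x hx hxb]
    have e := Wh_N3 hab hA.mem hd c1 c2 hb2
    have n3 := nu_mid f hA.mem hA.nmem hB.mem hB.nmem hab (cp_C_sub f hB.mem hB.nmem hd c2)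
    exact path_mid (Om_Wh hB') (Om_Wh hA) e (by omega) (by omega) (by rw [e]; omega)

end compat
end BirmanAux

namespace BirmanAux
open FreeGroup (of)

section corner
variable {V : Type} [Fintype V] [DecidableEq V]

def SepA (D : Set V) (Q : Set (Lt V)) (a : Lt V) : Prop := ∃ q : Lt V, q.1 = a.1 ∧ Adm D Q q

lemma SepA_of {D : Set V} {A B : Set (Lt V)} {a b : Lt V} (hA : Adm D A a) (hB : Adm D B b)
    (hab : a.1 ≠ b.1) (φ : Prop → Prop → Prop)
    (h1 : φ True (a ∈ B) ↔ ¬ φ False (linv a ∈ B))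
    (h2 : b.1 ∈ D → (φ (b ∈ A) True ↔ φ (linv b ∈ A) False)) :
    SepA D {x | φ (x ∈ A) (x ∈ B)} a := by
  have ha : (a ∈ A) = True := eq_true hA.mem
  have ha' : (linv a ∈ A) = False := eq_false hA.nmem
  have hb : (b ∈ B) = True := eq_true hB.mem
  have hb' : (linv b ∈ B) = False := eq_false hB.nmem
  have bal : ∀ x : Lt V, x.1 ∈ D → x.1 ≠ a.1 → (x ∈ {x | φ (x ∈ A) (x ∈ B)} ↔ linv x ∈ {x | φ (x ∈ A) (x ∈ B)}) := by
    intro x hx hxa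
    by_cases hxb : x.1 = b.1
    · have hbD : b.1 ∈ D := hxb ▸ hx
      rcases fst_eq_iff.1 hxb with rfl | rfl
      · simpa only [Set.mem_ofPred_eq, hb, hb'] using h2 hbD
      · simpa only [Set.mem_ofPred_eq, hb, hb', linv_linv] using (h2 hbD).symm
    · simp only [Set.mem_ofPred_eq, propext (hA.bal x hx hxa), propext (hB.bal x hx hxb)]
  by_cases h : φ True (a ∈ B)
  · refine ⟨a, rfl, ?_, ?_, bal⟩
    · simpa only [Set.mem_ofPred_eq, ha] using h
    · simpa only [Set.mem_ofPred_eq, ha'] using h1.1 h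
  · refine ⟨linv a, rfl, ?_, ?_, bal⟩
    · simp only [Set.mem_ofPred_eq, ha']
      by_contra h'
      exact h (h1.2 h')
    · simpa only [Set.mem_ofPred_eq, ha, linv_linv] using h

lemma corner_cases {D : Set V} {A B : Set (Lt V)} {a b : Lt V} (hA : Adm D A a) (hB : Adm D B b) :
    (SepA D (A ∩ B) a ∧ SepA D (A ∪ B) b) ∨ (SepA D (A ∪ B) a ∧ SepA D (A ∩ B) b) ∨
    (SepA D (A \ B) a ∧ SepA D (B \ A) b) ∨ (SepA D (B \ A) a ∧ SepA D (A \ B) b) ∨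
    (SepA D (A ∩ B) a ∧ SepA D (A ∪ B) a ∧ SepA D (A \ B) b ∧ SepA D (B \ A) b) ∨
    (SepA D (A \ B) a ∧ SepA D (B \ A) a ∧ SepA D (A ∩ B) b ∧ SepA D (A ∪ B) b) := by
  by_cases hab : a.1 = b.1
  · rcases fst_eq_iff.1 hab with rfl | rfl
    · left
      refine ⟨⟨a, rfl, ⟨hA.mem, hB.mem⟩, fun h => hA.nmem h.1, ?_⟩, ⟨a, rfl, Or.inl hA.mem, ?_, ?_⟩⟩
      · intro x hx hxa
        simp only [Set.mem_inter_iff, hA.bal x hx hxa, hB.bal x hx hxa]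
      · rintro (h | h)
        · exact hA.nmem h
        · exact hB.nmem h
      · intro x hx hxa
        simp only [Set.mem_union, hA.bal x hx hxa, hB.bal x hx hxa]
    · right; right; left
      have h' := hA.nmem
      rw [linv_linv] at h'
      refine ⟨⟨_, rfl, ⟨hA.mem, hB.nmem⟩, fun h => hA.nmem h.1, ?_⟩, ⟨_, rfl, ⟨hB.mem, h'⟩, fun h => hB.nmem h.1, ?_⟩⟩
      · intro x hx hxa
        simp only [Set.mem_sdiff, hA.bal x hx hxa, hB.bal x hx hxa]
      · intro x hx hxa
        simp only [Set.mem_sdiff, hA.bal x hx hxa, hB.bal x hx hxa]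
  have hba : b.1 ≠ a.1 := fun h => hab h.symm
  have A1 := SepA_of hA hB hab (fun p q => p ∧ q)
  have A2 := SepA_of hA hB hab (fun p q => p ∧ ¬ q)
  have A3 := SepA_of hA hB hab (fun p q => q ∧ ¬ p)
  have A4 := SepA_of hA hB hab (fun p q => p ∨ q)
  have B1 := SepA_of hB hA hba (fun p q => q ∧ p)
  have B2 := SepA_of hB hA hba (fun p q => q ∧ ¬ p)
  have B3 := SepA_of hB hA hba (fun p q => p ∧ ¬ q)
  have B4 := SepA_of hB hA hba (fun p q => q ∨ p)
  change _ → _ → SepA D (A ∩ B) a at A1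
  change _ → _ → SepA D (A \ B) a at A2
  change _ → _ → SepA D (B \ A) a at A3
  change _ → _ → SepA D (A ∪ B) a at A4
  change _ → _ → SepA D (A ∩ B) b at B1
  change _ → _ → SepA D (A \ B) b at B2
  change _ → _ → SepA D (B \ A) b at B3
  change _ → _ → SepA D (A ∪ B) b at B4
  have c1 : a.1 ∈ D → (a ∈ B ↔ linv a ∈ B) := fun h => hB.bal a h hab
  have c2 : b.1 ∈ D → (b ∈ A ↔ linv b ∈ A) := fun h => hA.bal b h hba
  revert A1 A2 A3 A4 B1 B2 B3 B4 c1 c2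
  generalize SepA D (A ∩ B) a = s1
  generalize SepA D (A \ B) a = s2
  generalize SepA D (B \ A) a = s3
  generalize SepA D (A ∪ B) a = s4
  generalize SepA D (A ∩ B) b = t1
  generalize SepA D (A \ B) b = t2
  generalize SepA D (B \ A) b = t3
  generalize SepA D (A ∪ B) b = t4
  generalize (a ∈ B) = p1
  generalize (linv a ∈ B) = p2
  generalize (b ∈ A) = q1
  generalize (linv b ∈ A) = q2
  generalize (a.1 ∈ D) = d1
  generalize (b.1 ∈ D) = d2
  by_cases p1 <;> by_cases p2 <;> by_cases q1 <;> by_cases q2 <;> by_cases d1 <;> by_cases d2 <;> simp [*] <;> tauto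

lemma cp_corner1 (f : MulAut (FreeGroup V)) (A B : Set (Lt V)) :
    cp f (C (A ∩ B)) + cp f (C (A ∪ B)) ≤ cp f (C A) + cp f (C B) := by
  rw [C_inter, C_union]
  exact cp_submod f (AI_C A) (AI_C B)

lemma cp_corner2 (f : MulAut (FreeGroup V)) (A B : Set (Lt V)) :
    cp f (C (A \ B)) + cp f (C (B \ A)) ≤ cp f (C A) + cp f (C B) := by
  have := cp_submod f (AI_C A) (AI_C B).compl
  rw [cp_compl, ← cp_compl f (C A ∪ (C B)ᶜ)] at this
  rw [C_diff, C_diff]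
  have e : C B \ C A = (C A ∪ (C B)ᶜ)ᶜ := by ext g; simp [and_comm]
  rw [e]; exact this

def RedA (D : Set V) (f : MulAut (FreeGroup V)) (Q : Set (Lt V)) : Prop :=
  ∃ q, Adm D Q q ∧ cp f (C Q) < cp f (C {q})

lemma SepA.red {D : Set V} {f : MulAut (FreeGroup V)} {Q : Set (Lt V)} {a : Lt V} (h : SepA D Q a)
    (h' : cp f (C Q) < cp f (C {a})) : RedA D f Q := by
  obtain ⟨q, hq, hQ⟩ := h
  refine ⟨q, hQ, ?_⟩
  rw [cp_letter, hq, ← cp_letter]; exact h'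

lemma corner {D : Set V} {f : MulAut (FreeGroup V)} {A B : Set (Lt V)} {a b : Lt V} (hA : Adm D A a)
    (hB : Adm D B b) (h1 : cp f (C A) < cp f (C {a})) (h2 : cp f (C B) ≤ cp f (C {b})) :
    RedA D f (A ∩ B) ∨ RedA D f (A \ B) ∨ RedA D f (B \ A) ∨ RedA D f (A ∪ B) := by
  have e1 := cp_corner1 f A B
  have e2 := cp_corner2 f A B
  by_contra hcon
  push Not at hcon
  obtain ⟨k1, k2, k3, k4⟩ := hcon
  have K : ∀ Q, ¬ RedA D f Q → ∀ c, SepA D Q c → cp f (C {c}) ≤ cp f (C Q) := by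
    intro Q hQ c hc
    by_contra h
    exact hQ (hc.red (by omega))
  rcases corner_cases hA hB with ⟨x, y⟩ | ⟨x, y⟩ | ⟨x, y⟩ | ⟨x, y⟩ | ⟨x, y, z, t⟩ | ⟨x, y, z, t⟩
  · have := K _ k1 _ x; have := K _ k4 _ y; omega
  · have := K _ k4 _ x; have := K _ k1 _ y; omega
  · have := K _ k2 _ x; have := K _ k3 _ y; omega
  · have := K _ k3 _ x; have := K _ k2 _ y; omega
  · have := K _ k1 _ x; have := K _ k4 _ y; have := K _ k2 _ z; have := K _ k3 _ t; omega
  · have := K _ k2 _ x; have := K _ k3 _ y; have := K _ k1 _ z; have := K _ k4 _ t; omega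

lemma h2_Wh {D : Set V} {f : MulAut (FreeGroup V)} {A B : Set (Lt V)} {a b : Lt V} (hA : Adm D A a)
    (hB : Adm D B b) (h1 : cp f (C A) < cp f (C {a})) (h2 : cp f (C B) ≤ cp f (C {b})) :
    Path D (nu f) 6 (Wh A a * f) (Wh B b * f) := by
  have key : ∀ {Q q}, Adm D Q q → cp f (C Q) < cp f (C {q}) → nu (Wh Q q * f) < nu f := by
    intro Q q hQ h
    have := nu_Wh f Q q hQ.mem hQ.nmem
    omega
  rcases corner hA hB h1 h2 with ⟨q, hQ, h⟩ | ⟨q, hQ, h⟩ | ⟨q, hQ, h⟩ | ⟨q, hQ, h⟩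
  · exact (compat_nested hQ hA (fun x hx => hx.1) h.le h1.le (Or.inl h)).symm.trans
      (compat_nested hQ hB (fun x hx => hx.2) h.le h2 (Or.inl h)) (key hQ h)
  · exact (compat_nested hQ hA (fun x hx => hx.1) h.le h1.le (Or.inl h)).symm.trans
      (compat_disj hQ hB (fun x hx => hx.2) h.le h2 (Or.inl h)) (key hQ h)
  · exact (compat_disj hQ hA (fun x hx => hx.2) h.le h1.le (Or.inl h)).symm.trans
      (compat_nested hQ hB (fun x hx => hx.1) h.le h2 (Or.inl h)) (key hQ h)
  · exact (compat_nested hA hQ (fun x hx => Or.inl hx) h1.le h.le (Or.inl h1)).trans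
      (compat_nested hB hQ (fun x hx => Or.inr hx) h2 h.le (Or.inr h)).symm (key hQ h)

lemma h2_main {D : Set V} {f w1 w2 : MulAut (FreeGroup V)} (h1 : w1 ∈ Om D) (h2 : w2 ∈ Om D)
    (n1 : nu (w1 * f) < nu f) (n2 : nu (w2 * f) ≤ nu f) :
    Path D (nu f) 6 (w1 * f) (w2 * f) := by
  rcases h1 with ⟨A, a, hA, rfl⟩ | ⟨hp, _⟩
  · have e1 := nu_Wh f A a hA.mem hA.nmem
    rcases h2 with ⟨B, b, hB, rfl⟩ | ⟨hp, hpG⟩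
    · have e2 := nu_Wh f B b hB.mem hB.nmem
      exact h2_Wh hA hB (by omega) (by omega)
    · have n3 := nu_perm hp (Wh A a * f)
      have n4 := nu_perm hp f
      obtain ⟨π, p1, p2⟩ := hp
      have c := perm_conj p1 p2 A a
      have E1 : Edge D (nu f) (Wh A a * f) (w2 * (Wh A a * f)) :=
        ⟨⟨w2, Or.inr ⟨⟨π, p1, p2⟩, hpG⟩, rfl⟩, by omega, by omega, by omega⟩
      have E2 : Edge D (nu f) (w2 * f) (w2 * (Wh A a * f)) :=
        ⟨⟨_, Om_Wh (hA.perm hpG p1 p2), by rw [← mul_assoc, ← mul_assoc, c]⟩, by omega, by omega, by omega⟩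
      exact (E1.path (n := 0)).trans (E2.symm.path (n := 4)) (by omega)
  · rw [nu_perm hp] at n1; omega

end corner
end BirmanAux

namespace BirmanAux
open FreeGroup (of)

section cones
variable {V : Type} [DecidableEq V]

lemma head_inv_ne {h : FreeGroup V} (hh : h ≠ 1) : ∃ a, head h⁻¹ = some a := by
  rcases e : head h⁻¹ with _ | a
  · rw [head_eq_none, inv_eq_one] at e; exact absurd e hh
  · exact ⟨a, rfl⟩

lemma cone_mul (h : FreeGroup V) : ∀ k, h ≠ 1 → head k ≠ head h⁻¹ →
    FreeGroup.norm (h * k) = FreeGroup.norm h + FreeGroup.norm k ∧ head (h * k) = head h := by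
  induction h using red_induction with
  | h1 => intro k h; exact absurd rfl h
  | hm x g hx ih =>
    intro k _ hk
    have hne : head (g * k) ≠ some (linv x) ∧ FreeGroup.norm (g * k) = FreeGroup.norm g + FreeGroup.norm k := by
      by_cases hg : g = 1
      · subst hg
        simp only [one_mul, FreeGroup.norm_one, zero_add, and_true]
        rwa [mul_one, ← elt_linv, head_elt] at hk
      · have e : head (elt x * g)⁻¹ = head g⁻¹ := by
          by_contra hcon
          rw [mul_inv_rev, ← elt_linv] at hcon
          rcases head_mul_elt _ hcon with h | h
          · exact hg (inv_eq_one.1 h)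
          · rw [inv_inj] at h; rw [h, head_elt] at hx; exact hx rfl
        obtain ⟨i1, i2⟩ := ih k hg (by rw [← e]; exact hk)
        exact ⟨by rw [i2]; exact hx, i1⟩
    rw [mul_assoc]
    refine ⟨?_, ?_⟩
    · rw [norm_elt_mul x hne.1, norm_elt_mul x hx, hne.2]; ring
    · rw [head_elt_mul x hne.1, head_elt_mul x hx]

/-- `NH H h`: the cone at `h` is not homogeneous for `H` -/
def NH (H : Set (FreeGroup V)) (h : FreeGroup V) : Prop :=
  ∃ k1 k2, (h = 1 ∨ head k1 ≠ head h⁻¹) ∧ (h = 1 ∨ head k2 ≠ head h⁻¹) ∧ h * k1 ∈ H ∧ h * k2 ∉ H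

lemma norm_cone {h k : FreeGroup V} (hk : h = 1 ∨ head k ≠ head h⁻¹) :
    FreeGroup.norm h ≤ FreeGroup.norm (h * k) := by
  by_cases hh : h = 1
  · subst hh; simp
  · rw [(cone_mul h k hh (by tauto)).1]; omega

lemma cone_hom {H : Set (FreeGroup V)} {h : FreeGroup V}
    (hH : ∀ x g, g ∈ bd (elt x) H → FreeGroup.norm g < FreeGroup.norm h) (k : FreeGroup V)
    (hk : h = 1 ∨ head k ≠ head h⁻¹) : h * k ∈ H ↔ h ∈ H := by
  have : ∀ m : FreeGroup V, (h = 1 ∨ head m⁻¹ ≠ head h⁻¹) → (h * m⁻¹ ∈ H ↔ h ∈ H) := by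
    intro m
    induction m using red_induction with
    | h1 => simp
    | hm x m hx ih =>
      intro hk
      have hk' : h = 1 ∨ head m⁻¹ ≠ head h⁻¹ := by
        by_cases hh : h = 1
        · exact Or.inl hh
        right
        by_cases hm : m = 1
        · subst hm
          rw [inv_one, head_one]
          obtain ⟨a, ha⟩ := head_inv_ne hh
          rw [ha]; simp
        · have e : head (elt x * m)⁻¹ = head m⁻¹ := by
            by_contra hcon
            rw [mul_inv_rev, ← elt_linv] at hcon
            rcases head_mul_elt _ hcon with h | h
            · exact hm (inv_eq_one.1 h)
            · rw [inv_inj] at h; rw [h, head_elt] at hx; exact hx rfl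
          rw [← e]; tauto
      rw [← ih hk', mul_inv_rev, ← mul_assoc, ← elt_linv]
      have := hH (linv x) (h * m⁻¹)
      by_contra hcon
      have h2 := norm_cone hk'
      have := this (by simp only [bd, Set.mem_ofPred_eq]; tauto)
      omega
  simpa using this k⁻¹ (by simpa using hk)

lemma exists_NH_max [Finite V] {H : Set (FreeGroup V)} (hH : AI H) {x y : FreeGroup V} (hx : x ∈ H) (hy : y ∉ H) :
    ∃ h, NH H h ∧ ∀ h', NH H h' → FreeGroup.norm h' ≤ FreeGroup.norm h := by
  have h1 : NH H 1 := ⟨x, y, Or.inl rfl, Or.inl rfl, by simpa using hx, by simpa using hy⟩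
  have hfin : (⋃ x : Lt V, bd (elt x) H).Finite := Set.finite_iUnion (fun x => hH _)
  obtain ⟨n, hn⟩ := (hfin.image FreeGroup.norm).bddAbove
  have hb : ∀ h, NH H h → FreeGroup.norm h ≤ n := by
    rintro h ⟨k1, k2, c1, c2, m1, m2⟩
    by_contra hcon
    have : ∀ x g, g ∈ bd (elt x) H → FreeGroup.norm g < FreeGroup.norm h := by
      intro x g hg
      have := hn (Set.mem_image_of_mem _ (Set.mem_iUnion.2 ⟨x, hg⟩))
      omega
    rw [cone_hom this k1 c1] at m1
    rw [cone_hom this k2 c2] at m2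
    exact m2 m1
  by_contra hcon
  push Not at hcon
  have : ∀ m : ℕ, ∃ h, NH H h ∧ m ≤ FreeGroup.norm h := by
    intro m
    induction m with
    | zero => exact ⟨1, h1, by simp⟩
    | succ m ih =>
      obtain ⟨h, a, b⟩ := ih
      obtain ⟨h', a', b'⟩ := hcon h a
      exact ⟨h', a', by omega⟩
  obtain ⟨h, a, b⟩ := this (n + 1)
  have := hb h a
  omega

/-- homogeneity of subcones at a maximal element -/
lemma NH_max_sub {H : Set (FreeGroup V)} {h : FreeGroup V}
    (hm : ∀ h', NH H h' → FreeGroup.norm h' ≤ FreeGroup.norm h) {b : Lt V} (hb : head h⁻¹ ≠ some b)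
    {k : FreeGroup V} (hk : head k = some b) : h * k ∈ H ↔ h * elt b ∈ H := by
  have key : ∀ k1 k2 : FreeGroup V, head k1 = some b → head k2 = some b → h * k1 ∈ H → h * k2 ∈ H := by
    intro k1 k2 e1 e2 m1
    by_contra m2
    obtain ⟨l1, rfl, n1⟩ := exists_of_head e1
    obtain ⟨l2, rfl, n2⟩ := exists_of_head e2
    have e3 : head (h * elt b)⁻¹ = some (linv b) := by
      rw [mul_inv_rev]; exact head_inv_elt_mul b hb
    have e4 : FreeGroup.norm (h * elt b) = FreeGroup.norm h + 1 := by
      rw [← FreeGroup.norm_inv_eq, mul_inv_rev, ← elt_linv, norm_elt_mul _ (by simpa using hb), FreeGroup.norm_inv_eq]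
    have := hm (h * elt b) ⟨l1, l2, Or.inr (by rw [e3]; exact n1), Or.inr (by rw [e3]; exact n2),
      by rwa [mul_assoc], by rwa [mul_assoc]⟩
    omega
  exact ⟨key _ _ hk (head_elt b), key _ _ (head_elt b) hk⟩

end cones

section lines
variable {V : Type} [DecidableEq V]

lemma head_pow (x : Lt V) (n : ℕ) : head (elt x ^ (n + 1)) = some x := by
  induction n with
  | zero => simp
  | succ n ih =>
    rw [pow_succ']
    apply head_elt_mul
    rw [ih]
    simp [ne_linv]

lemma pow_inj (x : Lt V) : Function.Injective (fun n : ℕ => elt x ^ n) := by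
  have : ∀ n : ℕ, FreeGroup.norm (elt x ^ n) = n := by
    intro n
    induction n with
    | zero => simp
    | succ n ih =>
      rw [pow_succ', norm_elt_mul, ih]
      cases n with
      | zero => simp
      | succ n => rw [head_pow]; simp [ne_linv]
  intro m n h
  rw [← this m, ← this n]; exact congrArg _ h

/-- far away points of a line -/
lemma line_far {H : Set (FreeGroup V)} (hH : AI H) (h r : FreeGroup V) (x : Lt V) :
    ∃ n : ℕ, h * elt x ^ (n + 1) ∈ H ↔ h * elt x ^ (n + 1) * r ∈ H := by
  by_contra hcon
  push Not at hcon
  have : Set.range (fun n : ℕ => h * elt x ^ (n + 1)) ⊆ bd r H := by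
    rintro _ ⟨n, rfl⟩
    have := hcon n
    simp only [bd, Set.mem_ofPred_eq]; tauto
  refine Set.infinite_range_of_injective ?_ ((hH r).subset this)
  intro m n hmn
  have := pow_inj x (mul_left_cancel hmn)
  simpa using this

end lines
end BirmanAux

namespace BirmanAux
open FreeGroup (of)

section hyp
variable {V : Type} [DecidableEq V]

structure Hyp (D : Set V) (f : MulAut (FreeGroup V)) (H : Set (FreeGroup V)) (v : V) (c : FreeGroup V) : Prop where
  ai : AI H
  cr : ∀ w g, g ∈ bd (f (of w)) H ↔ w = v ∧ g = c
  hd : head c ≠ head (c * f (of v))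
  conj : ∀ y ∈ D, ∃ d, f (of y) = d⁻¹ * of y * d ∧ (y = v → d = c)

lemma Hyp.compl {D : Set V} {f : MulAut (FreeGroup V)} {H : Set (FreeGroup V)} {v : V} {c : FreeGroup V}
    (h : Hyp D f H v c) : Hyp D f Hᶜ v c :=
  ⟨h.ai.compl, by intro w g; rw [bd_compl]; exact h.cr w g, h.hd, h.conj⟩

lemma Hyp.cp_eq [Fintype V] {D : Set V} {f : MulAut (FreeGroup V)} {H : Set (FreeGroup V)} {v : V} {c : FreeGroup V}
    (h : Hyp D f H v c) : cp f H = 1 := by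
  have : ∀ w, N (f (of w)) H = if w = v then 1 else 0 := by
    intro w
    split_ifs with hw
    · have : bd (f (of w)) H = {c} := by ext g; rw [h.cr]; simp [hw]
      rw [N, this, Set.ncard_singleton]
    · have : bd (f (of w)) H = ∅ := by ext g; rw [h.cr]; simp [hw]
      rw [N, this, Set.ncard_empty]
  simp [cp, this]

lemma bd_letter (v w : V) (g : FreeGroup V) : g ∈ bd (of w) (C {(v, true)}) ↔ w = v ∧ g = 1 := by
  rw [← elt_true]
  by_cases h : head (g * elt (w, true)) = head g
  · have : ¬ g ∈ bd (elt (w, true)) (C {(v, true)}) := by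
      simp [bd, C, h]
    simp only [this, false_iff, not_and]
    rintro rfl rfl
    simp at h
  · rcases head_mul_elt _ h with rfl | rfl
    · simp [bd, C]
    · have e : head (elt (w, true))⁻¹ = some (w, false) := by rw [← elt_linv, head_elt]; rfl
      simp only [bd, C, Set.mem_singleton_iff, exists_eq_left, Set.mem_ofPred_eq, e, inv_mul_cancel, head_one]
      simp only [Option.some.injEq, Prod.mk.injEq, reduceCtorEq, and_false, not_true_eq_false, false_iff, not_and]
      intro _ h'
      rw [h', head_one] at e; simp at e

lemma exists_c {v : V} (m : FreeGroup V) : ∃ m', m⁻¹ * of v * m = m'⁻¹ * of v * m' ∧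
    head m' ≠ some (v, true) ∧ head m' ≠ some (v, false) := by
  induction m using red_induction with
  | h1 => exact ⟨1, by simp, by simp, by simp⟩
  | hm x g hx ih =>
    by_cases hxv : x.1 = v
    · obtain ⟨m', h1, h2⟩ := ih
      refine ⟨m', ?_, h2⟩
      rw [← h1]
      obtain ⟨w, b⟩ := x
      subst hxv
      cases b
      · rw [elt_false]; group
      · rw [elt_true]; group
    · refine ⟨elt x * g, rfl, ?_, ?_⟩ <;>
      · rw [head_elt_mul x hx]
        intro h; apply hxv; rw [Option.some.injEq] at h; rw [h]

lemma exists_Hyp {D : Set V} {f : MulAut (FreeGroup V)} (hf : f ∈ Gam D) (v : V) :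
    ∃ H c, Hyp D f H v c := by
  have hex : ∃ c : FreeGroup V, (v ∈ D → f (of v) = c⁻¹ * of v * c) ∧ head c ≠ head (c * f (of v)) := by
    by_cases hv : v ∈ D
    · obtain ⟨u, hu⟩ := isConj_iff.1 (hf v hv)
      obtain ⟨c, h1, h2, h3⟩ := exists_c (v := v) u⁻¹
      have e : f (of v) = c⁻¹ * of v * c := by rw [← h1, ← hu]; group
      refine ⟨c, fun _ => e, ?_⟩
      rw [e]
      have : c * (c⁻¹ * of v * c) = elt (v, true) * c := by rw [elt_true]; group
      rw [this, head_elt_mul _ h3]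
      exact h2
    · refine ⟨1, fun h => absurd h hv, ?_⟩
      rw [one_mul, head_one]
      intro h
      have := head_eq_none.1 h.symm
      rw [EmbeddingLike.map_eq_one_iff] at this
      exact FreeGroup.of_ne_one v this
  obtain ⟨c, h1, h2⟩ := hex
  refine ⟨tr c (im f (C {(v, true)})), c, ((AI_C _).im f).tr c, ?_, h2, ?_⟩
  · intro w g
    rw [bd_tr, bd_im]
    simp only [Set.mem_image, exists_exists_and_eq_and, bd_letter]
    constructor
    · rintro ⟨_, ⟨hw, rfl⟩, rfl⟩; simp [hw]
    · rintro ⟨hw, rfl⟩; exact ⟨1, ⟨hw, rfl⟩, by simp⟩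
  · intro y hy
    by_cases hyv : y = v
    · subst hyv; exact ⟨c, h1 hy, fun _ => rfl⟩
    · obtain ⟨u, hu⟩ := isConj_iff.1 (hf y hy)
      exact ⟨u⁻¹, by rw [← hu]; group, fun h => absurd h hyv⟩

lemma int_line {P : ℤ → Prop} (h : ∀ j, j ≠ 0 → (P j ↔ P (j + 1))) :
    (∀ n : ℕ, P (n + 1) ↔ P 1) ∧ (∀ n : ℕ, P (-(n + 1)) ↔ P 0) := by
  constructor
  · intro n
    induction n with
    | zero => simp
    | succ n ih => rw [← ih]; push_cast; exact (h (n + 1) (by omega)).symm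
  · intro n
    induction n with
    | zero => simpa using h (-1) (by omega)
    | succ n ih =>
      rw [← ih, h _ (by push_cast; omega)]
      push_cast
      rw [show (-((n:ℤ) + 1 + 1) + 1) = -(n + 1) by ring]

lemma elt_false_pow (y : V) (n : ℕ) : elt (y, false) ^ n = of y ^ (-(n : ℤ)) := by
  rw [elt_false]; simp

/-- behaviour of lines -/
lemma Hyp.line {D : Set V} {f : MulAut (FreeGroup V)} {H : Set (FreeGroup V)} {v : V} {c : FreeGroup V}
    (hy : Hyp D f H v c) {y : V} (hyD : y ∈ D) (h : FreeGroup V)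
    (h0 : y = v → ∀ j : ℤ, j ≠ 0 → h * of y ^ j ≠ 1) :
    ∃ n m, ((h * elt (y, true) ^ (n + 1) ∈ H ↔ h * elt (y, false) ^ (m + 1) ∈ H) ↔ ¬ (y = v ∧ h = 1)) := by
  obtain ⟨d, hd, hd'⟩ := hy.conj y hyD
  obtain ⟨n, hn⟩ := line_far hy.ai h d (y, true)
  obtain ⟨m, hm⟩ := line_far hy.ai h d (y, false)
  have step : ∀ j : ℤ, (h * of y ^ j * d ∈ H ↔ h * of y ^ (j + 1) * d ∈ H) ↔ ¬ (y = v ∧ h * of y ^ j = 1) := by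
    intro j
    have := hy.cr y (h * of y ^ j * d)
    simp only [bd, Set.mem_ofPred_eq] at this
    have e : h * of y ^ j * d * f (of y) = h * of y ^ (j + 1) * d := by
      rw [hd, zpow_add_one]; group
    rw [e] at this
    rw [← not_iff_comm.1 this]
    constructor
    · rintro h ⟨h1, h2⟩; exact h ⟨h1, by rw [h2, one_mul, hd' h1]⟩
    · rintro h ⟨h1, h2⟩; refine h ⟨h1, ?_⟩
      rw [hd' h1] at h2; simpa using h2
  obtain ⟨i1, i2⟩ := int_line (P := fun j => h * of y ^ j * d ∈ H) (fun j hj => (step j).2 (by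
    rintro ⟨h1, h2⟩; exact h0 h1 j hj h2))
  refine ⟨n, m, ?_⟩
  rw [hn, hm, elt_false_pow, elt_true]
  have e1 := i1 n
  have e2 := i2 m
  have e3 := step 0
  push_cast
  simp only [zpow_zero, mul_one, zero_add] at e1 e2 e3
  rw [e2, ← e3, iff_comm (a := h * d ∈ H)]
  have : (of y ^ ((n:ℤ) + 1)) = of y ^ (n + 1) := by norm_cast
  rw [this] at e1
  rw [e1]

lemma head_zpow (y : V) (j : ℤ) (hj : j ≠ 0) : ∃ b, head (of y ^ j) = some (y, b) := by
  rcases lt_trichotomy j 0 with h | h | h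
  · obtain ⟨n, rfl⟩ : ∃ n : ℕ, j = -((n + 1 : ℕ) : ℤ) := ⟨(-j - 1).toNat, by omega⟩
    rw [← elt_false_pow]; exact ⟨_, head_pow _ _⟩
  · exact absurd h hj
  · obtain ⟨n, rfl⟩ : ∃ n : ℕ, j = ((n + 1 : ℕ) : ℤ) := ⟨(j - 1).toNat, by omega⟩
    rw [zpow_natCast, ← elt_true]; exact ⟨_, head_pow _ _⟩

/-- balance at a maximal element -/
lemma Hyp.bal {D : Set V} {f : MulAut (FreeGroup V)} {H : Set (FreeGroup V)} {v : V} {c : FreeGroup V}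
    (hy : Hyp D f H v c) {h : FreeGroup V}
    (hm : ∀ h', NH H h' → FreeGroup.norm h' ≤ FreeGroup.norm h) {y : V} (hyD : y ∈ D)
    (h1 : ∀ b, head h⁻¹ ≠ some (y, b)) :
    (h * elt (y, true) ∈ H ↔ h * elt (y, false) ∈ H) ↔ ¬ (y = v ∧ h = 1) := by
  obtain ⟨n, m, e⟩ := hy.line hyD h (by
    rintro rfl j hj hcon
    obtain ⟨b, hb⟩ := head_zpow y j hj
    rw [← inv_eq_of_mul_eq_one_right hcon] at hb
    exact h1 b hb)
  rw [NH_max_sub hm (h1 true) (head_pow _ _), NH_max_sub hm (h1 false) (head_pow _ _)] at e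
  exact e

end hyp

section reduce
variable {V : Type} [Fintype V] [DecidableEq V]

def IsMin (D : Set V) (f : MulAut (FreeGroup V)) : Prop := ∀ A a, Adm D A a → cp f (C {a}) ≤ cp f (C A)

lemma Hyp.h_one {D : Set V} {f : MulAut (FreeGroup V)} {H : Set (FreeGroup V)} {v : V} {c : FreeGroup V}
    (hy : Hyp D f H v c) (hf : IsMin D f) {h : FreeGroup V} (hn : NH H h)
    (hm : ∀ h', NH H h' → FreeGroup.norm h' ≤ FreeGroup.norm h) (hH : h ∉ H) : h = 1 := by
  by_contra h1
  obtain ⟨a, ha⟩ := head_inv_ne h1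
  set B : Set (Lt V) := {b | b ≠ a ∧ h * elt b ∈ H} with hB
  have hsub : ∀ k b, head k = some b → b ≠ a → (h * k ∈ H ↔ b ∈ B) := by
    intro k b hk hb
    rw [NH_max_sub hm (by rw [ha]; simpa using hb.symm) hk]
    simp [hB, hb]
  -- the cone
  have cone_head : ∀ g, g ∈ tr h (C {a})ᶜ → head g = head h := by
    intro g hg
    have := (cone_mul h (h⁻¹ * g) h1 (by
      rw [ha]; intro h'
      exact hg (by rw [mem_C_of_head h']; rfl))).2
    rwa [mul_inv_cancel_left] at this
  have E1 : tr h (C B) = H ∩ tr h (C {a})ᶜ := by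
    ext g
    obtain ⟨k, rfl⟩ : ∃ k, g = h * k := ⟨h⁻¹ * g, by group⟩
    simp only [mem_tr, inv_mul_cancel_left, Set.mem_inter_iff, Set.mem_compl_iff]
    rcases hk : head k with _ | b
    · rw [head_eq_none] at hk; subst hk; simpa using hH
    · rw [mem_C_of_head hk, mem_C_of_head hk, Set.mem_singleton_iff]
      by_cases hb : b = a
      · simp [hB, hb]
      · rw [hsub k b hk hb]; simp [hb]
  have E2 : tr h (C (insert a B))ᶜ = Hᶜ ∩ tr h (C {a})ᶜ := by
    ext g
    obtain ⟨k, rfl⟩ : ∃ k, g = h * k := ⟨h⁻¹ * g, by group⟩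
    simp only [mem_tr, inv_mul_cancel_left, Set.mem_inter_iff, Set.mem_compl_iff]
    rcases hk : head k with _ | b
    · rw [head_eq_none] at hk; subst hk; simpa using hH
    · rw [mem_C_of_head hk, mem_C_of_head hk, Set.mem_singleton_iff]
      by_cases hb : b = a
      · simp [hb]
      · rw [hsub k b hk hb]; simp [hb]
  have c1 : cp f (C B) = cp f (tr h (C B)) := (cp_tr _ _ _).symm
  have c2 : cp f (C (insert a B)) = cp f (tr h (C (insert a B))ᶜ) := by rw [cp_tr, cp_compl]
  have c3 : cp f (C {a}) = cp f (tr h (C {a})ᶜ) := by rw [cp_tr, cp_compl]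
  have key : cp f (C B) + cp f (C (insert a B)) ≤ cp f (C {a}) := by
    rw [c1, c2, c3, E1, E2]
    simp only [cp, ← Finset.sum_add_distrib]
    refine Finset.sum_le_sum fun w _ => ?_
    have fin : (bd (f (of w)) (tr h (C {a})ᶜ)).Finite := ((AI_C _).compl.tr h) _
    have := ncard_submod (s := bd (f (of w)) (H ∩ tr h (C {a})ᶜ)) (t := bd (f (of w)) (Hᶜ ∩ tr h (C {a})ᶜ))
      fin Set.finite_empty ?_ ?_
    · simpa [N] using this
    · intro g hg
      by_cases hcr : g ∈ bd (f (of w)) H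
      · have hh : ¬ (g ∈ tr h (C {a})ᶜ ∧ g * f (of w) ∈ tr h (C {a})ᶜ) := by
          rintro ⟨m1, m2⟩
          obtain ⟨rfl, rfl⟩ := (hy.cr w g).1 hcr
          exact hy.hd (by rw [cone_head _ m1, cone_head _ m2])
        simp only [bd, Set.mem_ofPred_eq, Set.mem_union, Set.mem_inter_iff, Set.mem_compl_iff (s := H)] at hg hcr ⊢
        left; tauto
      · simp only [bd, Set.mem_ofPred_eq, Set.mem_union, Set.mem_inter_iff, Set.mem_compl_iff (s := H)] at hg hcr ⊢
        left; tauto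
    · intro g hg
      exfalso
      have hcr : g ∈ bd (f (of w)) H := by
        simp only [bd, Set.mem_ofPred_eq, Set.mem_inter_iff, Set.mem_compl_iff (s := H)] at hg ⊢
        tauto
      obtain ⟨rfl, rfl⟩ := (hy.cr w g).1 hcr
      have hh : (g ∈ tr h (C {a})ᶜ ∧ g * f (of w) ∈ tr h (C {a})ᶜ) := by
        simp only [bd, Set.mem_ofPred_eq, Set.mem_inter_iff, Set.mem_compl_iff (s := H)] at hg
        tauto
      exact hy.hd (by rw [cone_head _ hh.1, cone_head _ hh.2])
  have p2 : 1 ≤ cp f (C (insert a B)) :=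
    cp_pos (AI_C _) (x := elt a) (y := 1) (by rw [mem_C_of_head (head_elt a)]; simp) (by simp)
  have p1 : 1 ≤ cp f (C B) := by
    obtain ⟨k1, k2, n1, n2, m1, m2⟩ := hn
    have n1 : head k1 ≠ some a := by rw [← ha]; tauto
    rcases hk : head k1 with _ | b
    · rw [head_eq_none] at hk; subst hk; rw [mul_one] at m1; exact absurd m1 hH
    · have hb : b ≠ a := by rw [hk] at n1; simpa using n1
      exact cp_pos (AI_C _) (x := k1) (y := 1) (by rw [mem_C_of_head hk, ← hsub k1 b hk hb]; exact m1) (by simp)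
  have bal : ∀ x : Lt V, x.1 ∈ D → x.1 ≠ a.1 → (x ∈ B ↔ linv x ∈ B) := by
    rintro ⟨y, b⟩ hyD hya
    have := (hy.bal hm hyD (by intro b; rw [ha]; intro h'; apply hya; rw [Option.some.injEq] at h'; rw [h'])).2
      (by tauto)
    have e1 : (y, true) ≠ a := by rintro rfl; exact hya rfl
    have e2 : (y, false) ≠ a := by rintro rfl; exact hya rfl
    cases b
    · simp [hB, linv, e1, e2, this]
    · simp [hB, linv, e1, e2, this]
  by_cases hc : linv a ∈ B
  · have := hf B (linv a) ⟨hc, by simp [hB], fun x hx hxa => bal x hx hxa⟩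
    rw [cp_linv] at this
    omega
  · have := hf (insert a B) a ⟨by simp, by simp [linv_ne, hc], fun x hx hxa => ?_⟩
    · omega
    · have x1 : x ≠ a := fun h => hxa (by rw [h])
      have x3 : linv x ≠ a := fun h => hxa (by rw [← h]; rfl)
      simp [x1, x3, bal x hx hxa]

/-- for minimal `f` we obtain sets of letters -/
lemma exists_B {D : Set V} {f : MulAut (FreeGroup V)} (hfG : f ∈ Gam D) (hf : IsMin D f) (v : V) :
    ∃ B c, Hyp D f (C B) v c ∧ ∀ y ∈ D, (((y, true) ∈ B ↔ (y, false) ∈ B) ↔ y ≠ v) := by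
  have main : ∀ H c h, Hyp D f H v c → NH H h → (∀ h', NH H h' → FreeGroup.norm h' ≤ FreeGroup.norm h) → h ∉ H →
      ∃ B c, Hyp D f (C B) v c ∧ ∀ y ∈ D, (((y, true) ∈ B ↔ (y, false) ∈ B) ↔ y ≠ v) := by
    intro H c h hy hn hm hH
    have h1 := hy.h_one hf hn hm hH
    subst h1
    have e : H = C {b | elt b ∈ H} := by
      ext k
      rcases hk : head k with _ | b
      · rw [head_eq_none] at hk; subst hk; simpa using hH
      · have := NH_max_sub hm (b := b) (by simp) hk
        rw [one_mul, one_mul] at this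
        rw [mem_C_of_head hk, this]; rfl
    refine ⟨{b | elt b ∈ H}, c, by rw [← e]; exact hy, ?_⟩
    intro y hyD
    have := hy.bal hm hyD (by simp)
    simpa using this
  obtain ⟨H, c, hy⟩ := exists_Hyp hfG v
  have hne : ∃ x y, x ∈ H ∧ y ∉ H := by
    have := (hy.cr v c).2 ⟨rfl, rfl⟩
    by_cases hc : c ∈ H
    · exact ⟨c, c * f (of v), hc, by simp only [bd, Set.mem_ofPred_eq] at this; tauto⟩
    · exact ⟨c * f (of v), c, by simp only [bd, Set.mem_ofPred_eq] at this; tauto, hc⟩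
  obtain ⟨x, y, hx, hyy⟩ := hne
  obtain ⟨h, hn, hm⟩ := exists_NH_max hy.ai hx hyy
  by_cases hH : h ∈ H
  · have sw : ∀ h', NH Hᶜ h' ↔ NH H h' := by
      intro h'
      simp only [NH, Set.mem_compl_iff, not_not]
      constructor
      · rintro ⟨k1, k2, a, b, c, d⟩; exact ⟨k2, k1, b, a, d, c⟩
      · rintro ⟨k1, k2, a, b, c, d⟩; exact ⟨k2, k1, b, a, d, c⟩
    exact main Hᶜ c h hy.compl ((sw h).2 hn) (fun h' hh => hm h' ((sw h').1 hh)) (by simpa using hH)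
  · exact main H c h hy hn hm hH

end reduce
end BirmanAux

namespace BirmanAux
open FreeGroup (of)

section chi
variable {V : Type} [DecidableEq V]

noncomputable def ind (E : Set (FreeGroup V)) (g : FreeGroup V) : ℤ := E.indicator (fun _ => (1:ℤ)) g

lemma ind_mem {E : Set (FreeGroup V)} {g} (h : g ∈ E) : ind E g = 1 := by simp [ind, h]
lemma ind_nmem {E : Set (FreeGroup V)} {g} (h : g ∉ E) : ind E g = 0 := by simp [ind, h]

lemma ind_sub_of_nbd {E : Set (FreeGroup V)} {g r : FreeGroup V} (h : g ∉ bd r E) : ind E (g * r) - ind E g = 0 := by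
  have : g ∈ E ↔ g * r ∈ E := by simpa [bd] using h
  by_cases hg : g ∈ E
  · rw [ind_mem hg, ind_mem (this.1 hg)]; rfl
  · rw [ind_nmem hg, ind_nmem (fun h => hg (this.2 h))]; rfl

lemma ind_supp (E : Set (FreeGroup V)) (r : FreeGroup V) :
    Function.support (fun g => ind E (g * r) - ind E g) ⊆ bd r E := by
  intro g hg
  by_contra h
  exact hg (ind_sub_of_nbd h)

noncomputable def chi (E : Set (FreeGroup V)) (hE : AI E) : FreeGroup V →* Multiplicative ℤ :=
  MonoidHom.mk' (fun r => Multiplicative.ofAdd (∑ᶠ g, (ind E (g * r) - ind E g))) (by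
    intro r s
    rw [← ofAdd_add]
    congr 1
    have e : ∑ᶠ g, (ind E (g * s) - ind E g) = ∑ᶠ g, (ind E (g * r * s) - ind E (g * r)) :=
      (finsum_comp_equiv (Equiv.mulRight r) (f := fun g => ind E (g * s) - ind E g)).symm
    rw [e, ← finsum_add_distrib ((hE r).subset (ind_supp E r))]
    · apply finsum_congr; intro g; rw [mul_assoc]; ring
    · have : (fun g => ind E (g * r * s) - ind E (g * r)) = (fun g => ind E (g * s) - ind E g) ∘ (fun g => g * r) := rfl
      change Set.Finite (Function.support _)
      rw [this, Function.support_comp_eq_preimage]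
      exact ((hE s).subset (ind_supp E s)).preimage (mul_left_injective r).injOn)

lemma chi_apply (E : Set (FreeGroup V)) (hE : AI E) (r) :
    chi E hE r = Multiplicative.ofAdd (∑ᶠ g, (ind E (g * r) - ind E g)) := rfl

lemma chi_letter (B : Set (Lt V)) (x : V) (h : (x, true) ∈ B ↔ (x, false) ∈ B) :
    chi (C B) (AI_C B) (of x) = 1 := by
  rw [chi_apply, ofAdd_eq_one]
  have : Function.support (fun g => ind (C B) (g * of x) - ind (C B) g) ⊆
      (({1, (of x)⁻¹} : Finset (FreeGroup V)) : Set (FreeGroup V)) := by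
    intro g hg'
    by_contra hg
    apply hg'
    apply ind_sub_of_nbd
    simp only [Finset.coe_insert, Finset.coe_singleton, Set.mem_insert_iff, Set.mem_singleton_iff, not_or] at hg
    have : head (g * of x) = head g := by
      by_contra hh
      rcases head_mul_elt (x, true) hh with h | h
      · exact hg.1 h
      · exact hg.2 h
    simp [bd, C, this]
  rw [finsum_eq_sum_of_support_subset _ this, Finset.sum_pair]
  · have e1 : ind (C B) 1 = 0 := ind_nmem (by simp)
    have h1 : head (of x) = some (x, true) := by rw [← elt_true, head_elt]
    have h2 : head (of x)⁻¹ = some (x, false) := by rw [← elt_true, ← elt_linv, head_elt]; rfl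
    simp only [one_mul, inv_mul_cancel, e1]
    by_cases hx : (x, true) ∈ B
    · rw [ind_mem ((mem_C_of_head h1).2 hx), ind_mem ((mem_C_of_head h2).2 (h.1 hx))]; norm_num
    · rw [ind_nmem (fun h' => hx ((mem_C_of_head h1).1 h')), ind_nmem (fun h' => hx (h.2 ((mem_C_of_head h2).1 h')))]; norm_num
  · intro h; rw [eq_comm, inv_eq_one] at h; exact FreeGroup.of_ne_one x h

/-- exponent sum -/
def theta (v : V) : FreeGroup V →* Multiplicative ℤ :=
  FreeGroup.lift (fun w => if w = v then Multiplicative.ofAdd 1 else 1)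

lemma theta_of (v w : V) : theta v (of w) = if w = v then Multiplicative.ofAdd 1 else 1 := by simp [theta]

lemma Hyp.chi_eq {D : Set V} {f : MulAut (FreeGroup V)} {B : Set (Lt V)} {v : V} {c : FreeGroup V}
    (hy : Hyp D f (C B) v c) {g : FreeGroup V} (hg : chi (C B) (AI_C B) (f g) = 1) : theta v g = 1 := by
  have h1 : ∀ w, w ≠ v → chi (C B) (AI_C B) (f (of w)) = 1 := by
    intro w hw
    rw [chi_apply, ofAdd_eq_one]
    rw [← finsum_zero (α := FreeGroup V)]
    apply finsum_congr
    intro g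
    apply ind_sub_of_nbd
    rw [hy.cr]; tauto
  have h2 : chi (C B) (AI_C B) (f (of v)) ≠ 1 := by
    rw [chi_apply, Ne, ofAdd_eq_one, finsum_eq_single _ c]
    · have := (hy.cr v c).2 ⟨rfl, rfl⟩
      simp only [bd, Set.mem_ofPred_eq] at this
      by_cases hc : c ∈ C B
      · rw [ind_mem hc, ind_nmem (by tauto)]; norm_num
      · rw [ind_nmem hc, ind_mem (by tauto)]; norm_num
    · intro g hg
      apply ind_sub_of_nbd
      rw [hy.cr]; tauto
  set z := Multiplicative.toAdd (chi (C B) (AI_C B) (f (of v))) with hz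
  have h3 : (chi (C B) (AI_C B)).comp f.toMonoidHom = (zpowGroupHom z).comp (theta v) := by
    ext w
    simp only [MonoidHom.comp_apply, MulEquiv.toMonoidHom_eq_coe, MonoidHom.coe_coe, theta_of]
    split_ifs with hw
    · subst hw
      simp [hz, zpowGroupHom]
    · rw [h1 w hw]; simp
  have h4 := DFunLike.congr_fun h3 g
  simp only [MonoidHom.comp_apply, MulEquiv.toMonoidHom_eq_coe, MonoidHom.coe_coe, hg] at h4
  have h5 : Multiplicative.toAdd (theta v g) * z = 0 := by
    have := congrArg Multiplicative.toAdd h4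
    simp [zpowGroupHom] at this
    rcases this with h | h <;> simp [h]
  have hz0 : z ≠ 0 := by
    intro h
    exact h2 (by rw [hz] at h; exact h)
  rcases mul_eq_zero.1 h5 with h | h
  · exact h
  · exact absurd h hz0

end chi

section final
variable {V : Type} [Fintype V] [DecidableEq V]

lemma theta_sum (φ : FreeGroup V →* Multiplicative ℤ) (g : FreeGroup V) :
    φ g = ∏ w, (φ (of w)) ^ (Multiplicative.toAdd (theta w g)) := by
  have : φ = ∏ w, (zpowersHom (Multiplicative ℤ) (φ (of w))).comp (theta w) := by
    ext v
    rw [MonoidHom.finsetProd_apply, Finset.prod_eq_single v]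
    · simp [theta_of]
    · intro w _ hw
      simp [theta_of, hw.symm]
    · simp
  conv_lhs => rw [this]
  rw [MonoidHom.finsetProd_apply]
  rfl

lemma cp_one_C {f : MulAut (FreeGroup V)} (a : Lt V) : 1 ≤ cp f (C {a}) :=
  cp_pos (AI_C _) (x := elt a) (y := 1) (by rw [mem_C_of_head (head_elt a)]; simp) (by simp)

lemma deg_le_one {D : Set V} {f : MulAut (FreeGroup V)} (hfG : f ∈ Gam D) (hf : IsMin D f) (v : V) :
    cp f (C {(v, true)}) ≤ 1 := by
  have fin : ∀ w B c, Hyp D f (C B) w c → (∀ y ∈ D, y ≠ v → ((y, true) ∈ B ↔ (y, false) ∈ B)) →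
      ¬ ((v, true) ∈ B ↔ (v, false) ∈ B) → cp f (C {(v, true)}) ≤ 1 := by
    intro w B c hy h1 h2
    have bal : ∀ x : Lt V, x.1 ∈ D → x.1 ≠ v → (x ∈ B ↔ linv x ∈ B) := by
      rintro ⟨y, b⟩ hyD hyv
      cases b
      · exact (h1 y hyD hyv).symm
      · exact h1 y hyD hyv
    rw [← hy.cp_eq]
    by_cases hv : (v, true) ∈ B
    · exact hf B (v, true) ⟨hv, fun h => h2 ⟨fun _ => h, fun _ => hv⟩, bal⟩
    · rw [← cp_linv]
      exact hf B (v, false) ⟨by tauto, hv, bal⟩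
  by_cases hv : v ∈ D
  · obtain ⟨B, c, hy, hB⟩ := exists_B hfG hf v
    exact fin v B c hy (fun y hyD hyv => (hB y hyD).2 hyv) (fun h => (hB v hv).1 h rfl)
  · by_contra hcon
    have hns : ∀ w ∉ D, theta w (f⁻¹ (of v)) = 1 := by
      intro w hw
      obtain ⟨B, c, hy, hB⟩ := exists_B hfG hf w
      apply hy.chi_eq
      rw [MulAut.apply_inv_self]
      apply chi_letter
      by_contra h2
      exact hcon (fin w B c hy (fun y hyD hyv => (hB y hyD).2 (by rintro rfl; exact hw hyD)) h2)
    have h1 := theta_sum ((theta v).comp f.toMonoidHom) (f⁻¹ (of v))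
    rw [Finset.prod_eq_one] at h1
    · simp [MulAut.apply_inv_self, theta_of] at h1
    · intro w _
      by_cases hw : w ∈ D
      · obtain ⟨u, hu⟩ := isConj_iff.1 (hfG w hw)
        have hwv : w ≠ v := by rintro rfl; exact hv hw
        simp [← hu, theta_of, hwv]
      · rw [hns w hw]; simp

lemma N_linv (r : FreeGroup V) (a : Lt V) : N r (C {linv a}) = N r (C {a}) := by
  rw [C_singleton_linv, N_tr, N_compl]

lemma N_letter (r : FreeGroup V) (a : Lt V) : N r (C {a}) = N r (C {(a.1, true)}) := by
  obtain ⟨v, b⟩ := a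
  cases b
  · exact N_linv r (v, true)
  · rfl

lemma nu_swap (f : MulAut (FreeGroup V)) : nu f = ∑ w, ∑ v, N (f (of w)) (C {(v, true)}) := by
  rw [nu, Finset.sum_comm]; rfl

lemma isPerm_of_nu {f : MulAut (FreeGroup V)} (h : nu f ≤ Fintype.card V) : IsPerm f := by
  have hd : ∀ w, ∃ x, head (f (of w)) = some x := by
    intro w
    rcases e : head (f (of w)) with _ | x
    · rw [head_eq_none, EmbeddingLike.map_eq_one_iff] at e; exact absurd e (FreeGroup.of_ne_one w)
    · exact ⟨x, rfl⟩
  have pos : ∀ {r : FreeGroup V} {g : FreeGroup V} {a : Lt V}, g ∈ bd r (C {a}) → 1 ≤ N r (C {(a.1, true)}) := by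
    intro r g a hg
    rw [← N_letter, N]
    exact (Set.ncard_pos (AI_C _ r)).2 ⟨g, hg⟩
  have bd1 : ∀ {r : FreeGroup V} {x : Lt V}, head r = some x → 1 ∈ bd r (C {x}) := by
    intro r x hx
    simp only [bd, Set.mem_ofPred_eq, one_mul, one_notMem_C, mem_C_of_head hx]; simp
  have ge1 : ∀ w, 1 ≤ ∑ v, N (f (of w)) (C {(v, true)}) := by
    intro w
    obtain ⟨x, hx⟩ := hd w
    exact (pos (bd1 hx)).trans (Finset.single_le_sum (f := fun v => N (f (of w)) (C {(v, true)})) (fun _ _ => Nat.zero_le _) (Finset.mem_univ _))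
  have eq1 : ∀ w, ∑ v, N (f (of w)) (C {(v, true)}) = 1 := by
    have h2 : ∑ w, ∑ v, N (f (of w)) (C {(v, true)}) ≤ ∑ w : V, 1 := by
      rw [← nu_swap]; simpa using h
    intro w
    exact ((Finset.sum_eq_sum_iff_of_le (fun w _ => ge1 w)).1 (le_antisymm (Finset.sum_le_sum fun w _ => ge1 w) h2) w
      (Finset.mem_univ w)).symm
  have img : ∀ w, ∃ x, f (of w) = elt x := by
    intro w
    obtain ⟨x, hx⟩ := hd w
    refine ⟨x, ?_⟩
    have e1 := eq1 w
    have b1 := bd1 hx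
    revert e1 b1
    obtain ⟨r', hr, hx'⟩ := exists_of_head hx
    rw [hr]
    intro e1 b1
    rcases hh : head r' with _ | y
    · rw [head_eq_none] at hh; rw [hh, mul_one]
    exfalso
    rw [hh] at hx'
    have hyx : y ≠ linv x := by simpa using hx'
    have b2 : (elt x)⁻¹ ∈ bd (elt x * r') (C {y}) := by
      have : head (elt x)⁻¹ = some (linv x) := by rw [← elt_linv, head_elt]
      simp only [bd, Set.mem_ofPred_eq, inv_mul_cancel_left, mem_C_of_head this, mem_C_of_head hh]
      simp [hyx.symm]
    by_cases hxy : y.1 = x.1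
    · rcases fst_eq_iff.1 hxy with rfl | rfl
      · have h2 : 2 ≤ N (elt y * r') (C {y}) := by
          have hne : (1 : FreeGroup V) ≠ (elt y)⁻¹ := by
            intro h'
            have := congrArg head h'
            rw [← elt_linv, head_elt] at this; simp at this
          rw [N, ← Set.ncard_pair hne]
          apply Set.ncard_le_ncard _ (AI_C _ _)
          rintro g (rfl | rfl)
          · exact b1
          · exact b2
        rw [N_letter] at h2
        have := Finset.single_le_sum (f := fun v => N (elt y * r') (C {(v, true)})) (fun _ _ => Nat.zero_le _) (Finset.mem_univ y.1)
        omega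
      · exact hyx rfl
    · have := Finset.sum_le_sum_of_subset (f := fun v => N (elt x * r') (C {(v, true)})) (Finset.subset_univ {y.1, x.1})
      rw [Finset.sum_pair hxy, e1] at this
      have := pos b1
      have := pos b2
      omega
  choose τ hτ using img
  let p : Lt V → Lt V := fun x => if x.2 then τ x.1 else linv (τ x.1)
  have hp : ∀ x, f (elt x) = elt (p x) := by
    rintro ⟨v, b⟩
    cases b
    · simp [p, elt_false, ← hτ]
    · simp [p, elt_true, ← hτ]
  have einj : ∀ x y : Lt V, elt x = elt y → x = y := by
    intro x y h
    have := congrArg head h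
    simpa using this
  have inj : Function.Injective p := by
    intro x y hxy
    apply einj
    apply f.injective
    rw [hp, hp, hxy]
  refine ⟨Equiv.ofBijective p (Finite.injective_iff_bijective.1 inj), ?_, hp⟩
  intro x
  apply einj
  simp only [Equiv.ofBijective_apply]
  rw [← hp, elt_linv, elt_linv, map_inv, hp]

lemma nu_one : nu (1 : MulAut (FreeGroup V)) = Fintype.card V := by
  have : ∀ v w : V, N (of w) (C {(v, true)}) = if w = v then 1 else 0 := by
    intro v w
    split_ifs with hw
    · have : bd (of w) (C {(v, true)}) = {1} := by ext g; rw [bd_letter]; simp [hw]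
      rw [N, this, Set.ncard_singleton]
    · have : bd (of w) (C {(v, true)}) = ∅ := by ext g; rw [bd_letter]; simp [hw]
      rw [N, this, Set.ncard_empty]
  simp [nu, cp, this]

lemma nu_of_isPerm {p : MulAut (FreeGroup V)} (h : IsPerm p) : nu p = Fintype.card V := by
  have := nu_perm h 1
  rwa [mul_one, nu_one] at this

lemma exists_reduce {D : Set V} {f : MulAut (FreeGroup V)} (hfG : f ∈ Gam D) (hp : ¬ IsPerm f) :
    ∃ w ∈ Om D, nu (w * f) < nu f := by
  by_contra hcon
  push Not at hcon
  apply hp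
  apply isPerm_of_nu
  have hf : IsMin D f := by
    intro A a hA
    have := hcon _ (Om_Wh hA)
    have := nu_Wh f A a hA.mem hA.nmem
    omega
  calc nu f ≤ ∑ v : V, 1 := Finset.sum_le_sum fun v _ => deg_le_one hfG hf v
    _ = _ := by simp

end final
end BirmanAux

namespace BirmanAux
open FreeGroup (of)

/-- `Ω` with relations of length at most `L` presents `Γ`. -/
def Pres {M : Type} [Group M] (Γ : Subgroup M) (Ω : Set M) (L : ℕ) : Prop :=
  ∀ (G : Type) [Group G] (s : M → G),
    (∀ l : List M, (∀ x ∈ l, x ∈ Ω) → l.length ≤ L → l.prod = 1 → (l.map s).prod = 1) →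
    ∃ Ψ : Γ →* G, ∀ ω (hΓ : ω ∈ Γ), ω ∈ Ω → Ψ ⟨ω, hΓ⟩ = s ω

section morse
variable {V : Type} [Fintype V] [DecidableEq V]

lemma path_list {D : Set V} {G : Type} [Group G] {s σ : MulAut (FreeGroup V) → G} {h : ℕ} (n : ℕ)
    {x y : MulAut (FreeGroup V)} (hx : nu x < h) (hxG : x ∈ Gam D)
    (hE : ∀ a w, w ∈ Om D → a ∈ Gam D → nu a < h → (nu (w * a) < h ∨ w * a = y) → σ (w * a) = s w * σ a)
    (p : Path D h n x y) : ∃ l : List (MulAut (FreeGroup V)), l.length ≤ n ∧ (∀ w ∈ l, w ∈ Om D) ∧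
      y = l.prod * x ∧ y ∈ Gam D ∧ σ y = (l.map s).prod * σ x := by
  induction n generalizing y with
  | zero => cases p; exact ⟨[], by simp, by simp, by simp, hxG, by simp⟩
  | succ n ih =>
    obtain ⟨z, hz, hzy⟩ := p
    rcases hzy with rfl | ⟨⟨⟨w, hw, rfl⟩, e⟩, hzx⟩
    · obtain ⟨l, a, b⟩ := ih hE hz
      exact ⟨l, by omega, b⟩
    · have hz1 : nu z < h := by
        rcases hzx with rfl | h'
        · exact hx
        · exact h'
      obtain ⟨l, h1, h2, h3, h4, h5⟩ := ih (by
        intro a w hw ha hna hh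
        refine hE a w hw ha hna (Or.inl ?_)
        rcases hh with h' | h'
        · exact h'
        · rw [h']; exact hz1) hz
      refine ⟨w :: l, by simpa using h1, ?_, ?_, mul_mem (Om_sub hw) h4, ?_⟩
      · intro w' hw'
        rcases List.mem_cons.1 hw' with rfl | h'
        · exact hw
        · exact h2 _ h'
      · rw [List.prod_cons, mul_assoc, ← h3]
      · rw [hE z w hw h4 hz1 (Or.inr rfl), h5, List.map_cons, List.prod_cons, mul_assoc]

theorem pres_Om (D : Set V) : Pres (Gam D) (Om D) 8 := by
  intro G _ s hs
  classical
  let P : Set (MulAut (FreeGroup V)) := {p | IsPerm p ∧ p ∈ Gam D}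
  have hPΩ : ∀ p ∈ P, p ∈ Om D := fun p hp => Or.inr hp
  have one_P : (1 : MulAut (FreeGroup V)) ∈ P := ⟨IsPerm.one, one_mem _⟩
  have s1 : s 1 = 1 := by
    simpa using hs [1] (by simpa using hPΩ 1 one_P) (by simp) (by simp)
  have sinv : ∀ w ∈ Om D, s w⁻¹ = (s w)⁻¹ := by
    intro w hw
    have := hs [w⁻¹, w] (by simp [hw, Om_inv hw]) (by simp) (by simp)
    simp at this
    exact eq_inv_of_mul_eq_one_left this
  have hred : ∀ f, ∃ w, f ∈ Gam D → f ∉ P → w ∈ Om D ∧ nu (w * f) < nu f := by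
    intro f
    by_cases h : f ∈ Gam D ∧ f ∉ P
    · obtain ⟨w, h1, h2⟩ := exists_reduce h.1 (fun hp => h.2 ⟨hp, h.1⟩)
      exact ⟨w, fun _ _ => ⟨h1, h2⟩⟩
    · exact ⟨1, fun a b => absurd ⟨a, b⟩ h⟩
  choose red hred using hred
  have hσ : ∃ σ : MulAut (FreeGroup V) → G, (∀ f ∈ P, σ f = s f) ∧
      (∀ f ∈ Gam D, f ∉ P → σ f = (s (red f))⁻¹ * σ (red f * f)) := by
    let F : ∀ x : MulAut (FreeGroup V), (∀ y, nu y < nu x → G) → G := fun f ih =>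
      if h : f ∈ Gam D ∧ f ∉ P then (s (red f))⁻¹ * ih (red f * f) (hred f h.1 h.2).2 else s f
    refine ⟨(measure nu).wf.fix F, ?_, ?_⟩
    · intro f hf
      rw [WellFounded.fix_eq]
      simp only [F]
      rw [dif_neg (fun h => h.2 hf)]
    · intro f h1 h2
      rw [WellFounded.fix_eq]
      simp only [F]
      rw [dif_pos ⟨h1, h2⟩]
  obtain ⟨σ, σP, σr⟩ := hσ
  have Pcase : ∀ f ∈ P, ∀ w ∈ Om D, nu (w * f) ≤ nu f → σ (w * f) = s w * σ f := by
    intro f hf w hw hn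
    have hwf : w * f ∈ P := ⟨isPerm_of_nu (by rw [nu_of_isPerm hf.1] at hn; exact hn), mul_mem (Om_sub hw) hf.2⟩
    rw [σP _ hf, σP _ hwf]
    have := hs [(w * f)⁻¹, w, f] (by intro x hx; simp only [List.mem_cons, List.not_mem_nil, or_false] at hx; rcases hx with rfl | rfl | rfl; exacts [Om_inv (hPΩ _ hwf), hw, hPΩ _ hf]) (by simp) (by simp)
    simp only [List.map_cons, List.map_nil, List.prod_cons, List.prod_nil, mul_one] at this
    rw [sinv _ (hPΩ _ hwf)] at this
    exact (inv_mul_eq_one.1 this)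
  have Ppath : ∀ f ∈ Gam D, f ∉ P → ∀ w ∈ Om D, nu (w * f) ≤ nu f →
      (∀ a v, v ∈ Om D → a ∈ Gam D → nu a < nu f → (nu (v * a) < nu f ∨ v * a = w * f) → σ (v * a) = s v * σ a) →
      σ (w * f) = s w * σ f := by
    intro f hf hfP w hw hn hE
    obtain ⟨r1, r2⟩ := hred f hf hfP
    obtain ⟨l, h1, h2, h3, h4, h5⟩ := path_list 6 r2 (mul_mem (Om_sub r1) hf) hE (h2_main r1 hw r2 hn)
    have := hs (w⁻¹ :: (l ++ [red f])) (by
      intro x hx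
      simp only [List.mem_cons, List.mem_append, List.not_mem_nil, or_false] at hx
      rcases hx with rfl | h | rfl
      · exact Om_inv hw
      · exact h2 _ h
      · exact r1) (by simp; omega) (by
      rw [← mul_assoc] at h3
      have := mul_right_cancel h3
      simp [← this])
    simp only [List.map_cons, List.map_append, List.map_nil, List.prod_cons, List.prod_append, List.prod_nil, mul_one] at this
    rw [sinv w hw, inv_mul_eq_one] at this
    rw [h5, σr f hf hfP, this]
    group
  have main : ∀ h f w, f ∈ Gam D → w ∈ Om D → nu f ≤ h → nu (w * f) ≤ h → σ (w * f) = s w * σ f := by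
    intro h
    induction h using Nat.strong_induction_on with
    | _ h ih =>
    have both : ∀ a v, v ∈ Om D → a ∈ Gam D → nu a < h → nu (v * a) < h → σ (v * a) = s v * σ a := by
      intro a v hv ha h1 h2
      exact ih (max (nu a) (nu (v * a))) (max_lt h1 h2) a v ha hv (le_max_left _ _) (le_max_right _ _)
    have strict : ∀ f ∈ Gam D, ∀ w ∈ Om D, nu f = h → nu (w * f) < h → σ (w * f) = s w * σ f := by
      intro f hf w hw h1 h2
      by_cases hP : f ∈ P
      · exact Pcase f hP w hw (by omega)
      · refine Ppath f hf hP w hw (by omega) ?_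
        intro a v hv ha h3 h4
        refine both a v hv ha (by omega) ?_
        rcases h4 with h4 | h4
        · omega
        · rw [h4]; exact h2
    have strict' : ∀ f ∈ Gam D, ∀ w ∈ Om D, nu f < h → nu (w * f) = h → σ (w * f) = s w * σ f := by
      intro f hf w hw h1 h2
      have := strict (w * f) (mul_mem (Om_sub hw) hf) w⁻¹ (Om_inv hw) h2 (by simpa using h1)
      rw [inv_mul_cancel_left, sinv w hw] at this
      rw [this]; group
    intro f w hf hw h1 h2
    rcases lt_or_eq_of_le h1 with h1 | h1 <;> rcases lt_or_eq_of_le h2 with h2 | h2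
    · exact both f w hw hf h1 h2
    · exact strict' f hf w hw h1 h2
    · exact strict f hf w hw h1 h2
    · by_cases hP : f ∈ P
      · exact Pcase f hP w hw (by omega)
      · refine Ppath f hf hP w hw (by omega) ?_
        intro a v hv ha h3 h4
        rcases h4 with h4 | h4
        · exact both a v hv ha (by omega) (by omega)
        · exact strict' a ha v hv (by omega) (by rw [h4]; exact h2)
  have key : ∀ f w, f ∈ Gam D → w ∈ Om D → σ (w * f) = s w * σ f := fun f w hf hw =>
    main (max (nu f) (nu (w * f))) f w hf hw (le_max_left _ _) (le_max_right _ _)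
  have σ1 : σ 1 = 1 := by rw [σP 1 one_P, s1]
  have σw : ∀ w ∈ Om D, σ w = s w := by
    intro w hw
    have := key 1 w (one_mem _) hw
    rwa [mul_one, σ1, mul_one] at this
  have hom : ∀ n g f, nu g ≤ n → g ∈ Gam D → f ∈ Gam D → σ (g * f) = σ g * σ f := by
    intro n
    induction n with
    | zero =>
      intro g f hn hg hf
      by_cases hP : g ∈ P
      · rw [key f g hf (hPΩ g hP), σP g hP]
      · have := (hred g hg hP).2; omega
    | succ n ih =>
      intro g f hn hg hf
      by_cases hP : g ∈ P
      · rw [key f g hf (hPΩ g hP), σP g hP]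
      · obtain ⟨r1, r2⟩ := hred g hg hP
        have e := ih (red g * g) f (by omega) (mul_mem (Om_sub r1) hg) hf
        rw [mul_assoc, key (g * f) _ (mul_mem hg hf) r1, key g _ hg r1, mul_assoc] at e
        exact mul_left_cancel e
  refine ⟨MonoidHom.mk' (fun g => σ g) (fun g f => hom _ g f le_rfl g.2 f.2), ?_⟩
  intro w hΓ hw
  exact σw w hw

theorem closure_Om (D : Set V) : Subgroup.closure (Om D) = Gam D := by
  apply le_antisymm
  · rw [Subgroup.closure_le]; exact fun w hw => Om_sub hw
  · have : ∀ n f, nu f ≤ n → f ∈ Gam D → f ∈ Subgroup.closure (Om D) := by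
      intro n
      induction n with
      | zero =>
        intro f hn hf
        by_cases hP : IsPerm f
        · exact Subgroup.subset_closure (Or.inr ⟨hP, hf⟩)
        · obtain ⟨w, _, h⟩ := exists_reduce hf hP; omega
      | succ n ih =>
        intro f hn hf
        by_cases hP : IsPerm f
        · exact Subgroup.subset_closure (Or.inr ⟨hP, hf⟩)
        · obtain ⟨w, hw, h⟩ := exists_reduce hf hP
          have := ih (w * f) (by omega) (mul_mem (Om_sub hw) hf)
          have h2 := mul_mem (inv_mem (Subgroup.subset_closure hw)) this
          rwa [inv_mul_cancel_left] at h2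
    exact fun f hf => this _ f le_rfl hf

end morse
end BirmanAux

namespace BirmanAux
open FreeGroup (of)

section split
variable {V : Type}

/-- The smallest `D`-balanced set containing `x`. -/
def pcs (D : Set V) (x : Lt V) : Set (Lt V) := {y | y = x ∨ (y = linv x ∧ x.1 ∈ D)}

lemma pcs_fst {D : Set V} {x y : Lt V} (h : y ∈ pcs D x) : y.1 = x.1 := by
  rcases h with rfl | ⟨rfl, _⟩
  · rfl
  · simp

lemma mem_pcs_self (D : Set V) (x : Lt V) : x ∈ pcs D x := Or.inl rfl

lemma pcs_bal {D : Set V} {x y : Lt V} (h : y.1 ∈ D) : y ∈ pcs D x ↔ linv y ∈ pcs D x := by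
  have key : ∀ y : Lt V, y.1 ∈ D → y ∈ pcs D x → linv y ∈ pcs D x := by
    rintro y hy (rfl | ⟨rfl, h'⟩)
    · exact Or.inr ⟨rfl, hy⟩
    · left; simp
  refine ⟨key y h, fun h' => ?_⟩
  have := key (linv y) h h'
  rwa [linv_linv] at this

/-- The generating set of the kernel. -/
def SS (D Y : Set V) : Set (MulAut (FreeGroup V)) :=
  {w | ∃ x d : Lt V, x.1 ≠ d.1 ∧ (d.1 ∈ Y ∨ x.1 ∈ Y) ∧ w = Wh (insert d (pcs D x)) d}

lemma atom_adm (D : Set V) {x d : Lt V} (h : x.1 ≠ d.1) : Adm D (insert d (pcs D x)) d := by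
  refine ⟨by simp, ?_, ?_⟩
  · rintro (h' | h')
    · exact linv_ne d h'
    · exact h (pcs_fst h').symm
  · intro y hy hyd
    have h1 : y ≠ d := fun h' => hyd (by rw [h'])
    have h2 : linv y ≠ d := fun h' => hyd (by rw [← h']; rfl)
    simp only [Set.mem_insert_iff, h1, h2, false_or]
    exact pcs_bal hy

lemma SS_sub_Om {D Y : Set V} : SS D Y ⊆ Om D := by
  rintro w ⟨x, d, h, _, rfl⟩
  exact Om_Wh (atom_adm D h)

lemma Wh_single {A : Set (Lt V)} {a : Lt V} (h : ∀ x ∈ A, x.1 = a.1) : Wh A a = 1 := by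
  apply aut_ext_elt
  intro v
  refine ⟨true, ?_⟩
  have : ∀ x, pre A a x = 1 := by
    intro x
    by_cases hx : x ∈ A
    · exact pre_own (h x hx)
    · exact pre_out hx
  rw [Wh_elt, this, this]; simp

lemma fac_mem [Finite V] {D Y : Set V} (hYD : Y ⊆ D) {b : Lt V} (n : ℕ) :
    ∀ {B : Set (Lt V)}, B.ncard ≤ n → Adm D B b → (b.1 ∈ Y ∨ ∀ x ∈ B, x ≠ b → x.1 ∈ Y) →
    Wh B b ∈ Subgroup.closure (SS D Y) := by
  induction n with
  | zero =>
    intro B hn hB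
    have := (Set.ncard_eq_zero (Set.toFinite B)).1 (by omega)
    have := hB.mem
    simp_all
  | succ n ih =>
    intro B hn hB hY
    by_cases h : ∀ x ∈ B, x = b
    · rw [Wh_single (fun x hx => by rw [h x hx])]; exact one_mem _
    · push Not at h
      obtain ⟨x, hx, hxb⟩ := h
      have hx1 : x.1 ≠ b.1 := by
        intro h'
        rcases fst_eq_iff.1 h' with h' | h'
        · exact hxb h'
        · rw [h'] at hx; exact hB.nmem hx
      have hsub : ∀ y ∈ pcs D x, y ∈ B := by
        rintro y (rfl | ⟨rfl, hD⟩)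
        · exact hx
        · exact (hB.bal x hD hx1).1 hx
      have e : Wh (insert b (pcs D x)) b * Wh (B \ pcs D x) b = Wh B b := by
        rw [Wh_union]
        · apply Wh_congr
          intro y hy
          have : y ≠ b := fun h' => hy (by rw [h'])
          have := hsub y
          simp only [Set.mem_union, Set.mem_insert_iff, Set.mem_sdiff]
          tauto
        · rintro y (rfl | h1) h2
          · rfl
          · exact absurd h1 h2.2
      rw [← e]
      refine mul_mem (Subgroup.subset_closure ⟨x, b, hx1, ?_, rfl⟩) (ih ?_ ⟨⟨hB.mem, ?_⟩, ?_, ?_⟩ ?_)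
      · exact hY.imp_right (fun h => h x hx hxb)
      · have : (B \ pcs D x).ncard < B.ncard :=
          Set.ncard_lt_ncard ⟨Set.diff_subset, fun h => (h hx).2 (mem_pcs_self D x)⟩ (Set.toFinite B)
        omega
      · intro h'; exact hx1 (pcs_fst h').symm
      · exact fun h' => hB.nmem h'.1
      · intro y hy hyb
        rw [Set.mem_sdiff, Set.mem_sdiff, hB.bal y hy hyb, pcs_bal hy]
      · exact hY.imp_right (fun h x hx => h x hx.1)

lemma fac_mem' [Finite V] {D Y : Set V} (hYD : Y ⊆ D) {b : Lt V} {B : Set (Lt V)} (h : Adm D B b)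
    (h' : b.1 ∈ Y ∨ ∀ x ∈ B, x ≠ b → x.1 ∈ Y) : Wh B b ∈ Subgroup.closure (SS D Y) :=
  fac_mem hYD _ le_rfl h h'

open Classical in
/-- The retraction killing `Y`. -/
noncomputable def qY (Y : Set V) : FreeGroup V →* FreeGroup V :=
  FreeGroup.lift (fun v => if v ∈ Y then 1 else of v)

lemma qY_elt_mem {Y : Set V} {x : Lt V} (h : x.1 ∈ Y) : qY Y (elt x) = 1 := by
  obtain ⟨v, b⟩ := x
  cases b
  · simp only [elt_false, qY, map_inv, FreeGroup.lift_apply_of]; rw [if_pos h]; simp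
  · simp only [elt_true, qY, FreeGroup.lift_apply_of]; rw [if_pos h]

lemma qY_elt_notMem {Y : Set V} {x : Lt V} (h : x.1 ∉ Y) : qY Y (elt x) = elt x := by
  obtain ⟨v, b⟩ := x
  cases b
  · simp only [elt_false, qY, map_inv, FreeGroup.lift_apply_of]; rw [if_neg h]
  · simp only [elt_true, qY, FreeGroup.lift_apply_of]; rw [if_neg h]

lemma qY_fix {Y : Set V} {f : FreeGroup V →* FreeGroup V} (h : ∀ v ∉ Y, f (of v) = of v) (w) :
    f (qY Y w) = qY Y w := by
  have : f.comp (qY Y) = qY Y := by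
    apply hom_ext_elt
    intro v
    refine ⟨true, ?_⟩
    by_cases hv : v ∈ Y
    · simp [qY_elt_mem (x := (v, true)) hv]
    · rw [MonoidHom.comp_apply, qY_elt_notMem (x := (v, true)) hv, elt_true, h v hv]
  exact DFunLike.congr_fun this w

lemma qY_qY (Y : Set V) (w) : qY Y (qY Y w) = qY Y w :=
  qY_fix (f := qY Y) (fun v hv => qY_elt_notMem (x := (v, true)) hv) w

/-- Automorphisms fixing `Y` and commuting with the retraction. -/
def HY (Y : Set V) : Subgroup (MulAut (FreeGroup V)) where
  carrier := {t | (∀ y ∈ Y, t (of y) = of y) ∧ ∀ w, qY Y (t w) = t (qY Y w)}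
  one_mem' := ⟨fun _ _ => rfl, fun _ => rfl⟩
  mul_mem' := by
    rintro a b ⟨h1, h2⟩ ⟨h3, h4⟩
    refine ⟨fun y hy => ?_, fun w => ?_⟩
    · rw [MulAut.mul_apply, h3 y hy, h1 y hy]
    · rw [MulAut.mul_apply, h2, h4, MulAut.mul_apply]
  inv_mem' := by
    rintro a ⟨h1, h2⟩
    refine ⟨fun y hy => ?_, fun w => ?_⟩
    · apply a.injective
      rw [MulAut.apply_inv_self, h1 y hy]
    · apply a.injective
      rw [MulAut.apply_inv_self, ← h2, MulAut.apply_inv_self]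

def fixQ (Y : Set V) : Subgroup (MulAut (FreeGroup V)) where
  carrier := {f | ∀ w, qY Y (f w) = qY Y w}
  one_mem' := fun _ => rfl
  mul_mem' := by
    intro f g hf hg w
    rw [MulAut.mul_apply]
    exact (hf (g w)).trans (hg w)
  inv_mem' := by
    intro f hf w
    have h := hf (f⁻¹ w)
    rw [MulAut.apply_inv_self] at h
    exact h.symm

lemma HY_fixQ {Y : Set V} {t : MulAut (FreeGroup V)} (h1 : t ∈ HY Y) (h2 : t ∈ fixQ Y) : t = 1 := by
  apply aut_ext_elt
  intro v
  refine ⟨true, ?_⟩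
  by_cases hv : v ∈ Y
  · exact h1.1 v hv
  · have := h1.2 (of v)
    rw [h2, show qY Y (of v) = of v from qY_elt_notMem (x := (v, true)) hv] at this
    exact this.symm

lemma fixQ_of {Y : Set V} {f : MulAut (FreeGroup V)} (h : ∀ v, qY Y (f (elt (v, true))) = qY Y (elt (v, true))) :
    f ∈ fixQ Y := by
  have : (qY Y).comp f.toMonoidHom = qY Y := hom_ext_elt (fun v => ⟨true, h v⟩)
  exact fun w => DFunLike.congr_fun this w

lemma closure_SS_fixQ {D Y : Set V} (hYD : Y ⊆ D) : Subgroup.closure (SS D Y) ≤ fixQ Y := by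
  rw [Subgroup.closure_le]
  rintro w ⟨x, d, hxd, hY, rfl⟩
  apply fixQ_of
  intro v
  rw [Wh_elt, map_mul, map_mul, map_inv]
  rcases hY with hY | hY
  · have : ∀ z, qY Y (pre (insert d (pcs D x)) d z) = 1 := by
      intro z
      rw [pre_def]
      split_ifs
      · exact qY_elt_mem hY
      · simp
    rw [this, this]; simp
  · by_cases hv : v = x.1
    · rw [qY_elt_mem (x := (v, true)) (by rw [hv]; exact hY)]
      have h1 : ∀ b, (v, b) ∈ pcs D x := by
        intro b
        rcases fst_eq_iff.1 (show ((v, b) : Lt V).1 = x.1 from hv) with h | h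
        · exact Or.inl h
        · exact Or.inr ⟨h, hYD hY⟩
      rw [pre_in (Or.inr (h1 _)) (by rw [hv]; exact hxd), show linv ((v, true) : Lt V) = (v, false) from rfl,
        pre_in (Or.inr (h1 _)) (by rw [hv]; exact hxd)]
      simp
    · have : ∀ b, pre (insert d (pcs D x)) d (v, b) = 1 := by
        intro b
        by_cases hd : v = d.1
        · exact pre_own hd
        · apply pre_out
          rintro (h | h)
          · exact hd (by rw [← h])
          · exact hv (pcs_fst h)
      rw [this, show linv ((v, true) : Lt V) = (v, false) from rfl, this]; simp

lemma HY_of {Y : Set V} {t : MulAut (FreeGroup V)} (h1 : ∀ y ∈ Y, t (of y) = of y)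
    (h2 : ∀ v ∉ Y, qY Y (t (elt (v, true))) = t (elt (v, true))) : t ∈ HY Y := by
  refine ⟨h1, ?_⟩
  have : (qY Y).comp t.toMonoidHom = t.toMonoidHom.comp (qY Y) := by
    apply hom_ext_elt
    intro v
    refine ⟨true, ?_⟩
    by_cases hv : v ∈ Y
    · have := h1 v hv
      have e : qY Y (of v) = 1 := qY_elt_mem (x := (v, true)) hv
      simp [elt_true, this, e]
    · have := h2 v hv
      simp [qY_elt_notMem (x := (v, true)) hv, this]
  exact fun w => DFunLike.congr_fun this w

lemma HY_Wh {Y : Set V} {A : Set (Lt V)} {a : Lt V} (ha : a.1 ∉ Y) (hA : ∀ x ∈ A, x.1 ∉ Y) :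
    Wh A a ∈ HY Y := by
  apply HY_of
  · intro y hy
    rw [← elt_true, Wh_elt, pre_out (fun h => hA _ h hy), pre_out (fun h => hA _ h hy)]; simp
  · intro v hv
    have : ∀ x, qY Y (pre A a x) = pre A a x := by
      intro x
      rw [pre_def]
      split_ifs
      · exact qY_elt_notMem ha
      · simp
    rw [Wh_elt, map_mul, map_mul, map_inv, this, this, qY_elt_notMem (x := (v, true)) hv]

lemma HY_perm {D Y : Set V} (hYD : Y ⊆ D) {p : MulAut (FreeGroup V)} (hp : IsPerm p) (hp' : p ∈ Gam D) :
    p ∈ HY Y := by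
  obtain ⟨π, h1, h2⟩ := hp
  apply HY_of
  · intro y hy
    rw [← elt_true, h2, perm_fix hp' h1 h2 (hYD hy)]
  · intro v hv
    rw [h2]
    apply qY_elt_notMem
    intro h
    have := perm_fix hp' h1 h2 (hYD h)
    have := π.injective this
    rw [this] at h
    exact hv h

end split
end BirmanAux

namespace BirmanAux
open FreeGroup (of)

section norm
variable {V : Type}

open Classical in
lemma atom_Y {D Y : Set V} (hYD : Y ⊆ D) {x d : Lt V} (hY : x.1 ∈ Y) (hxd : x.1 ≠ d.1) (y : Lt V) :
    Wh (insert d (pcs D x)) d (elt y) = if y.1 = x.1 then elt d * elt y * (elt d)⁻¹ else elt y := by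
  have key : ∀ y : Lt V, pre (insert d (pcs D x)) d y = if y.1 = x.1 then elt d else 1 := by
    intro y
    split_ifs with h
    · apply pre_in
      · right
        rcases fst_eq_iff.1 h with h | h
        · exact Or.inl h
        · exact Or.inr ⟨h, hYD hY⟩
      · rw [h]; exact hxd
    · by_cases hd : y.1 = d.1
      · exact pre_own hd
      · apply pre_out
        rintro (h' | h')
        · exact hd (by rw [← h'])
        · exact h (pcs_fst h')
  rw [Wh_elt, key, key, linv_fst]
  split_ifs <;> simp

lemma conj_mem {D Y : Set V} (hYD : Y ⊆ D) {y : V} (hy : y ∈ Y) (w : FreeGroup V) :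
    ∃ c ∈ Subgroup.closure (SS D Y), c (of y) = qY Y w * of y * (qY Y w)⁻¹ ∧ ∀ v, v ≠ y → c (of v) = of v := by
  have fixc : ∀ c : MulAut (FreeGroup V), (∀ v, v ≠ y → c (of v) = of v) → ∀ w, c (qY Y w) = qY Y w := by
    intro c hc w
    exact qY_fix (f := c.toMonoidHom) (fun v hv => hc v (fun h => hv (by rw [h]; exact hy))) w
  induction w using elt_induction with
  | h1 => exact ⟨1, one_mem _, by simp, by simp⟩
  | hm x g ih =>
    obtain ⟨c, hc, h1, h2⟩ := ih
    by_cases hx : x.1 ∈ Y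
    · refine ⟨c, hc, ?_, h2⟩
      rw [map_mul, qY_elt_mem hx, one_mul, h1]
    · have hyx : y ≠ x.1 := fun h => hx (by rw [← h]; exact hy)
      have h3 : ∀ v, v ≠ y → Wh (insert x (pcs D (y, true))) x (of v) = of v := by
        intro v hv
        rw [← elt_true, atom_Y hYD hy hyx, if_neg hv]
      refine ⟨c * Wh (insert x (pcs D (y, true))) x, mul_mem hc (Subgroup.subset_closure ⟨(y, true), x, hyx, Or.inr hy, rfl⟩), ?_, ?_⟩
      · rw [MulAut.mul_apply, ← elt_true, atom_Y hYD hy hyx, if_pos rfl, map_mul, map_mul, map_inv, elt_true, h1,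
          map_mul, qY_elt_notMem hx]
        have : c (elt x) = elt x := by
          have := fixc c h2 (elt x)
          rwa [qY_elt_notMem hx] at this
        rw [this]
        group
      · intro v hv
        rw [MulAut.mul_apply, h3 v hv, h2 v hv]

/-- Conjugation-type generators are normalized by `HY`. -/
lemma norm_conj {D Y : Set V} (hYD : Y ⊆ D) {x d : Lt V} (hx : x.1 ∈ Y) (hd : d.1 ∉ Y)
    {t : MulAut (FreeGroup V)} (ht : t ∈ HY Y) :
    t * Wh (insert d (pcs D x)) d * t⁻¹ ∈ Subgroup.closure (SS D Y) := by
  have hxd : x.1 ≠ d.1 := fun h => hd (by rw [← h]; exact hx)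
  obtain ⟨c, hc, h1, h2⟩ := conj_mem hYD hx (t (elt d))
  rw [ht.2, qY_elt_notMem hd] at h1
  have ht' := inv_mem ht
  have : t * Wh (insert d (pcs D x)) d * t⁻¹ = c := by
    apply aut_ext_elt
    intro v
    refine ⟨true, ?_⟩
    rw [elt_true, MulAut.mul_apply, MulAut.mul_apply]
    by_cases hv : v = x.1
    · rw [hv, h1, ht'.1 _ hx, ← elt_true, atom_Y hYD hx hxd, if_pos rfl, map_mul, map_mul, map_inv, elt_true,
        ht.1 _ hx]
    · rw [h2 v hv]
      by_cases hvY : v ∈ Y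
      · rw [ht'.1 _ hvY, ← elt_true, atom_Y hYD hx hxd, if_neg hv, elt_true, ht.1 _ hvY]
      · have e : t⁻¹ (of v) = qY Y (t⁻¹ (of v)) := by
          rw [ht'.2, show qY Y (of v) = of v from qY_elt_notMem (x := (v, true)) hvY]
        rw [e, show Wh (insert d (pcs D x)) d (qY Y (t⁻¹ (of v))) = qY Y (t⁻¹ (of v)) from
          qY_fix (f := (Wh (insert d (pcs D x)) d).toMonoidHom) (fun u hu => ?_) _, ← e, MulAut.apply_inv_self]
        change Wh (insert d (pcs D x)) d (of u) = of u
        rw [← elt_true, atom_Y hYD hx hxd, if_neg]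
        intro h
        exact hu (by rw [show u = x.1 from h]; exact hx)
  rw [this]; exact hc

lemma norm_perm [Finite V] {D Y : Set V} (hYD : Y ⊆ D) {d x : Lt V} (hd : d.1 ∈ Y) (hxd : x.1 ≠ d.1)
    {p : MulAut (FreeGroup V)} (hp : IsPerm p) (hp' : p ∈ Gam D) :
    p * Wh (insert d (pcs D x)) d * p⁻¹ ∈ Subgroup.closure (SS D Y) := by
  obtain ⟨π, h1, h2⟩ := hp
  rw [perm_conj h1 h2, mul_inv_cancel_right]
  have := (atom_adm D hxd).perm hp' h1 h2
  rw [perm_fix hp' h1 h2 (hYD hd)] at this ⊢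
  exact fac_mem' hYD this (Or.inl hd)

lemma mul_conj_of {G : Type*} [Group G] {W s r : G} (h : W * s = r * W) : W * s * W⁻¹ = r := by
  rw [h, mul_inv_cancel_right]

/-- Multiplication-type generators. -/
lemma norm_mult [Finite V] {D Y : Set V} (hYD : Y ⊆ D) {d x : Lt V} (hd : d.1 ∈ Y) (hxd : x.1 ≠ d.1)
    {A : Set (Lt V)} {a : Lt V} (hA : Adm D A a) (ha : a.1 ∉ Y) (hAY : ∀ z ∈ A, z.1 ∉ Y) :
    Wh A a * Wh (insert d (pcs D x)) d * (Wh A a)⁻¹ ∈ Subgroup.closure (SS D Y) := by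
  have hda : d.1 ≠ a.1 := fun h => ha (by rw [← h]; exact hd)
  have hdA : d ∉ A := fun h => hAY _ h hd
  have hdA' : linv d ∉ A := fun h => hAY _ h hd
  set c := Wh (insert a (pcs D d)) a with hc
  have hcS : c ∈ Subgroup.closure (SS D Y) := Subgroup.subset_closure ⟨d, a, hda, Or.inr hd, rfl⟩
  have hpd : ∀ z, z ∈ pcs D d ↔ z = d ∨ z = linv d := by
    intro z
    simp [pcs, hYD hd]
  -- the enlarged set
  have hW : c * Wh A a = Wh (A ∪ pcs D d) a := by
    rw [hc, Wh_union]
    · apply Wh_congr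
      intro z hz
      have : z ≠ a := fun h => hz (by rw [h])
      simp only [Set.mem_union, Set.mem_insert_iff, this, false_or]
      tauto
    · rintro z (rfl | h) h'
      · rfl
      · exact absurd (by rw [pcs_fst h]; exact hd) (hAY z h')
  have ht : Wh A a = c⁻¹ * Wh (A ∪ pcs D d) a := by rw [← hW]; group
  have hconj : ∀ s, Wh (A ∪ pcs D d) a * s * (Wh (A ∪ pcs D d) a)⁻¹ ∈ Subgroup.closure (SS D Y) →
      Wh A a * s * (Wh A a)⁻¹ ∈ Subgroup.closure (SS D Y) := by
    intro s hs
    have : Wh A a * s * (Wh A a)⁻¹ = c⁻¹ * (Wh (A ∪ pcs D d) a * s * (Wh (A ∪ pcs D d) a)⁻¹) * c := by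
      rw [ht]; group
    rw [this]
    exact mul_mem (mul_mem (inv_mem hcS) hs) hcS
  have linva : linv a ∉ A ∪ pcs D d := by
    rintro (h | h)
    · exact hA.nmem h
    · exact hda (pcs_fst h).symm
  -- the two basic conjugation formulas
  have F1 : Wh A a * Wh {linv a, d} d * (Wh A a)⁻¹ = Wh (({linv a, d} ∪ A) \ {a}) d := by
    have := Wh_D2 (A := A) (B := {linv a, d}) (a := a) (b := d) hda.symm hA.mem (by simp)
      (by
        rintro z hz (h | h)
        · rw [h] at hz; exact hA.nmem hz
        · rw [h] at hz; exact hdA hz) (by simp) hdA'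
    exact mul_conj_of this.symm
  have F2 : Wh (A ∪ pcs D d) a * Wh {a, d} d * (Wh (A ∪ pcs D d) a)⁻¹ =
      Wh (insert (linv a) ((A ∪ pcs D d) \ {a, d})) (linv d) := by
    refine mul_conj_of (Wh_N2 (A := {a, d}) (B := A ∪ pcs D d) (a := d) (b := a) hda (by simp) ?_ ?_ ?_ (by simp) linva)
    · rintro (h | h)
      · exact hda (by rw [← h]; rfl)
      · exact linv_ne d h
    · rintro z (rfl | h)
      · exact Or.inl hA.mem
      · rw [h]; exact Or.inr (mem_pcs_self D d)
    · exact Or.inr ((hpd _).2 (Or.inr rfl))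
  by_cases hxa : x.1 = a.1
  · have hdx : ∀ z : Lt V, z.1 ∈ D → z.1 ≠ a.1 → z.1 ≠ d.1 → (z ∈ A ↔ linv z ∈ A) := fun z h1 h2 _ => hA.bal z h1 h2
    by_cases haD : a.1 ∈ D
    · -- z and its inverse equal a and its inverse
      have hs : Wh (insert d (pcs D x)) d = Wh {a, d} d * Wh {linv a, d} d := by
        rw [Wh_union]
        · apply Wh_congr
          intro z hz
          have hzd : z ≠ d := fun h => hz (by rw [h])
          have h1 : z ∈ pcs D x ↔ z = a ∨ z = linv a := by
            rw [← fst_eq_iff, ← hxa]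
            refine ⟨pcs_fst, fun h => ?_⟩
            rcases fst_eq_iff.1 h with h | h
            · exact Or.inl h
            · exact Or.inr ⟨h, by rw [hxa]; exact haD⟩
          simp only [Set.mem_insert_iff, Set.mem_union, Set.mem_singleton_iff, h1, hzd]
          tauto
        · rintro z (rfl | h) (h' | h')
          · exact absurd h' (ne_linv z)
          · rw [h']
          · rw [h]
          · rw [h']
      set E := A \ {a} with hE
      set L := Wh (insert d (pcs D x)) d with hL
      set m := Wh {linv a, d} d with hm
      set X1 := Wh (insert d E) d with hX1
      set X2 := Wh (insert (linv d) E) (linv d) with hX2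
      have hEa : ∀ z ∈ E, z.1 ≠ a.1 := by
        intro z hz h
        rcases fst_eq_iff.1 h with h | h
        · exact hz.2 h
        · rw [h] at hz; exact hA.nmem hz.1
      have hEb : ∀ z : Lt V, z.1 ∈ D → (z ∈ E ↔ linv z ∈ E) := by
        intro z hz
        by_cases hza : z.1 = a.1
        · exact ⟨fun h => absurd hza (hEa z h), fun h => absurd (by rw [linv_fst]; exact hza) (hEa _ h)⟩
        · have := hA.bal z hz hza
          have h1 : z ≠ a := fun h => hza (by rw [h])
          have h2 : linv z ≠ a := fun h => hza (by rw [← h]; rfl)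
          simp [hE, this, h1, h2]
      have hX : ∀ e : Lt V, e.1 = d.1 → Wh (insert e E) e ∈ Subgroup.closure (SS D Y) := by
        intro e he
        refine fac_mem' hYD ⟨by simp, ?_, ?_⟩ (Or.inl (by rw [he]; exact hd))
        · rintro (h | h)
          · exact linv_ne e h
          · exact hAY _ h.1 (by rw [linv_fst, he]; exact hd)
        · intro z hz hze
          have h1 : z ≠ e := fun h => hze (by rw [h])
          have h2 : linv z ≠ e := fun h => hze (by rw [← h]; rfl)
          simp only [Set.mem_insert_iff, h1, h2, false_or]
          exact hEb z hz
      have e1 : Wh (({linv a, d} ∪ A) \ {a}) d = X1 * m := by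
        rw [hX1, hm, Wh_union]
        · apply Wh_congr
          intro z hz
          have hzd : z ≠ d := fun h => hz (by rw [h])
          have : linv a ≠ a := linv_ne a
          simp only [Set.mem_insert_iff, Set.mem_union, Set.mem_singleton_iff, hzd, hE, Set.mem_sdiff]
          constructor
          · tauto
          · rintro ((h | ⟨h1, h2⟩) | h | h)
            · exact h.elim
            · exact ⟨Or.inr h1, h2⟩
            · rw [h]; exact ⟨Or.inl (Or.inl rfl), this⟩
            · exact h.elim
        · rintro z (rfl | h) (h' | h')
          · rfl
          · rfl
          · exact absurd (by rw [h']; rfl) (hEa z h)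
          · rw [h']
      have e2 : Wh (insert (linv a) ((A ∪ pcs D d) \ {a, d})) (linv d) = m⁻¹ * X2 := by
        rw [hX2, hm, Wh_inv, Wh_union]
        · apply Wh_congr
          intro z hz
          have hzd : z ≠ d := fun h => hz (by rw [h]; rfl)
          have hzd' : z ≠ linv d := fun h => hz (by rw [h])
          simp only [Set.mem_insert_iff, Set.mem_union, Set.mem_singleton_iff, hzd, hzd', hE, Set.mem_sdiff, hpd]
          tauto
        · rintro z (h | h) (h' | h')
          · rw [h']
          · exact absurd (by rw [h]; rfl) (hEa z h')
          · rw [h']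
          · rw [h]; rfl
      have e3 : m * X1 = X1 * m := by
        have h : ∀ z ∈ ({linv a, d} : Set (Lt V)), z ∈ insert d E → z.1 = d.1 := by
          rintro z (h | h) (h' | h')
          · rw [h']
          · exact absurd (by rw [h]; rfl) (hEa z h')
          · rw [h']
          · rw [h]
        rw [hm, hX1, Wh_union h, Wh_union (fun z h1 h2 => h z h2 h1), Set.union_comm]
      have e5 : X2 = X1⁻¹ := by
        rw [hX2, hX1, Wh_inv]
        apply Wh_congr
        intro z hz
        have hzd : z ≠ d := fun h => hz (by rw [h]; rfl)
        have hzd' : z ≠ linv d := fun h => hz (by rw [h])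
        simp [hzd, hzd']
      have e4 : c * m = m * (c * L) := by
        have cd : c (elt d) = elt a * elt d * (elt a)⁻¹ := by
          rw [hc, atom_Y hYD hd hda, if_pos rfl]
        have cv : ∀ z : Lt V, z.1 ≠ d.1 → c (elt z) = elt z := by
          intro z hz
          rw [hc, atom_Y hYD hd hda, if_neg hz]
        have md : m (elt d) = elt d := Wh_own _ _ _ rfl
        have Ld : L (elt d) = elt d := Wh_own _ _ _ rfl
        have ma : m (elt a) = elt a * (elt d)⁻¹ := by
          rw [hm, Wh_elt, pre_out, pre_in (x := linv a) (by simp) hda.symm, one_mul]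
          rintro (h | h)
          · exact ne_linv a h
          · exact hda (by rw [show a = d from h])
        have hpx : ∀ z : Lt V, z.1 = a.1 → z ∈ pcs D x := by
          intro z hz
          rw [← hxa] at hz
          rcases fst_eq_iff.1 hz with h | h
          · exact Or.inl h
          · exact Or.inr ⟨h, by rw [hxa]; exact haD⟩
        have La : L (elt a) = elt d * elt a * (elt d)⁻¹ := by
          rw [hL, Wh_elt, pre_in (Or.inr (hpx a rfl)) hda.symm, pre_in (x := linv a) (Or.inr (hpx (linv a) rfl)) hda.symm]
        have mv : ∀ z : Lt V, z.1 ≠ d.1 → z.1 ≠ a.1 → m (elt z) = elt z := by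
          have : ∀ z : Lt V, z.1 ≠ d.1 → z.1 ≠ a.1 → pre {linv a, d} d z = 1 := by
            intro z h1 h2
            apply pre_out
            rintro (h | h)
            · exact h2 (by rw [h]; rfl)
            · exact h1 (by rw [show z = d from h])
          intro z h1 h2
          rw [hm, Wh_elt, this z h1 h2, this (linv z) h1 h2]; simp
        have Lv : ∀ z : Lt V, z.1 ≠ d.1 → z.1 ≠ a.1 → L (elt z) = elt z := by
          have : ∀ z : Lt V, z.1 ≠ d.1 → z.1 ≠ a.1 → pre (insert d (pcs D x)) d z = 1 := by
            intro z h1 h2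
            apply pre_out
            rintro (h | h)
            · exact h1 (by rw [h])
            · exact h2 (by rw [pcs_fst h, hxa])
          intro z h1 h2
          rw [hL, Wh_elt, this z h1 h2, this (linv z) h1 h2]; simp
        have ca := cv a hda.symm
        apply aut_ext_elt
        intro v
        by_cases hva : v = a.1
        · refine ⟨a.2, ?_⟩
          rw [hva]
          change (c * m) (elt a) = (m * (c * L)) (elt a)
          simp only [MulAut.mul_apply, map_mul, map_inv, cd, ca, md, ma, La, Ld]
          group
        · by_cases hvd : v = d.1
          · refine ⟨d.2, ?_⟩
            rw [hvd]
            change (c * m) (elt d) = (m * (c * L)) (elt d)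
            simp only [MulAut.mul_apply, map_mul, map_inv, cd, ca, md, ma, La, Ld]
            group
          · refine ⟨true, ?_⟩
            simp only [MulAut.mul_apply]
            rw [mv (v, true) hvd hva, Lv (v, true) hvd hva, cv (v, true) hvd, mv (v, true) hvd hva]
      have : Wh A a * L * (Wh A a)⁻¹ = c⁻¹ * X2 * c * L * X1 := by
        have h1 : Wh A a * L * (Wh A a)⁻¹ = c⁻¹ * (Wh (A ∪ pcs D d) a * Wh {a, d} d * (Wh (A ∪ pcs D d) a)⁻¹) * c *
            (Wh A a * m * (Wh A a)⁻¹) := by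
          rw [hs, ht]; group
        have h2 : m⁻¹ * X1⁻¹ = X1⁻¹ * m⁻¹ := by rw [← mul_inv_rev, ← mul_inv_rev, e3]
        have h3 : c * L = m⁻¹ * (c * m) := by rw [e4]; group
        rw [h1, F2, F1, e1, e2, e5, h2]
        calc _ = c⁻¹ * X1⁻¹ * m⁻¹ * c * (X1 * m) := by group
          _ = c⁻¹ * X1⁻¹ * (m⁻¹ * (c * m)) * X1 := by rw [← e3]; group
          _ = _ := by rw [← h3]; group
      rw [this]
      have hLS : L ∈ Subgroup.closure (SS D Y) := Subgroup.subset_closure ⟨x, d, hxd, Or.inl hd, rfl⟩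
      exact mul_mem (mul_mem (mul_mem (mul_mem (inv_mem hcS) (hX _ rfl)) hcS) hLS) (hX _ rfl)
    · have hpx : pcs D x = {x} := by
        ext z
        simp [pcs, hxa, haD]
      have hDa : ∀ z : Lt V, z.1 ∈ D → z.1 ≠ a.1 := fun z h h' => haD (by rw [← h']; exact h)
      rw [hpx]
      rcases fst_eq_iff.1 hxa with rfl | rfl
      · apply hconj
        rw [Set.pair_comm, F2]
        refine fac_mem' hYD ⟨?_, ?_, ?_⟩ (Or.inl hd)
        · right
          refine ⟨Or.inr ((hpd _).2 (Or.inr rfl)), ?_⟩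
          rintro (h | h)
          · exact hda (by rw [← h]; rfl)
          · exact linv_ne d h
        · rw [linv_linv]
          rintro (h | h)
          · exact hda (by rw [h]; rfl)
          · exact h.2 (Or.inr rfl)
        · have key : ∀ z : Lt V, z.1 ∈ D → z.1 ≠ (linv d).1 →
              (z ∈ insert (linv x) ((A ∪ pcs D d) \ {x, d}) ↔ z ∈ A) := by
            intro z h1 h2
            have g1 := hDa z h1
            have g2 : z ≠ linv x := fun h => g1 (by rw [h]; rfl)
            have g3 : z ≠ x := fun h => g1 (by rw [h])
            have g4 : z ≠ d := fun h => h2 (by rw [h]; rfl)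
            have g5 : z ∉ pcs D d := fun h => h2 (by rw [linv_fst]; exact pcs_fst h)
            simp [g2, g3, g4, g5]
          intro z h1 h2
          rw [key z h1 h2, key (linv z) h1 h2]
          exact hA.bal z h1 (hDa z h1)
      · rw [Set.pair_comm, F1]
        refine fac_mem' hYD ⟨?_, ?_, ?_⟩ (Or.inl hd)
        · refine ⟨Or.inl (Or.inr rfl), ?_⟩
          intro h; exact hda (by rw [show d = a from h])
        · rintro ⟨(h | h) | h, _⟩
          · exact hda (by rw [linv_inj.1 h])
          · exact linv_ne d h
          · exact hdA' h
        · have key : ∀ z : Lt V, z.1 ∈ D → z.1 ≠ d.1 →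
              (z ∈ (({linv a, d} : Set (Lt V)) ∪ A) \ {a} ↔ z ∈ A) := by
            intro z h1 h2
            have g1 := hDa z h1
            have g2 : z ≠ linv a := fun h => g1 (by rw [h]; rfl)
            have g3 : z ≠ a := fun h => g1 (by rw [h])
            have g4 : z ≠ d := fun h => h2 (by rw [h])
            simp [g2, g3, g4]
          intro z h1 h2
          rw [key z h1 h2, key (linv z) h1 h2]
          exact hA.bal z h1 (hDa z h1)
  · have hLS : Wh (insert d (pcs D x)) d ∈ Subgroup.closure (SS D Y) :=
      Subgroup.subset_closure ⟨x, d, hxd, Or.inl hd, rfl⟩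
    have hnot : ∀ z : Lt V, z.1 = a.1 → z ∉ insert d (pcs D x) := by
      rintro z hz (h | h)
      · exact hda (by rw [← hz, h])
      · exact hxa (by rw [← hz, pcs_fst h])
    by_cases hxA : x ∈ A
    · apply hconj
      rw [mul_conj_of (Wh_N1 (A := insert d (pcs D x)) (B := A ∪ pcs D d) (a := d) (b := a) hda (by simp) ?_ ?_
        (hnot a rfl) (hnot _ rfl))]
      · exact hLS
      · rintro z (rfl | rfl | ⟨rfl, h⟩)
        · exact Or.inr (mem_pcs_self D z)
        · exact Or.inl hxA
        · exact Or.inl ((hA.bal x h hxa).1 hxA)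
      · exact Or.inr ((hpd _).2 (Or.inr rfl))
    · rw [mul_conj_of (Wh_D1 (A := A) (B := insert d (pcs D x)) (a := a) (b := d) hda.symm hA.mem (by simp) ?_
        (hnot _ rfl) hdA').symm]
      · exact hLS
      · rintro z hz (rfl | rfl | ⟨rfl, h⟩)
        · exact hdA hz
        · exact hxA hz
        · exact hxA ((hA.bal x h hxa).2 hz)

/-- Elements normalizing the group generated by `SS`. -/
lemma norm_all {D Y : Set V} {t : MulAut (FreeGroup V)}
    (h : ∀ s ∈ SS D Y, t * s * t⁻¹ ∈ Subgroup.closure (SS D Y)) :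
    ∀ s ∈ Subgroup.closure (SS D Y), t * s * t⁻¹ ∈ Subgroup.closure (SS D Y) := by
  intro s hs
  induction hs using Subgroup.closure_induction with
  | mem x hx => exact h x hx
  | one => simp
  | mul x y _ _ h1 h2 =>
    have : t * (x * y) * t⁻¹ = (t * x * t⁻¹) * (t * y * t⁻¹) := by group
    rw [this]; exact mul_mem h1 h2
  | inv x _ h1 =>
    have : t * x⁻¹ * t⁻¹ = (t * x * t⁻¹)⁻¹ := by group
    rw [this]; exact inv_mem h1

lemma norm_Wh [Finite V] {D Y : Set V} (hYD : Y ⊆ D) {A : Set (Lt V)} {a : Lt V} (hA : Adm D A a)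
    (ha : a.1 ∉ Y) (hAY : ∀ z ∈ A, z.1 ∉ Y) :
    ∀ s ∈ SS D Y, Wh A a * s * (Wh A a)⁻¹ ∈ Subgroup.closure (SS D Y) := by
  rintro s ⟨x, d, hxd, hY, rfl⟩
  by_cases hd : d.1 ∈ Y
  · exact norm_mult hYD hd hxd hA ha hAY
  · exact norm_conj hYD (hY.resolve_left hd) hd (HY_Wh ha hAY)

lemma norm_perm' [Finite V] {D Y : Set V} (hYD : Y ⊆ D) {p : MulAut (FreeGroup V)} (hp : IsPerm p) (hp' : p ∈ Gam D) :
    ∀ s ∈ SS D Y, p * s * p⁻¹ ∈ Subgroup.closure (SS D Y) := by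
  rintro s ⟨x, d, hxd, hY, rfl⟩
  by_cases hd : d.1 ∈ Y
  · exact norm_perm hYD hd hxd hp hp'
  · exact norm_conj hYD (hY.resolve_left hd) hd (HY_perm hYD hp hp')

lemma split_Om [Finite V] {D Y : Set V} (hYD : Y ⊆ D) {w : MulAut (FreeGroup V)} (hw : w ∈ Om D) :
    ∃ k ∈ Subgroup.closure (SS D Y), ∃ t ∈ HY Y, w = k * t ∧
      ∀ s ∈ SS D Y, t * s * t⁻¹ ∈ Subgroup.closure (SS D Y) := by
  rcases hw with ⟨A, a, hA, rfl⟩ | ⟨h1, h2⟩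
  · by_cases ha : a.1 ∈ Y
    · refine ⟨_, fac_mem' hYD hA (Or.inl ha), 1, one_mem _, (mul_one _).symm, ?_⟩
      intro s hs
      simpa using Subgroup.subset_closure hs
    · have hA2 : Adm D {z | z ∈ A ∧ z.1 ∉ Y} a := by
        refine ⟨⟨hA.mem, ha⟩, fun h => hA.nmem h.1, ?_⟩
        intro z h1 h2
        have := hA.bal z h1 h2
        simp [this]
      have hA1 : Adm D {z | z ∈ A ∧ (z = a ∨ z.1 ∈ Y)} a := by
        refine ⟨⟨hA.mem, Or.inl rfl⟩, fun h => hA.nmem h.1, ?_⟩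
        intro z h1 h2
        have := hA.bal z h1 h2
        have g1 : z ≠ a := fun h => h2 (by rw [h])
        have g2 : linv z ≠ a := fun h => h2 (by rw [← h]; rfl)
        simp [this, g1, g2]
      have hY2 : ∀ z ∈ {z | z ∈ A ∧ z.1 ∉ Y}, z.1 ∉ Y := fun z hz => hz.2
      refine ⟨Wh {z | z ∈ A ∧ (z = a ∨ z.1 ∈ Y)} a, fac_mem' hYD hA1 (Or.inr ?_), Wh {z | z ∈ A ∧ z.1 ∉ Y} a,
        HY_Wh ha hY2, ?_, norm_Wh hYD hA2 ha hY2⟩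
      · intro z hz hza
        exact hz.2.resolve_left hza
      · rw [Wh_union]
        · congr 1
          ext z
          simp only [Set.mem_union, Set.mem_ofPred_eq]
          tauto
        · rintro z ⟨_, h1 | h1⟩ ⟨_, h2⟩
          · rw [h1]
          · exact absurd h1 h2
  · exact ⟨1, one_mem _, w, HY_perm hYD h1 h2, (one_mul _).symm, norm_perm' hYD h1 h2⟩

theorem closure_SS [Fintype V] [DecidableEq V] {D Y : Set V} (hYD : Y ⊆ D) :
    Subgroup.closure (SS D Y) = Gam D ⊓ fixQ Y := by
  apply le_antisymm
  · refine le_inf ?_ (closure_SS_fixQ hYD)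
    rw [Subgroup.closure_le]
    exact fun s hs => Om_sub (SS_sub_Om hs)
  · rintro f ⟨hf, hq⟩
    change f ∈ Gam D at hf
    rw [← closure_Om] at hf
    have : ∃ k ∈ Subgroup.closure (SS D Y), ∃ t ∈ HY Y, f = k * t ∧
        ∀ s ∈ Subgroup.closure (SS D Y), t * s * t⁻¹ ∈ Subgroup.closure (SS D Y) := by
      clear hq
      induction hf using Subgroup.closure_induction_left with
      | one => exact ⟨1, one_mem _, 1, one_mem _, by simp, by simp⟩
      | mul_left x hx y _ ih =>
        obtain ⟨k, hk, t, ht, rfl, h⟩ := ih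
        obtain ⟨k', hk', t', ht', rfl, h'⟩ := split_Om hYD hx
        have h'' := norm_all h'
        refine ⟨k' * (t' * k * t'⁻¹), mul_mem hk' (h'' k hk), t' * t, mul_mem ht' ht, by group, ?_⟩
        intro s hs
        have : t' * t * s * (t' * t)⁻¹ = t' * (t * s * t⁻¹) * t'⁻¹ := by group
        rw [this]
        exact h'' _ (h s hs)
      | inv_mul_cancel x hx y _ ih =>
        obtain ⟨k, hk, t, ht, rfl, h⟩ := ih
        obtain ⟨k', hk', t', ht', e, h'⟩ := split_Om hYD (Om_inv hx)
        rw [e]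
        have h'' := norm_all h'
        refine ⟨k' * (t' * k * t'⁻¹), mul_mem hk' (h'' k hk), t' * t, mul_mem ht' ht, by group, ?_⟩
        intro s hs
        have : t' * t * s * (t' * t)⁻¹ = t' * (t * s * t⁻¹) * t'⁻¹ := by group
        rw [this]
        exact h'' _ (h s hs)
    obtain ⟨k, hk, t, ht, rfl, _⟩ := this
    have hkq := closure_SS_fixQ hYD hk
    have : t ∈ fixQ Y := by
      have := mul_mem (inv_mem hkq) hq
      rwa [inv_mul_cancel_left] at this
    rw [HY_fixQ ht this, mul_one]
    exact hk

end norm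
end BirmanAux

namespace BirmanAux
open FreeGroup (of)

section inj

lemma conj_free_inj {J : Type} (e : J → ℕ) (he : Function.Injective e) :
    Function.Injective (FreeGroup.lift (fun j : J => of (0 : Fin 2) ^ (e j) * of 1 * (of 0 ^ (e j))⁻¹)) := by
  let σ : MulAut (FreeGroup ℤ) := FreeGroup.freeGroupCongr (Equiv.addRight (1 : ℤ))
  have hσ : ∀ i : ℕ, (σ ^ i) (of 0) = of (i : ℤ) := by
    intro i
    induction i with
    | zero => simp
    | succ i ih =>
      rw [pow_succ', MulAut.mul_apply, ih]
      simp [σ, FreeGroup.freeGroupCongr]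
  let T : FreeGroup (Fin 2) →* FreeGroup ℤ ⋊[MonoidHom.id _] MulAut (FreeGroup ℤ) :=
    FreeGroup.lift ![SemidirectProduct.inr σ, SemidirectProduct.inl (of 0)]
  have hT : T.comp (FreeGroup.lift (fun j : J => of (0 : Fin 2) ^ (e j) * of 1 * (of 0 ^ (e j))⁻¹)) =
      SemidirectProduct.inl.comp (FreeGroup.map (fun j : J => (e j : ℤ))) := by
    ext1 j
    simp only [MonoidHom.comp_apply, FreeGroup.lift_apply_of, FreeGroup.map.of, map_mul, map_inv, map_pow]
    simp only [T, FreeGroup.lift_apply_of, Matrix.cons_val_zero, Matrix.cons_val_one]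
    rw [← map_pow, ← map_inv, ← SemidirectProduct.inl_aut]
    simp [hσ]
  have h1 : Function.Injective (SemidirectProduct.inl.comp (FreeGroup.map (fun j : J => (e j : ℤ))) :
      FreeGroup J →* FreeGroup ℤ ⋊[MonoidHom.id _] MulAut (FreeGroup ℤ)) := by
    rw [MonoidHom.coe_comp]
    exact SemidirectProduct.inl_injective.comp (FreeGroup.map_injective (fun a b h => he (by exact_mod_cast h)))
  rw [← hT, MonoidHom.coe_comp] at h1
  exact h1.of_comp

lemma inj_lift {J M : Type} [Group M] (e : J → ℕ) (he : Function.Injective e) (ι : Fin 2 → J)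
    (r : FreeGroup J →* FreeGroup (Fin 2)) (hr : ∀ i, r (of (ι i)) = of i)
    (π : FreeGroup J →* M) (hπ : ∀ i, π (of (ι i)) = 1) (g : J → FreeGroup J) :
    ∃ φ : Monoid.End (FreeGroup J), Function.Injective φ ∧ ∀ j, π (φ (of j)) = π (g j) := by
  have hri : ∀ w, r (FreeGroup.map ι w) = w := by
    intro w
    have : r.comp (FreeGroup.map ι) = MonoidHom.id _ := by
      ext1 i
      simp [hr]
    exact DFunLike.congr_fun this w
  have hπi : ∀ w, π (FreeGroup.map ι w) = 1 := by
    intro w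
    have : π.comp (FreeGroup.map ι) = 1 := by
      ext1 i
      simp [hπ]
    exact DFunLike.congr_fun this w
  let φ : FreeGroup J →* FreeGroup J := FreeGroup.lift (fun j => g j * (FreeGroup.map ι (r (g j)))⁻¹ *
    FreeGroup.map ι (of (0 : Fin 2) ^ (e j) * of 1 * (of 0 ^ (e j))⁻¹))
  refine ⟨φ, ?_, ?_⟩
  · have h1 := conj_free_inj e he
    have : r.comp φ = FreeGroup.lift (fun j : J => of (0 : Fin 2) ^ (e j) * of 1 * (of 0 ^ (e j))⁻¹) := by
      ext1 j
      simp only [φ, MonoidHom.comp_apply, FreeGroup.lift_apply_of]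
      rw [map_mul, map_mul, map_inv, hri, hri]
      group
    rw [← this, MonoidHom.coe_comp] at h1
    exact h1.of_comp
  · intro j
    change π (φ (of j)) = _
    simp only [φ, FreeGroup.lift_apply_of]
    rw [map_mul, map_mul, map_inv, hπi, hπi]
    simp

end inj

section lpres
variable {M J : Type} [Group M]

def kap (κ : M → FreeGroup J) (φ : M → Monoid.End (FreeGroup J)) : List M → FreeGroup J
  | [] => 1
  | ω :: l => κ ω * φ ω (kap κ φ l)

def ph (φ : M → Monoid.End (FreeGroup J)) (l : List M) : Monoid.End (FreeGroup J) := (l.map φ).prod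

lemma ph_cons (φ : M → Monoid.End (FreeGroup J)) (ω : M) (l : List M) (w) : ph φ (ω :: l) w = φ ω (ph φ l w) := by
  simp [ph]

theorem lpres_core [Finite J] {Γ : Subgroup M} {Ω : Set M} {L : ℕ} (hfin : Ω.Finite) (hinv : ∀ ω ∈ Ω, ω⁻¹ ∈ Ω)
    (hΩΓ : ∀ ω ∈ Ω, ω ∈ Γ) (hP : Pres Γ Ω L) (hL : 2 ≤ L) (H : Subgroup M)
    (π : FreeGroup J →* M) (hπH : ∀ w, π w ∈ H → π w = 1)
    (κ : M → FreeGroup J) (φ : M → Monoid.End (FreeGroup J)) (t : M → M)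
    (ht : ∀ ω ∈ Ω, t ω ∈ H) (hκ : ∀ ω ∈ Ω, ω = π (κ ω) * t ω)
    (hφ : ∀ ω ∈ Ω, ∀ w, π (φ ω w) = t ω * π w * (t ω)⁻¹)
    (hJ : ∀ j, π (of j) = 1 ∨ (π (of j) ∈ Ω ∧ κ (π (of j)) = of j ∧ φ (π (of j)) = 1)) :
    ∃ (R : Finset (FreeGroup J)) (Φ : Finset (Monoid.End (FreeGroup J))),
      (∀ ψ ∈ Φ, ∃ ω ∈ Ω, ψ = φ ω) ∧
      Nonempty ((FreeGroup J ⧸ Subgroup.normalClosure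
          {w : FreeGroup J | ∃ ψ ∈ Submonoid.closure (Φ : Set (Monoid.End (FreeGroup J))),
              ∃ r ∈ R, w = ψ r}) ≃* π.range) := by
  classical
  let Rel : Set (List M) := {l | (∀ x ∈ l, x ∈ Ω) ∧ l.length ≤ L ∧ l.prod = 1}
  have hRel : Rel.Finite := by
    have : Finite Ω := hfin
    refine ((List.finite_length_le Ω L).image (List.map Subtype.val)).subset ?_
    rintro l ⟨h1, h2, _⟩
    refine ⟨l.attachWith (· ∈ Ω) h1, ?_, ?_⟩
    · simpa using h2
    · simp
  let R0 : Set (FreeGroup J) := {w | (∃ j, w = of j ∧ π (of j) = 1)} ∪ (kap κ φ '' Rel) ∪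
    ((fun p : List M × J => ph φ p.1 (of p.2) * (of p.2)⁻¹) '' (Rel ×ˢ Set.univ))
  have hR0 : R0.Finite := by
    refine Set.Finite.union (Set.Finite.union ?_ (hRel.image _)) ((hRel.prod Set.finite_univ).image _)
    refine (Set.finite_range (fun j : J => of j)).subset ?_
    rintro w ⟨j, rfl, _⟩
    exact ⟨j, rfl⟩
  let Φ := (hfin.image φ).toFinset
  let R := hR0.toFinset
  refine ⟨R, Φ, ?_, ?_⟩
  · intro ψ hψ
    simp only [Φ, Set.Finite.mem_toFinset] at hψ
    obtain ⟨ω, h, rfl⟩ := hψ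
    exact ⟨ω, h, rfl⟩
  set X := {w : FreeGroup J | ∃ ψ ∈ Submonoid.closure (Φ : Set (Monoid.End (FreeGroup J))),
              ∃ r ∈ R, w = ψ r} with hX
  set N := Subgroup.normalClosure X with hN
  have hRN : ∀ r ∈ R0, r ∈ N := by
    intro r hr
    exact Subgroup.subset_normalClosure ⟨1, one_mem _, r, by simpa [R] using hr, rfl⟩
  -- list identities
  have hprod : ∀ l : List M, (∀ x ∈ l, x ∈ Ω) → l.prod = π (kap κ φ l) * (l.map t).prod ∧ (l.map t).prod ∈ H ∧
      ∀ w, π (ph φ l w) = (l.map t).prod * π w * (l.map t).prod⁻¹ := by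
    intro l
    induction l with
    | nil => intro _; simp [kap, ph]
    | cons ω l ih =>
      intro h
      obtain ⟨i1, i2, i3⟩ := ih (fun x hx => h x (List.mem_cons_of_mem _ hx))
      have hω := h ω List.mem_cons_self
      refine ⟨?_, ?_, ?_⟩
      · rw [List.prod_cons, List.map_cons, List.prod_cons, kap, map_mul, hφ ω hω, i1]
        nth_rw 1 [hκ ω hω]
        group
      · rw [List.map_cons, List.prod_cons]; exact mul_mem (ht ω hω) i2
      · intro w
        rw [ph_cons, hφ ω hω, i3, List.map_cons, List.prod_cons]; group
  have hrel : ∀ l ∈ Rel, π (kap κ φ l) = 1 ∧ (l.map t).prod = 1 := by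
    rintro l ⟨h1, _, h3⟩
    obtain ⟨i1, i2, _⟩ := hprod l h1
    rw [h3] at i1
    have e : π (kap κ φ l) = (l.map t).prod⁻¹ := eq_inv_of_mul_eq_one_left i1.symm
    have h4 : π (kap κ φ l) = 1 := hπH _ (by rw [e]; exact inv_mem i2)
    refine ⟨h4, ?_⟩
    rw [h4, one_mul] at i1
    exact i1.symm
  have hR1 : ∀ r ∈ R0, π r = 1 := by
    rintro r ((⟨j, rfl, h⟩ | ⟨l, hl, rfl⟩) | ⟨⟨l, j⟩, ⟨hl, _⟩, rfl⟩)
    · exact h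
    · exact (hrel l hl).1
    · change π (ph φ l (of j) * (of j)⁻¹) = 1
      rw [map_mul, map_inv, (hprod l hl.1).2.2, (hrel l hl).2]; simp
  have hNker : N ≤ π.ker := by
    apply Subgroup.normalClosure_le_normal
    rintro w ⟨ψ, hψ, r, hr, rfl⟩
    have hker : ∀ w, π w = 1 → π (ψ w) = 1 := by
      induction hψ using Submonoid.closure_induction with
      | mem x hx =>
        simp only [Φ, Set.Finite.coe_toFinset] at hx
        obtain ⟨ω, hω, rfl⟩ := hx
        intro w hw
        rw [hφ ω hω, hw]; simp
      | one => intro w hw; exact hw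
      | mul x y _ _ h1 h2 => intro w hw; exact h1 _ (h2 w hw)
    exact hker r (hR1 r (by simpa [R] using hr))
  have hφN : ∀ ω ∈ Ω, N ≤ N.comap (φ ω : FreeGroup J →* FreeGroup J) := by
    intro ω hω
    haveI : (N.comap (φ ω : FreeGroup J →* FreeGroup J)).Normal := Subgroup.Normal.comap inferInstance _
    apply Subgroup.normalClosure_le_normal
    rintro w ⟨ψ, hψ, r, hr, rfl⟩
    refine Subgroup.subset_normalClosure ⟨φ ω * ψ, mul_mem (Submonoid.subset_closure ?_) hψ, r, hr, rfl⟩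
    simp only [Φ, Set.Finite.coe_toFinset]
    exact ⟨ω, hω, rfl⟩
  -- the action
  let mkN : FreeGroup J →* FreeGroup J ⧸ N := QuotientGroup.mk' N
  have hmk : Function.Surjective mkN := QuotientGroup.mk'_surjective N
  have hmk1 : ∀ w, w ∈ N → mkN w = 1 := fun w hw => (QuotientGroup.eq_one_iff w).2 hw
  have hf : ∀ ω, ∃ f : FreeGroup J ⧸ N → FreeGroup J ⧸ N, ω ∈ Ω → ∀ w, f (mkN w) = mkN (κ ω * φ ω w) := by
    intro ω
    by_cases hω : ω ∈ Ω
    · refine ⟨fun g => mkN (κ ω) * QuotientGroup.map N N (φ ω) (hφN ω hω) g, fun _ w => ?_⟩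
      rw [map_mul]
      rfl
    · exact ⟨id, fun h => absurd h hω⟩
  choose f hf using hf
  have hrelN : ∀ l ∈ Rel, ∀ w, mkN (kap κ φ l * ph φ l w) = mkN w := by
    intro l hl w
    rw [map_mul, hmk1 _ (hRN _ (Or.inl (Or.inr ⟨l, hl, rfl⟩))), one_mul]
    have : mkN.comp (ph φ l) = mkN := by
      ext1 j
      have := hmk1 _ (hRN _ (Or.inr ⟨(l, j), ⟨hl, Set.mem_univ _⟩, rfl⟩))
      simp only [map_mul, map_inv] at this
      exact mul_inv_eq_one.1 this
    exact DFunLike.congr_fun this w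
  have hff : ∀ ω ∈ Ω, ∀ g, f ω⁻¹ (f ω g) = g := by
    intro ω hω g
    obtain ⟨w, rfl⟩ := hmk g
    rw [hf ω hω, hf _ (hinv ω hω)]
    have := hrelN [ω⁻¹, ω] ⟨by simp [hω, hinv ω hω], by simpa using hL, by simp⟩ w
    rw [← this, ph_cons, ph_cons]
    simp [kap, ph, mul_assoc]
  let s : M → Equiv.Perm (FreeGroup J ⧸ N) := fun ω =>
    if h : ω ∈ Ω then ⟨f ω, f ω⁻¹, hff ω h, fun g => by
      have := hff _ (hinv ω h) g
      rwa [inv_inv] at this⟩ else 1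
  have hs : ∀ ω ∈ Ω, ∀ w, s ω (mkN w) = mkN (κ ω * φ ω w) := by
    intro ω hω w
    simp only [s, dif_pos hω]
    exact hf ω hω w
  have hsl : ∀ l : List M, (∀ x ∈ l, x ∈ Ω) → ∀ w, (l.map s).prod (mkN w) = mkN (kap κ φ l * ph φ l w) := by
    intro l
    induction l with
    | nil => intro _ w; simp [kap, ph]
    | cons ω l ih =>
      intro h w
      rw [List.map_cons, List.prod_cons, Equiv.Perm.mul_apply, ih (fun x hx => h x (List.mem_cons_of_mem _ hx)),
        hs ω (h ω List.mem_cons_self), kap, ph_cons, map_mul (φ ω), mul_assoc]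
  obtain ⟨Ψ, hΨ⟩ := hP (Equiv.Perm (FreeGroup J ⧸ N)) s (by
    intro l h1 h2 h3
    ext g
    obtain ⟨w, rfl⟩ := hmk g
    rw [hsl l h1, hrelN l ⟨h1, h2, h3⟩]; rfl)
  have hπΓ : ∀ w, π w ∈ Γ := by
    intro w
    have : (⊤ : Subgroup (FreeGroup J)) ≤ Γ.comap π := by
      rw [← FreeGroup.closure_range_of, Subgroup.closure_le]
      rintro _ ⟨j, rfl⟩
      change π (of j) ∈ Γ
      rcases hJ j with h | h
      · rw [h]; exact one_mem _
      · exact hΩΓ _ h.1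
    exact this (Subgroup.mem_top w)
  have key : Ψ.comp (π.codRestrict Γ hπΓ) = (MulAction.toPermHom (FreeGroup J ⧸ N) (FreeGroup J ⧸ N)).comp mkN := by
    ext1 j
    ext g
    obtain ⟨w, rfl⟩ := hmk g
    change Ψ ⟨π (of j), hπΓ _⟩ (mkN w) = mkN (of j) * mkN w
    rcases hJ j with h | ⟨h1, h2, h3⟩
    · have e : (⟨π (of j), hπΓ (of j)⟩ : Γ) = 1 := Subtype.ext h
      rw [e, map_one, hmk1 _ (hRN _ (Or.inl (Or.inl ⟨j, rfl, h⟩)))]; simp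
    · rw [hΨ _ _ h1, hs _ h1, h2, h3, map_mul]; rfl
  have hker : N = π.ker := by
    apply le_antisymm hNker
    intro w hw
    have h1 := DFunLike.congr_fun key w
    have e : π.codRestrict Γ hπΓ w = 1 := Subtype.ext hw
    rw [MonoidHom.comp_apply, e, map_one] at h1
    have h2 := DFunLike.congr_fun h1 (1 : FreeGroup J ⧸ N)
    have h3 : (1 : FreeGroup J ⧸ N) = mkN w * 1 := h2
    rw [mul_one] at h3
    exact (QuotientGroup.eq_one_iff w).1 h3.symm
  exact ⟨(QuotientGroup.quotientMulEquivOfEq hker).trans (QuotientGroup.quotientKerEquivRange π)⟩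

theorem lpres_fin {Γ : Subgroup M} {Ω S : Set M} {L : ℕ} (hfin : Ω.Finite) (hinv : ∀ ω ∈ Ω, ω⁻¹ ∈ Ω)
    (hΩΓ : ∀ ω ∈ Ω, ω ∈ Γ) (hP : Pres Γ Ω L) (hL : 2 ≤ L) (hS : S ⊆ Ω) (H : Subgroup M)
    (hSH : ∀ x ∈ Subgroup.closure S, x ∈ H → x = 1)
    (hsplit : ∀ ω ∈ Ω, ∃ k ∈ Subgroup.closure S, ∃ t ∈ H, ω = k * t ∧ ∀ s ∈ S, t * s * t⁻¹ ∈ Subgroup.closure S) :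
    ∃ (s : ℕ) (R : Finset (FreeGroup (Fin s))) (Φ : Finset (Monoid.End (FreeGroup (Fin s)))),
      (∀ φ ∈ Φ, Function.Injective φ) ∧
      Nonempty ((FreeGroup (Fin s) ⧸ Subgroup.normalClosure
          {w : FreeGroup (Fin s) |
            ∃ φ ∈ Submonoid.closure (Φ : Set (Monoid.End (FreeGroup (Fin s)))),
              ∃ r ∈ R, w = φ r}) ≃* ↥(Subgroup.closure S)) := by
  classical
  haveI : Finite S := hfin.subset hS
  obtain ⟨m, ⟨e'⟩⟩ := Finite.exists_equiv_fin S
  let e := e'.symm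
  let E : Fin m ⊕ Fin 2 ≃ Fin (m + 2) := finSumFinEquiv
  let v : Fin (m + 2) → M := fun j => Sum.elim (fun i => (e i : M)) (fun _ => 1) (E.symm j)
  have v1 : ∀ i, v (E (Sum.inl i)) = e i := fun i => by simp [v]
  have v2 : ∀ i, v (E (Sum.inr i)) = 1 := fun i => by simp [v]
  let π : FreeGroup (Fin (m + 2)) →* M := FreeGroup.lift v
  have hπ : ∀ j, π (of j) = v j := fun j => FreeGroup.lift_apply_of
  have hcase : ∀ j, (∃ i, j = E (Sum.inl i)) ∨ ∃ i, j = E (Sum.inr i) := by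
    intro j
    obtain ⟨x, rfl⟩ := E.surjective j
    rcases x with i | i
    · exact Or.inl ⟨i, rfl⟩
    · exact Or.inr ⟨i, rfl⟩
  have hrange : π.range = Subgroup.closure S := by
    rw [FreeGroup.range_lift_eq_closure]
    apply le_antisymm
    · rw [Subgroup.closure_le]
      rintro _ ⟨j, rfl⟩
      rcases hcase j with ⟨i, rfl⟩ | ⟨i, rfl⟩
      · rw [v1]; exact Subgroup.subset_closure (e i).2
      · rw [v2]; exact one_mem _
    · rw [Subgroup.closure_le]
      intro x hx
      refine Subgroup.subset_closure ⟨E (Sum.inl (e.symm ⟨x, hx⟩)), ?_⟩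
      rw [v1]; simp
  have hmem : ∀ x, x ∈ Subgroup.closure S → ∃ w, π w = x := by
    intro x hx
    rw [← hrange] at hx
    exact hx
  have hmem' : ∀ w, π w ∈ Subgroup.closure S := by
    intro w
    rw [← hrange]; exact ⟨w, rfl⟩
  have data : ∀ ω, ∃ (k : FreeGroup (Fin (m + 2))) (p : Monoid.End (FreeGroup (Fin (m + 2)))) (t : M), ω ∈ Ω →
      (t ∈ H ∧ ω = π k * t ∧ (∀ w, π (p w) = t * π w * t⁻¹) ∧ Function.Injective p ∧
        ∀ i, (e i : M) = ω → k = of (E (Sum.inl i)) ∧ p = 1) := by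
    intro ω
    by_cases hω : ω ∈ Ω
    · by_cases hωS : ω ∈ S
      · refine ⟨of (E (Sum.inl (e.symm ⟨ω, hωS⟩))), 1, 1, fun _ => ⟨one_mem _, ?_, ?_, ?_, ?_⟩⟩
        · rw [hπ, v1]; simp
        · intro w; simp
        · exact fun a b h => h
        · intro i hi
          have : e.symm ⟨ω, hωS⟩ = i := by
            rw [Equiv.symm_apply_eq]
            exact Subtype.ext hi.symm
          rw [this]
          exact ⟨rfl, rfl⟩
      · obtain ⟨k, hk, t, ht, h1, h2⟩ := hsplit ω hω
        obtain ⟨k', rfl⟩ := hmem k hk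
        have : ∀ j, ∃ g, π g = t * v j * t⁻¹ := by
          intro j
          rcases hcase j with ⟨i, rfl⟩ | ⟨i, rfl⟩
          · rw [v1]; exact hmem _ (h2 _ (e i).2)
          · rw [v2]; exact ⟨1, by simp⟩
        choose g hg using this
        obtain ⟨p, hp1, hp2⟩ := inj_lift (fun j : Fin (m + 2) => (j : ℕ)) Fin.val_injective (fun i => E (Sum.inr i))
          (FreeGroup.lift (fun j => Sum.elim (fun _ => 1) (fun i => of i) (E.symm j))) (by intro i; simp)
          π (by intro i; rw [hπ, v2]) g
        refine ⟨k', p, t, fun _ => ⟨ht, h1, ?_, hp1, ?_⟩⟩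
        · have : π.comp p = (MulAut.conj t).toMonoidHom.comp π := by
            ext1 j
            have h3 := hp2 j
            rw [hg, ← hπ] at h3
            exact h3
          intro w
          exact DFunLike.congr_fun this w
        · intro i hi
          exact absurd (by rw [← hi]; exact (e i).2) hωS
    · exact ⟨1, 1, 1, fun h => absurd h hω⟩
  choose κ φ t hdata using data
  obtain ⟨R, Φ, h1, ⟨h2⟩⟩ := lpres_core hfin hinv hΩΓ hP hL H π (fun w hw => hSH _ (hmem' w) hw) κ φ t
    (fun ω h => (hdata ω h).1) (fun ω h => (hdata ω h).2.1) (fun ω h => (hdata ω h).2.2.1) (by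
      intro j
      rw [hπ]
      rcases hcase j with ⟨i, rfl⟩ | ⟨i, rfl⟩
      · right
        rw [v1]
        have hΩ := hS (e i).2
        exact ⟨hΩ, (hdata _ hΩ).2.2.2.2 i rfl⟩
      · left; exact v2 i)
  refine ⟨m + 2, R, Φ, ?_, ⟨h2.trans (MulEquiv.subgroupCongr hrange)⟩⟩
  intro ψ hψ
  obtain ⟨ω, hω, rfl⟩ := h1 ψ hψ
  exact (hdata ω hω).2.2.2.1

theorem lpres_Gam {V : Type} [Fintype V] [DecidableEq V] (D Y : Set V) (hYD : Y ⊆ D) :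
    ∃ (s : ℕ) (R : Finset (FreeGroup (Fin s))) (Φ : Finset (Monoid.End (FreeGroup (Fin s)))),
      (∀ φ ∈ Φ, Function.Injective φ) ∧
      Nonempty ((FreeGroup (Fin s) ⧸ Subgroup.normalClosure
          {w : FreeGroup (Fin s) |
            ∃ φ ∈ Submonoid.closure (Φ : Set (Monoid.End (FreeGroup (Fin s)))),
              ∃ r ∈ R, w = φ r}) ≃* ↥(Gam D ⊓ fixQ Y)) := by
  rw [← closure_SS hYD]
  exact lpres_fin (Om_finite D) (fun _ h => Om_inv h) (fun _ h => Om_sub h) (pres_Om D) (by norm_num) SS_sub_Om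
    (HY Y) (fun x h1 h2 => HY_fixQ h2 (closure_SS_fixQ hYD h1)) (fun ω hω => split_Om hYD hω)

end lpres
end BirmanAux

namespace Birman

lemma K_eq (n k l : ℕ) : K n k l = BirmanAux.Gam (Set.range (Sum.inr : Fin k ⊕ Fin l → Gen n k l)) ⊓
    BirmanAux.fixQ (Set.range (fun j : Fin k => (Sum.inr (Sum.inl j) : Gen n k l))) := by
  set Y : Set (Gen n k l) := Set.range (fun j : Fin k => (Sum.inr (Sum.inl j) : Gen n k l)) with hY
  let ι : FG n 0 l →* FG n k l := FreeGroup.map (Sum.map id (Sum.map Fin.elim0 id))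
  have h1 : ∀ w, ι (proj n k l w) = BirmanAux.qY Y w := by
    have : ι.comp (proj n k l) = BirmanAux.qY Y := by
      ext1 v
      rcases v with i | j | m <;> simp [ι, proj, BirmanAux.qY, hY]
    exact fun w => DFunLike.congr_fun this w
  have h2 : ∀ w, proj n k l (BirmanAux.qY Y w) = proj n k l w := by
    have : (proj n k l).comp (BirmanAux.qY Y) = proj n k l := by
      ext1 v
      rcases v with i | j | m <;> simp [proj, BirmanAux.qY, hY]
    exact fun w => DFunLike.congr_fun this w
  have e1 : A n k l = BirmanAux.Gam (Set.range (Sum.inr : Fin k ⊕ Fin l → Gen n k l)) := by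
    ext f
    rw [BirmanAux.mem_Gam]
    refine ⟨?_, fun h s => h _ ⟨s, rfl⟩⟩
    rintro h _ ⟨s, rfl⟩
    exact h s
  have e2 : fixProj n k l = BirmanAux.fixQ Y := by
    ext f
    constructor
    · intro h w
      rw [← h1, ← h1, h w]
    · intro h w
      rw [← h2 (f w), h w, h2]
  rw [K, e1, e2]

/-- **Corollary (finite L-presentation).**  `K_{n,k,l}` admits a finite, ascending, injective
L-presentation: there are a finite generating set (of size `s`), a finite set `R` of relators
in the free group `F(S)`, and a finite set `Φ` of injective endomorphisms of `F(S)` such that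
`K_{n,k,l} ≅ F(S) / ⟪⋃_{φ ∈ Φ*} φ(R)⟫`, where `Φ*` is the submonoid of `End(F(S))` generated
by `Φ` (the closure of `Φ ∪ {id}` under composition). -/
theorem K_finite_L_presentation (n k l : ℕ) :
    ∃ (s : ℕ) (R : Finset (FreeGroup (Fin s))) (Φ : Finset (Monoid.End (FreeGroup (Fin s)))),
      (∀ φ ∈ Φ, Function.Injective φ) ∧
      Nonempty ((FreeGroup (Fin s) ⧸ Subgroup.normalClosure
          {w : FreeGroup (Fin s) |
            ∃ φ ∈ Submonoid.closure (Φ : Set (Monoid.End (FreeGroup (Fin s)))),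
              ∃ r ∈ R, w = φ r}) ≃* ↥(K n k l)) := by
  rw [K_eq]
  apply BirmanAux.lpres_Gam
  rintro _ ⟨j, rfl⟩
  exact ⟨_, rfl⟩

end Birman
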